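/- For every α > 0 the limit D(α) = lim_{n→∞} det M_n(α) exists and is a positive real number, and Dyson's asymptotic formula holds: lim_{α→∞} ( log D(2α) + α²/2 + (log α)/4 ) = (log 2)/12 + 3ζ'(−1), where ζ'(−1) is the derivative of the Riemann zeta function at −1. -/

import Mathlib

open Filter

noncomputable section

/-- The sine kernel: `K x = sin x / (π x)` for `x ≠ 0`, and `K 0 = 1/π`. -/
def sineKernel (x : ℝ) : ℝ := if x = 0 then 1 / Real.pi else Real.sin x / (Real.pi * x)

/-- The `n × n` matrix `M_n(α)` with entries `δ_{jk} − (α/n) K(α(j−k)/n)`. -/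
def sineMatrix (n : ℕ) (α : ℝ) : Matrix (Fin n) (Fin n) ℝ :=
  Matrix.of fun j k =>
    (if j = k then 1 else 0) - (α / n) * sineKernel (α * ((j : ℝ) - (k : ℝ)) / n)

/-- Error bound for the trapezoidal rule with first-derivative correction. -/
theorem norm_trapezoid_le {F f f₁ f₂ f₃ f₄ : ℝ → ℂ} {a M : ℝ}
    (hF : ∀ x ∈ Set.Icc a (a + 1), HasDerivAt F (f x) x)
    (hf : ∀ x ∈ Set.Icc a (a + 1), HasDerivAt f (f₁ x) x)
    (hf₁ : ∀ x ∈ Set.Icc a (a + 1), HasDerivAt f₁ (f₂ x) x)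
    (hf₂ : ∀ x ∈ Set.Icc a (a + 1), HasDerivAt f₂ (f₃ x) x)
    (hf₃ : ∀ x ∈ Set.Icc a (a + 1), HasDerivAt f₃ (f₄ x) x)
    (hM : ∀ x ∈ Set.Icc a (a + 1), ‖f₄ x‖ ≤ M) :
    ‖F (a + 1) - F a - (f (a + 1) + f a) / 2 + (f₁ (a + 1) - f₁ a) / 12‖ ≤ M := by
  have hM0 : 0 ≤ M := (norm_nonneg _).trans (hM a ⟨le_rfl, by linarith⟩)
  have key : ∀ {e e' : ℝ → ℂ} {K : ℝ}, (∀ t ∈ Set.Icc (0:ℝ) 1, HasDerivAt e (e' t) t) →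
      e 0 = 0 → (∀ t ∈ Set.Icc (0:ℝ) 1, ‖e' t‖ ≤ K) → ∀ t ∈ Set.Icc (0:ℝ) 1, ‖e t‖ ≤ K := by
    intro e e' K h h0 hK t ht
    have hK0 : 0 ≤ K := (norm_nonneg _).trans (hK t ht)
    have := (convex_Icc (0:ℝ) 1).norm_image_sub_le_of_norm_hasDerivWithin_le
      (fun x hx => (h x hx).hasDerivWithinAt) hK (show (0:ℝ) ∈ Set.Icc (0:ℝ) 1 by simp) ht
    rw [h0, sub_zero, sub_zero, Real.norm_eq_abs, abs_of_nonneg ht.1] at this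
    nlinarith [ht.2]
  have hy : ∀ t ∈ Set.Icc (0:ℝ) 1, a + 1 - t ∈ Set.Icc a (a + 1) :=
    fun t ht => ⟨by linarith [ht.2], by linarith [ht.1]⟩
  have hsub : ∀ t : ℝ, HasDerivAt (fun t : ℝ => a + 1 - t) (-1) t := fun t => by
    simpa using (hasDerivAt_id t).const_sub (a + 1)
  have comp : ∀ {g g' : ℝ → ℂ}, (∀ x ∈ Set.Icc a (a + 1), HasDerivAt g (g' x) x) →
      ∀ t ∈ Set.Icc (0:ℝ) 1, HasDerivAt (fun t => g (a + 1 - t)) (-g' (a + 1 - t)) t := by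
    intro g g' h t ht
    exact ((h _ (hy t ht)).scomp t (hsub t)).congr_deriv (by simp)
  have ht1 : ∀ t : ℝ, HasDerivAt (fun t : ℝ => (t : ℂ)) 1 t := fun t => by
    simpa using (hasDerivAt_id t).ofReal_comp
  let e : ℝ → ℂ := fun t => F (a + 1) - F (a + 1 - t) - t / 2 * (f (a + 1) + f (a + 1 - t))
    + t ^ 2 / 12 * (f₁ (a + 1) - f₁ (a + 1 - t))
  let e₁ : ℝ → ℂ := fun t => f (a + 1 - t) - (f (a + 1) + f (a + 1 - t)) / 2
    + t / 2 * f₁ (a + 1 - t) + t / 6 * (f₁ (a + 1) - f₁ (a + 1 - t))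
    + t ^ 2 / 12 * f₂ (a + 1 - t)
  let e₂ : ℝ → ℂ := fun t => (f₁ (a + 1) - f₁ (a + 1 - t)) / 6 - t / 6 * f₂ (a + 1 - t)
    - t ^ 2 / 12 * f₃ (a + 1 - t)
  let e₃ : ℝ → ℂ := fun t => t ^ 2 / 12 * f₄ (a + 1 - t)
  have he : ∀ t ∈ Set.Icc (0:ℝ) 1, HasDerivAt e (e₁ t) t := by
    intro t ht
    have := (((comp hF t ht).const_sub (F (a + 1))).sub
      (((ht1 t).div_const 2).mul ((comp hf t ht).const_add (f (a + 1))))).add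
      ((((ht1 t).pow 2).div_const 12).mul ((comp hf₁ t ht).const_sub (f₁ (a + 1))))
    refine this.congr_deriv ?_
    simp only [e₁, Pi.pow_apply]; push_cast; ring
  have he₁ : ∀ t ∈ Set.Icc (0:ℝ) 1, HasDerivAt e₁ (e₂ t) t := by
    intro t ht
    have := (((((comp hf t ht).sub (((comp hf t ht).const_add (f (a + 1))).div_const 2)).add
      (((ht1 t).div_const 2).mul (comp hf₁ t ht))).add
      (((ht1 t).div_const 6).mul ((comp hf₁ t ht).const_sub (f₁ (a + 1)))))).add
      ((((ht1 t).pow 2).div_const 12).mul (comp hf₂ t ht))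
    refine this.congr_deriv ?_
    simp only [e₂, Pi.pow_apply]; push_cast; ring
  have he₂ : ∀ t ∈ Set.Icc (0:ℝ) 1, HasDerivAt e₂ (e₃ t) t := by
    intro t ht
    have := ((((comp hf₁ t ht).const_sub (f₁ (a + 1))).div_const 6).sub
      (((ht1 t).div_const 6).mul (comp hf₂ t ht))).sub
      ((((ht1 t).pow 2).div_const 12).mul (comp hf₃ t ht))
    refine this.congr_deriv ?_
    simp only [e₃, Pi.pow_apply]; push_cast; ring
  have hb₃ : ∀ t ∈ Set.Icc (0:ℝ) 1, ‖e₃ t‖ ≤ M := by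
    intro t ht
    have h1 := hM _ (hy t ht)
    simp only [e₃, norm_mul, norm_div, norm_pow, Complex.norm_real, Real.norm_eq_abs,
      abs_of_nonneg ht.1]
    have : t ^ 2 ≤ 1 := by nlinarith [ht.1, ht.2]
    norm_num
    nlinarith [norm_nonneg (f₄ (a + 1 - t)), sq_nonneg t]
  have := key he (by simp [e]) (key he₁ (by simp [e₁])
    (key he₂ (by simp [e₂]) hb₃)) 1 (by simp)
  refine le_trans (le_of_eq ?_) this
  congr 1
  simp only [e]; push_cast; ring_nf

/-- The Euler-Maclaurin approximation of `∑_{j ≤ t} j ^ (-s) - ζ(s)`. -/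
noncomputable def zetaCorrection (t s : ℂ) : ℂ :=
  t ^ (1 - s) / (1 - s) + t ^ (-s) / 2 - s * t ^ (-s - 1) / 12

/-- The Euler-Maclaurin remainder between `i + 1` and `i + 2`. -/
noncomputable def zetaTerm (i : ℕ) (s : ℂ) : ℂ :=
  ((i : ℂ) + 2) ^ (-s) - zetaCorrection (i + 2) s + zetaCorrection (i + 1) s

theorem sum_zetaTerm (N : ℕ) (s : ℂ) :
    ∑ i ∈ Finset.range N, zetaTerm i s =
      ∑ j ∈ Finset.range (N + 1), ((j : ℂ) + 1) ^ (-s) - zetaCorrection (N + 1) s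
        - (1 - zetaCorrection 1 s) := by
  induction N with
  | zero => simp
  | succ N ih =>
    rw [Finset.sum_range_succ, ih, Finset.sum_range_succ _ (N + 1)]
    simp only [zetaTerm]; push_cast
    rw [show (N : ℂ) + 1 + 1 = N + 2 by ring]; ring

theorem hasDerivAt_ofReal_cpow_mul (c r : ℂ) {x : ℝ} (hx : 0 < x) :
    HasDerivAt (fun x : ℝ => c * (x : ℂ) ^ r) (c * (r * (x : ℂ) ^ (r - 1))) x := by
  by_cases hr : r = 0
  · simpa [hr] using hasDerivAt_const x c
  have h := (hasDerivAt_ofReal_cpow_const hx.ne' hr).const_mul c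
  exact h

theorem norm_zetaTerm_le (i : ℕ) {s : ℂ} (h1 : s ≠ 1) (hre : -(3 / 2) < s.re) (hs : ‖s‖ < 3) :
    ‖zetaTerm i s‖ ≤ 360 * ((i : ℝ) + 1) ^ (-(5 / 2) : ℝ) := by
  have hs1 : 1 - s ≠ 0 := sub_ne_zero.mpr (Ne.symm h1)
  have hpos : ∀ x ∈ Set.Icc ((i : ℝ) + 1) ((i : ℝ) + 1 + 1), 0 < x :=
    fun x hx => lt_of_lt_of_le (by positivity) hx.1
  have := norm_trapezoid_le (a := (i : ℝ) + 1)
    (M := 360 * ((i : ℝ) + 1) ^ (-(5 / 2) : ℝ))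
    (F := fun x => (1 / (1 - s)) * (x : ℂ) ^ (1 - s))
    (f := fun x => 1 * (x : ℂ) ^ (-s))
    (f₁ := fun x => (-s) * (x : ℂ) ^ (-s - 1))
    (f₂ := fun x => (-s) * (-s - 1) * (x : ℂ) ^ (-s - 2))
    (f₃ := fun x => (-s) * (-s - 1) * (-s - 2) * (x : ℂ) ^ (-s - 3))
    (f₄ := fun x => (-s) * (-s - 1) * (-s - 2) * (-s - 3) * (x : ℂ) ^ (-s - 4))
    (fun x hx => (hasDerivAt_ofReal_cpow_mul _ _ (hpos x hx)).congr_deriv (by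
      rw [← mul_assoc, one_div_mul_cancel hs1]; congr 2; ring))
    (fun x hx => (hasDerivAt_ofReal_cpow_mul _ _ (hpos x hx)).congr_deriv (by ring))
    (fun x hx => (hasDerivAt_ofReal_cpow_mul _ _ (hpos x hx)).congr_deriv (by
      rw [mul_assoc]; congr 3; ring))
    (fun x hx => (hasDerivAt_ofReal_cpow_mul _ _ (hpos x hx)).congr_deriv (by
      rw [← mul_assoc]; congr 2; ring))
    (fun x hx => (hasDerivAt_ofReal_cpow_mul _ _ (hpos x hx)).congr_deriv (by
      rw [← mul_assoc]; congr 2; ring))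
    ?_
  · refine le_trans (le_of_eq ?_) this
    rw [← norm_neg]
    congr 1
    simp only [zetaTerm, zetaCorrection]; push_cast
    rw [show (i : ℂ) + 1 + 1 = i + 2 by ring]; ring
  · intro x hx
    have hx0 := hpos x hx
    have n1 : ‖-s‖ ≤ 3 := by rw [norm_neg]; exact hs.le
    have n2 : ‖-s - 1‖ ≤ 4 := (norm_sub_le _ _).trans (by rw [norm_one]; linarith)
    have n3 : ‖-s - 2‖ ≤ 5 := (norm_sub_le _ _).trans (by norm_num; linarith [norm_neg s])
    have n4 : ‖-s - 3‖ ≤ 6 := (norm_sub_le _ _).trans (by norm_num; linarith [norm_neg s])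
    have n5 : ‖(x : ℂ) ^ (-s - 4)‖ ≤ ((i : ℝ) + 1) ^ (-(5 / 2) : ℝ) := by
      rw [Complex.norm_cpow_eq_rpow_re_of_pos hx0]
      calc x ^ (-s - 4).re ≤ x ^ (-(5 / 2) : ℝ) := by
            apply Real.rpow_le_rpow_of_exponent_le
            · have := hx.1; have : (0:ℝ) ≤ i := by positivity
              linarith
            · simp; linarith
        _ ≤ _ := Real.rpow_le_rpow_of_nonpos (by positivity) hx.1 (by norm_num)
    calc ‖(-s) * (-s - 1) * (-s - 2) * (-s - 3) * (x : ℂ) ^ (-s - 4)‖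
        = ‖-s‖ * ‖-s - 1‖ * ‖-s - 2‖ * ‖-s - 3‖ * ‖(x : ℂ) ^ (-s - 4)‖ := by simp only [norm_mul]
      _ ≤ 3 * 4 * 5 * 6 * ((i : ℝ) + 1) ^ (-(5 / 2) : ℝ) := by gcongr
      _ = _ := by ring

/-- The bounded region on which the Euler-Maclaurin series is summed. -/
def zetaRegion : Set ℂ := {s | s ≠ 1 ∧ -(3 / 2) < s.re ∧ ‖s‖ < 3}

theorem isOpen_zetaRegion : IsOpen zetaRegion :=
  isOpen_ne.inter ((isOpen_lt continuous_const Complex.continuous_re).inter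
    (isOpen_lt continuous_norm continuous_const))

theorem differentiableAt_zetaCorrection {t s : ℂ} (ht : t ≠ 0) (hs : s ≠ 1) :
    DifferentiableAt ℂ (zetaCorrection t) s := by
  have hs1 : 1 - s ≠ 0 := sub_ne_zero.mpr (Ne.symm hs)
  unfold zetaCorrection
  have h1 : DifferentiableAt ℂ (fun s : ℂ => t ^ (1 - s)) s :=
    ((differentiableAt_const _).sub differentiableAt_id).const_cpow (Or.inl ht)
  have h2 : DifferentiableAt ℂ (fun s : ℂ => t ^ (- s)) s :=
    (differentiableAt_id.neg).const_cpow (Or.inl ht)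
  have h3 : DifferentiableAt ℂ (fun s : ℂ => t ^ (- s - 1)) s :=
    (differentiableAt_id.neg.sub (differentiableAt_const _)).const_cpow (Or.inl ht)
  exact ((h1.div ((differentiableAt_const _).sub differentiableAt_id) hs1).add
    (h2.div_const _)).sub ((differentiableAt_id.mul h3).div_const _)

theorem natCast_add_ne_zero (i k : ℕ) (hk : k ≠ 0) : (i : ℂ) + k ≠ 0 := by
  norm_cast; omega

theorem differentiableAt_zetaTerm (i : ℕ) {s : ℂ} (hs : s ≠ 1) :
    DifferentiableAt ℂ (zetaTerm i) s := by
  have h1 : (i : ℂ) + 1 ≠ 0 := by simpa using natCast_add_ne_zero i 1 one_ne_zero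
  have h2 : (i : ℂ) + 2 ≠ 0 := by simpa using natCast_add_ne_zero i 2 two_ne_zero
  exact ((differentiableAt_id.neg.const_cpow (Or.inl h2)).sub
    (differentiableAt_zetaCorrection h2 hs)).add (differentiableAt_zetaCorrection h1 hs)

theorem summable_zetaBound : Summable fun i : ℕ => 360 * ((i : ℝ) + 1) ^ (-(5 / 2) : ℝ) := by
  apply Summable.mul_left
  have := (summable_nat_add_iff 1).mpr
    (Real.summable_nat_rpow (p := -(5 / 2)).mpr (by norm_num))
  simpa using this

theorem tendsto_zetaCorrection {s : ℂ} (hs : 1 < s.re) :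
    Tendsto (fun N : ℕ => zetaCorrection (N + 1) s) atTop (nhds 0) := by
  have key : ∀ r : ℂ, r.re < 0 →
      Tendsto (fun N : ℕ => ((N : ℂ) + 1) ^ r) atTop (nhds 0) := by
    intro r hr
    rw [tendsto_zero_iff_norm_tendsto_zero]
    have : ∀ N : ℕ, ‖((N : ℂ) + 1) ^ r‖ = ((N + 1 : ℕ) : ℝ) ^ (- (-r.re)) := by
      intro N
      rw [show ((N : ℂ) + 1) = (((N + 1 : ℕ) : ℝ) : ℂ) by push_cast; ring,
        Complex.norm_cpow_eq_rpow_re_of_pos (by positivity), neg_neg]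
    simp_rw [this]
    exact (tendsto_rpow_neg_atTop (by linarith)).comp
      (tendsto_natCast_atTop_atTop.comp (tendsto_add_atTop_nat 1))
  have h1 := (key (1 - s) (by simp; linarith)).div_const (1 - s)
  have h2 := (key (-s) (by simp; linarith)).div_const 2
  have h3 := ((key (-s - 1) (by simp; linarith)).const_mul s).div_const 12
  simpa [zetaCorrection] using (h1.add h2).sub h3

/-- The Euler-Maclaurin series for the zeta function to the right of `1`. -/
theorem riemannZeta_eq_of_one_lt_re {s : ℂ} (hs : 1 < s.re) (hb : ‖s‖ < 3) :
    riemannZeta s = 1 - zetaCorrection 1 s + ∑' i, zetaTerm i s := by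
  have h1 : s ≠ 1 := by rintro rfl; simp at hs
  have hsum : Summable fun i => zetaTerm i s :=
    Summable.of_norm_bounded summable_zetaBound
      (fun i => norm_zetaTerm_le i h1 (by linarith) hb)
  have t1 := hsum.hasSum.tendsto_sum_nat
  have hz : Summable fun n : ℕ => 1 / ((n : ℂ) + 1) ^ s := by
    have := (summable_nat_add_iff 1).mpr (Complex.summable_one_div_nat_cpow.mpr hs)
    simpa using this
  have t2 := (hz.hasSum.tendsto_sum_nat.comp (tendsto_add_atTop_nat 1))
  rw [← zeta_eq_tsum_one_div_nat_add_one_cpow hs] at t2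
  have t3 := (t2.sub (tendsto_zetaCorrection hs)).sub_const (1 - zetaCorrection 1 s)
  have := tendsto_nhds_unique t1 (t3.congr fun N => by
    rw [sum_zetaTerm]; simp [Complex.cpow_neg])
  rw [this]; ring

theorem riemannZeta_eq_near_neg_one :
    riemannZeta =ᶠ[nhds (-1)] fun s => 1 - zetaCorrection 1 s + ∑' i, zetaTerm i s := by
  set g : ℂ → ℂ := fun s => 1 - zetaCorrection 1 s + ∑' i, zetaTerm i s
  have hg : DifferentiableOn ℂ g zetaRegion := by
    refine ((differentiableOn_const _).sub fun s hs =>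
      (differentiableAt_zetaCorrection one_ne_zero hs.1).differentiableWithinAt).add ?_
    exact Complex.differentiableOn_tsum_of_summable_norm summable_zetaBound
      (fun i s hs => (differentiableAt_zetaTerm i hs.1).differentiableWithinAt)
      isOpen_zetaRegion (fun i s hs => norm_zetaTerm_le i hs.1 hs.2.1 hs.2.2)
  have hext : ∀ U : Set ℂ, IsOpen U → Convex ℝ U → U ⊆ zetaRegion → ∀ z ∈ U,
      riemannZeta =ᶠ[nhds z] g → Set.EqOn riemannZeta g U := by
    intro U hU hc hsub z hz he
    have a1 : AnalyticOnNhd ℂ riemannZeta U := DifferentiableOn.analyticOnNhd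
      (fun s hs => (differentiableAt_riemannZeta (hsub hs).1).differentiableWithinAt) hU
    exact a1.eqOn_of_preconnected_of_eventuallyEq ((hg.mono hsub).analyticOnNhd hU)
      hc.isPreconnected hz he
  have hball : Convex ℝ {s : ℂ | ‖s‖ < 3} := by
    have := convex_ball (0 : ℂ) 3
    simpa [Metric.ball, dist_zero_right] using this
  have hre : IsOpen {s : ℂ | -(3 / 2) < s.re} := isOpen_lt continuous_const Complex.continuous_re
  have hno : IsOpen {s : ℂ | ‖s‖ < 3} := isOpen_lt continuous_norm continuous_const
  have e1 : Set.EqOn riemannZeta g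
      ({s : ℂ | 0 < s.im} ∩ ({s : ℂ | -(3 / 2) < s.re} ∩ {s : ℂ | ‖s‖ < 3})) := by
    refine hext _ ((isOpen_lt continuous_const Complex.continuous_im).inter (hre.inter hno))
      ((convex_halfSpace_im_gt _).inter ((convex_halfSpace_re_gt _).inter hball)) ?_ (2 + Complex.I)
      ?_ ?_
    · rintro s ⟨h1, h2, h3⟩
      refine ⟨?_, h2, h3⟩
      rintro rfl; simp at h1
    · refine ⟨by simp, by simp; norm_num, ?_⟩
      have : ‖(2 + Complex.I : ℂ)‖ ^ 2 = 5 := by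
        rw [← Complex.normSq_eq_norm_sq]; simp [Complex.normSq_apply]; norm_num
      show ‖(2 + Complex.I : ℂ)‖ < 3
      nlinarith [norm_nonneg (2 + Complex.I : ℂ)]
    · have : {s : ℂ | 1 < s.re} ∩ {s : ℂ | ‖s‖ < 3} ∈ nhds (2 + Complex.I) := by
        refine ((isOpen_lt continuous_const Complex.continuous_re).inter hno).mem_nhds
          ⟨by simp, ?_⟩
        have : ‖(2 + Complex.I : ℂ)‖ ^ 2 = 5 := by
          rw [← Complex.normSq_eq_norm_sq]; simp [Complex.normSq_apply]; norm_num
        show ‖(2 + Complex.I : ℂ)‖ < 3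
        nlinarith [norm_nonneg (2 + Complex.I : ℂ)]
      filter_upwards [this] with s hs
      exact riemannZeta_eq_of_one_lt_re hs.1 hs.2
  have hU2 : IsOpen ({s : ℂ | s.re < 1} ∩ ({s : ℂ | -(3 / 2) < s.re} ∩ {s : ℂ | ‖s‖ < 3})) :=
    (isOpen_lt Complex.continuous_re continuous_const).inter (hre.inter hno)
  have e2 : Set.EqOn riemannZeta g
      ({s : ℂ | s.re < 1} ∩ ({s : ℂ | -(3 / 2) < s.re} ∩ {s : ℂ | ‖s‖ < 3})) := by
    refine hext _ hU2
      ((convex_halfSpace_re_lt _).inter ((convex_halfSpace_re_gt _).inter hball)) ?_ Complex.I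
      ?_ ?_
    · rintro s ⟨h1, h2, h3⟩
      refine ⟨?_, h2, h3⟩
      rintro rfl; simp at h1
    · refine ⟨by simp, by simp, by simp⟩
    · filter_upwards [((isOpen_lt continuous_const Complex.continuous_im).inter
        (hre.inter hno)).mem_nhds (show Complex.I ∈ {s : ℂ | 0 < s.im} ∩
          ({s : ℂ | -(3 / 2) < s.re} ∩ {s : ℂ | ‖s‖ < 3}) from
          ⟨by simp, by simp, by simp⟩)] with s hs
      exact e1 hs
  filter_upwards [hU2.mem_nhds (show (-1 : ℂ) ∈ _ from
    ⟨by simp, by simp; norm_num, by simp⟩)] with s hs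
  exact e2 hs

theorem hasDerivAt_zetaCorrection_neg_one {t : ℝ} (ht : 0 < t) :
    HasDerivAt (zetaCorrection t)
      ((-(t ^ 2 / 2 + t / 2 + 1 / 12) * Real.log t + t ^ 2 / 4 - 1 / 12 : ℝ) : ℂ) (-1) := by
  have ht0 : (t : ℂ) ≠ 0 := by exact_mod_cast ht.ne'
  have h1 : HasDerivAt (fun s : ℂ => (t : ℂ) ^ (1 - s)) _ (-1) :=
    ((hasDerivAt_id (-1 : ℂ)).const_sub 1).const_cpow (Or.inl ht0)
  have h2 : HasDerivAt (fun s : ℂ => (t : ℂ) ^ (- s)) _ (-1) :=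
    (hasDerivAt_id (-1 : ℂ)).neg.const_cpow (Or.inl ht0)
  have h3 : HasDerivAt (fun s : ℂ => (t : ℂ) ^ (- s - 1)) _ (-1) :=
    ((hasDerivAt_id (-1 : ℂ)).neg.sub_const 1).const_cpow (Or.inl ht0)
  have h := ((h1.div ((hasDerivAt_id (-1 : ℂ)).const_sub 1) (by norm_num)).add
    (h2.div_const 2)).sub (((hasDerivAt_id (-1 : ℂ)).mul h3).div_const 12)
  refine h.congr_deriv ?_
  simp only [id, Pi.neg_apply]
  rw [← Complex.ofReal_log ht.le]
  norm_num
  ring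

theorem hasDerivAt_cpow_neg_one {t : ℝ} (ht : 0 < t) :
    HasDerivAt (fun s : ℂ => (t : ℂ) ^ (-s)) ((-(t * Real.log t) : ℝ) : ℂ) (-1) := by
  have ht0 : (t : ℂ) ≠ 0 := by exact_mod_cast ht.ne'
  refine ((hasDerivAt_id (-1 : ℂ)).neg.const_cpow (Or.inl ht0)).congr_deriv ?_
  simp only [id, Pi.neg_apply]
  rw [← Complex.ofReal_log ht.le]
  norm_num

/-- The asymptotics of `∑ j log j`, with the constant expressed by `ζ'(-1)`. -/
theorem tendsto_sum_mul_log :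
    Tendsto (fun N : ℕ => -∑ j ∈ Finset.range (N + 1), ((j : ℝ) + 1) * Real.log (j + 1)
      + (((N : ℝ) + 1) ^ 2 / 2 + ((N : ℝ) + 1) / 2 + 1 / 12) * Real.log (N + 1)
      - ((N : ℝ) + 1) ^ 2 / 4 + 1 / 12) atTop (nhds (deriv riemannZeta (-1)).re) := by
  have hmem : (-1 : ℂ) ∈ zetaRegion := ⟨by norm_num, by simp; norm_num, by simp⟩
  have hd := Complex.hasSum_deriv_of_summable_norm summable_zetaBound
      (fun i s hs => (differentiableAt_zetaTerm i hs.1).differentiableWithinAt)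
      isOpen_zetaRegion (fun i s hs => norm_zetaTerm_le i hs.1 hs.2.1 hs.2.2) hmem
  have hts : DifferentiableAt ℂ (fun s => ∑' i, zetaTerm i s) (-1) :=
    (Complex.differentiableOn_tsum_of_summable_norm summable_zetaBound
      (fun i s hs => (differentiableAt_zetaTerm i hs.1).differentiableWithinAt)
      isOpen_zetaRegion (fun i s hs => norm_zetaTerm_le i hs.1 hs.2.1 hs.2.2)).differentiableAt
      (isOpen_zetaRegion.mem_nhds hmem)
  have hc1 : HasDerivAt (zetaCorrection 1) ((1 / 4 - 1 / 12 : ℝ) : ℂ) (-1) := by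
    simpa using hasDerivAt_zetaCorrection_neg_one one_pos
  have hz : deriv riemannZeta (-1) =
      - ((1 / 4 - 1 / 12 : ℝ) : ℂ) + deriv (fun s => ∑' i, zetaTerm i s) (-1) := by
    rw [riemannZeta_eq_near_neg_one.deriv_eq]
    have := (hc1.const_sub 1).add hts.hasDerivAt
    rw [show (fun s => 1 - zetaCorrection 1 s + ∑' i, zetaTerm i s) = (fun s => 1 - zetaCorrection 1 s) + fun s => ∑' i, zetaTerm i s from rfl, this.deriv]
  have t1 := hd.tendsto_sum_nat
  have hfin : ∀ N : ℕ, ∑ i ∈ Finset.range N, deriv (zetaTerm i) (-1) =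
      ((-∑ j ∈ Finset.range (N + 1), ((j : ℝ) + 1) * Real.log (j + 1)
      + (((N : ℝ) + 1) ^ 2 / 2 + ((N : ℝ) + 1) / 2 + 1 / 12) * Real.log (N + 1)
      - ((N : ℝ) + 1) ^ 2 / 4 + 1 / 12 + (1 / 4 - 1 / 12) : ℝ) : ℂ) := by
    intro N
    have h0 : ∑ i ∈ Finset.range N, deriv (zetaTerm i) (-1) =
        deriv (fun s => ∑ i ∈ Finset.range N, zetaTerm i s) (-1) := by
      rw [deriv_fun_sum]
      exact fun i _ => differentiableAt_zetaTerm i (by norm_num)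
    rw [h0]
    simp_rw [sum_zetaTerm]
    have hs1 : HasDerivAt (fun s : ℂ => ∑ j ∈ Finset.range (N + 1), ((j : ℂ) + 1) ^ (-s))
        (∑ j ∈ Finset.range (N + 1), ((-(((j : ℝ) + 1) * Real.log (j + 1)) : ℝ) : ℂ)) (-1) := by
      refine HasDerivAt.fun_sum fun j _ => ?_
      have := hasDerivAt_cpow_neg_one (t := (j : ℝ) + 1) (by positivity)
      simpa using this
    have hN := hasDerivAt_zetaCorrection_neg_one (t := (N : ℝ) + 1) (by positivity)
    have := (hs1.sub (by simpa using hN)).sub (hc1.const_sub 1)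
    rw [show (fun s : ℂ => ∑ j ∈ Finset.range (N + 1), ((j : ℂ) + 1) ^ (-s) - zetaCorrection (N + 1) s
        - (1 - zetaCorrection 1 s)) = (fun s : ℂ => ∑ j ∈ Finset.range (N + 1), ((j : ℂ) + 1) ^ (-s)) - zetaCorrection (N + 1) - (fun s => 1 - zetaCorrection 1 s) from rfl, this.deriv]
    push_cast
    rw [Finset.sum_neg_distrib]
    ring
  simp_rw [hfin] at t1
  have t2 := (Complex.continuous_re.tendsto _).comp t1
  have t3 := t2.sub_const (1 / 4 - 1 / 12)
  rw [hz]
  convert t3 using 1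
  · ext N
    simp only [Function.comp, Complex.ofReal_re]; ring
  · congr 1
    simp only [Complex.add_re, Complex.neg_re, Complex.ofReal_re]; ring

/-- The `n × n` Hilbert matrix. -/
noncomputable def hilbertMatrix (n : ℕ) : Matrix (Fin n) (Fin n) ℝ :=
  Matrix.of fun i j => 1 / ((i : ℝ) + j + 1)

/-- The coefficients of the monomials in the shifted Legendre basis. -/
noncomputable def legendreCoeff (i k : ℕ) : ℝ :=
  if k ≤ i then (i.factorial : ℝ) ^ 2 / ((i - k).factorial * (i + k + 1).factorial) else 0

theorem sum_legendreCoeff_mul (i j : ℕ) :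
    ∀ N, i < N → ∑ k ∈ Finset.range N, legendreCoeff i k * (2 * k + 1) * legendreCoeff j k =
      1 / ((i : ℝ) + j + 1) := by
  let a : ℕ → ℝ := fun k => if k ≤ i ∧ k ≤ j then
    (i.factorial : ℝ) ^ 2 * (j.factorial : ℝ) ^ 2 / ((i - k).factorial * (i + k).factorial *
      ((j - k).factorial * (j + k).factorial)) / ((i : ℝ) + j + 1) else 0
  have hij : (i : ℝ) + j + 1 ≠ 0 := by positivity
  have step : ∀ k, legendreCoeff i k * (2 * k + 1) * legendreCoeff j k = a k - a (k + 1) := by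
    intro k
    have fne : ∀ m : ℕ, (m.factorial : ℝ) ≠ 0 := fun m => by positivity
    have e1 : ∀ m : ℕ, ((m + k + 1).factorial : ℝ) = (m + k + 1) * (m + k).factorial := by
      intro m; rw [Nat.factorial_succ]; push_cast; ring
    by_cases hi : k ≤ i
    · by_cases hj : k ≤ j
      · have p1 : ((i : ℝ) + k + 1) ≠ 0 := by positivity
        have p2 : ((j : ℝ) + k + 1) ≠ 0 := by positivity
        by_cases hk : k + 1 ≤ i ∧ k + 1 ≤ j
        · obtain ⟨u, rfl⟩ := Nat.exists_eq_add_of_le hk.1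
          obtain ⟨v, rfl⟩ := Nat.exists_eq_add_of_le hk.2
          have e3 : ∀ m : ℕ, k + 1 + m - k = m + 1 := fun m => by omega
          have e4 : ∀ m : ℕ, k + 1 + m - (k + 1) = m := fun m => by omega
          simp only [legendreCoeff, a, if_pos hi, if_pos hj, if_pos hk, if_pos (And.intro hi hj),
            e3, e4, ← add_assoc, Nat.factorial_succ]
          push_cast
          have q1 : ((u : ℝ) + 1) ≠ 0 := by positivity
          have q2 : ((v : ℝ) + 1) ≠ 0 := by positivity
          have q3 := fne (k + 1 + u + k)
          have q4 := fne (k + 1 + v + k)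
          push_cast at hij p1 p2
          field_simp
          ring
        · have hk' : i = k ∨ j = k := by omega
          have : a (k + 1) = 0 := if_neg hk
          rw [this, sub_zero]
          simp only [legendreCoeff, a, if_pos hi, if_pos hj, if_pos (And.intro hi hj), e1]
          have q3 := fne (i + k)
          have q4 := fne (j + k)
          have q1 := fne (i - k)
          have q2 := fne (j - k)
          field_simp
          rcases hk' with h | h <;> subst h <;> ring
      · simp [legendreCoeff, a, hj, show ¬ (k + 1 ≤ j) by omega]
    · simp [legendreCoeff, a, hi, show ¬ (k + 1 ≤ i) by omega]
  intro N hN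
  simp_rw [step]
  rw [Finset.sum_range_sub']
  have h0 : a N = 0 := if_neg (by omega)
  rw [h0]
  have p1 : (i.factorial : ℝ) ≠ 0 := by positivity
  have p2 : (j.factorial : ℝ) ≠ 0 := by positivity
  simp only [a, zero_le, and_self, if_true, Nat.sub_zero, add_zero, sub_zero]
  field_simp

theorem det_hilbertMatrix (n : ℕ) :
    (hilbertMatrix n).det =
      ∏ k ∈ Finset.range n, (2 * (k : ℝ) + 1) *
        ((k.factorial : ℝ) ^ 2 / (2 * k + 1).factorial) ^ 2 := by
  let L : Matrix (Fin n) (Fin n) ℝ := Matrix.of fun i k => legendreCoeff i k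
  let d : Fin n → ℝ := fun k => 2 * (k : ℝ) + 1
  have hL : L.BlockTriangular OrderDual.toDual := by
    intro i j hij
    have hlt : (i : ℕ) < j := hij
    exact if_neg (not_le.mpr hlt)
  have hdet : L.det = ∏ k : Fin n, legendreCoeff k k := Matrix.det_of_isLowerTriangular L hL
  have hmul : hilbertMatrix n = L * Matrix.diagonal d * L.transpose := by
    ext i j
    rw [Matrix.mul_apply]
    simp only [Matrix.mul_diagonal, Matrix.transpose_apply, hilbertMatrix, Matrix.of_apply, L, d]
    rw [← sum_legendreCoeff_mul i j n i.2, Finset.sum_range]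
  rw [hmul, Matrix.det_mul, Matrix.det_mul, Matrix.det_transpose, Matrix.det_diagonal, hdet,
    Finset.prod_range, ← Finset.prod_mul_distrib, ← Finset.prod_mul_distrib]
  refine Finset.prod_congr rfl fun k _ => ?_
  simp only [legendreCoeff, le_refl, if_true, Nat.sub_self, Nat.factorial_zero, d]
  rw [show (k : ℕ) + k + 1 = 2 * k + 1 by ring]
  push_cast; ring

theorem det_hilbertMatrix_pos (n : ℕ) : 0 < (hilbertMatrix n).det := by
  rw [det_hilbertMatrix]
  exact Finset.prod_pos fun k _ => by positivity

/-- The logarithm of the superfactorial. -/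
noncomputable def logSuperfactorial (n : ℕ) : ℝ := ∑ i ∈ Finset.range n, Real.log i.factorial

theorem log_det_hilbertMatrix (n : ℕ) :
    Real.log (hilbertMatrix n).det = 4 * logSuperfactorial n - logSuperfactorial (2 * n) := by
  rw [det_hilbertMatrix, Real.log_prod (fun k _ => by positivity)]
  have : logSuperfactorial (2 * n) = ∑ k ∈ Finset.range n,
      (2 * Real.log (2 * k + 1).factorial - Real.log (2 * k + 1)) := by
    unfold logSuperfactorial
    induction n with
    | zero => simp
    | succ n ih =>
      rw [show 2 * (n + 1) = 2 * n + 1 + 1 by ring, Finset.sum_range_succ, Finset.sum_range_succ,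
        ih, Finset.sum_range_succ, Nat.factorial_succ (2 * n)]
      push_cast
      rw [Real.log_mul (by positivity) (by positivity)]
      ring
  rw [this, logSuperfactorial, Finset.mul_sum, ← Finset.sum_sub_distrib]
  refine Finset.sum_congr rfl fun k _ => ?_
  rw [Real.log_mul (by positivity) (by positivity), Real.log_pow, Real.log_div (by positivity)
    (by positivity), Real.log_pow]
  push_cast; ring

theorem logSuperfactorial_eq (n : ℕ) :
    logSuperfactorial n = n * Real.log n.factorial -
      ∑ j ∈ Finset.range n, ((j : ℝ) + 1) * Real.log (j + 1) := by
  unfold logSuperfactorial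
  induction n with
  | zero => simp
  | succ n ih =>
    rw [Finset.sum_range_succ, ih, Finset.sum_range_succ, Nat.factorial_succ]
    push_cast
    rw [Real.log_mul (by positivity) (by positivity)]
    ring

theorem tendsto_mul_log_stirlingSeq :
    Tendsto (fun n : ℕ => (n : ℝ) * (Real.log (Stirling.stirlingSeq n) - Real.log Real.pi / 2))
      atTop (nhds (1 / 12)) := by
  have hlim : Tendsto (fun n : ℕ => Real.log (Stirling.stirlingSeq n)) atTop
      (nhds (Real.log Real.pi / 2)) := by
    rw [← Real.log_sqrt Real.pi_pos.le]
    exact (Real.continuousAt_log (by positivity)).tendsto.comp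
      Stirling.tendsto_stirlingSeq_sqrt_pi
  have hcast : Tendsto (fun n : ℕ => (n : ℝ)) atTop atTop := tendsto_natCast_atTop_atTop
  have hinv1 : Tendsto (fun n : ℕ => 1 / (12 * (n : ℝ))) atTop (nhds 0) := by
    have := tendsto_const_nhds (x := (1:ℝ)) |>.div_atTop (hcast.const_mul_atTop (show (0:ℝ) < 12 by norm_num))
    simpa using this
  have hinv2 : Tendsto (fun n : ℕ => 1 / (12 * ((n : ℝ) + 1 / 2))) atTop (nhds 0) := by
    have := tendsto_const_nhds (x := (1:ℝ)) |>.div_atTop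
      ((tendsto_atTop_add_const_right _ (1 / 2) hcast).const_mul_atTop
        (show (0:ℝ) < 12 by norm_num))
    simpa using this
  have hmono : ∀ f : ℕ → ℝ, Tendsto f atTop (nhds 0) → (∀ n ≥ 1, f (n + 1) ≤ f n) →
      ∀ n ≥ 1, 0 ≤ f n := by
    intro f hf hs n hn
    refine le_of_tendsto' ((tendsto_add_atTop_iff_nat n).mpr hf) fun m => ?_
    induction m with
    | zero => simp
    | succ m ih =>
      rw [show m + 1 + n = m + n + 1 by ring]
      exact (hs _ (by omega)).trans ih
  have hup : ∀ n : ℕ, n ≥ 1 → 0 ≤ 1 / (12 * (n : ℝ)) -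
      (Real.log (Stirling.stirlingSeq n) - Real.log Real.pi / 2) := by
    refine hmono _ (by simpa using hinv1.sub (hlim.sub_const (Real.log Real.pi / 2))) ?_
    intro n hn
    have h := Stirling.log_stirlingSeq_sdiff_le n
    have hn' : (0:ℝ) < n := by exact_mod_cast hn
    have : 1 / (12 * (n : ℝ) * (n + 1)) = 1 / (12 * n) - 1 / (12 * (n + 1)) := by
      field_simp; ring
    push_cast
    linarith
  have hlo : ∀ n : ℕ, n ≥ 1 → 0 ≤ (Real.log (Stirling.stirlingSeq n) - Real.log Real.pi / 2) -
      1 / (12 * ((n : ℝ) + 1 / 2)) := by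
    refine hmono _ (by simpa using (hlim.sub_const (Real.log Real.pi / 2)).sub hinv2) ?_
    intro n hn
    obtain ⟨m, rfl⟩ := Nat.exists_eq_add_of_le' hn
    have h := (Stirling.log_stirlingSeq_sdiff_hasSum m)
    have h0 := le_hasSum h 0 (fun j _ => by positivity)
    have : 1 / (12 * (((m + 1 : ℕ) : ℝ) + 1 / 2)) - 1 / (12 * (((m + 1 + 1 : ℕ) : ℝ) + 1 / 2)) ≤
        1 / (2 * ((0 + 1 : ℕ) : ℝ) + 1) * ((1 / (2 * ((m + 1 : ℕ) : ℝ) + 1)) ^ 2) ^ (0 + 1) := by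
      push_cast
      have hm : (0:ℝ) ≤ m := by positivity
      rw [div_sub_div _ _ (by positivity) (by positivity), pow_one, div_pow,
        div_mul_div_comm, div_le_div_iff₀ (by positivity) (by positivity)]
      nlinarith [mul_nonneg hm hm, mul_nonneg hm (mul_nonneg hm hm)]
    rw [show m + 1 + 1 = m + 2 from rfl] at *
    linarith
  refine tendsto_of_tendsto_of_tendsto_of_le_of_le' (g := fun n : ℕ => (n : ℝ) * (1 / (12 * ((n : ℝ) + 1 / 2))))
    (h := fun _ => 1 / 12) ?_ tendsto_const_nhds ?_ ?_
  · have := (hinv2.const_mul (1 / 2)).const_sub (1 / 12)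
    simp only [mul_zero, sub_zero] at this
    refine this.congr fun n => ?_
    have : (n : ℝ) + 1 / 2 ≠ 0 := by positivity
    field_simp; ring
  · filter_upwards [eventually_ge_atTop 1] with n hn
    exact mul_le_mul_of_nonneg_left (by linarith [hlo n hn]) (by positivity)
  · filter_upwards [eventually_ge_atTop 1] with n hn
    have hn' : (0:ℝ) < n := by exact_mod_cast hn
    calc _ ≤ (n : ℝ) * (1 / (12 * n)) :=
          mul_le_mul_of_nonneg_left (by linarith [hup n hn]) (by positivity)
      _ = 1 / 12 := by field_simp

/-- Asymptotics of the superfactorial. -/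
theorem tendsto_logSuperfactorial :
    Tendsto (fun n : ℕ => logSuperfactorial n - ((n : ℝ) ^ 2 / 2 * Real.log n - 3 * n ^ 2 / 4
      + n / 2 * Real.log (2 * Real.pi) - Real.log n / 12)) atTop
      (nhds (deriv riemannZeta (-1)).re) := by
  rw [← tendsto_add_atTop_iff_nat 1]
  have h := (((tendsto_add_atTop_iff_nat 1).mpr tendsto_mul_log_stirlingSeq).sub_const
    (1 / 12)).add tendsto_sum_mul_log
  rw [sub_self, zero_add] at h
  refine h.congr fun n => ?_
  rw [logSuperfactorial_eq, Stirling.log_stirlingSeq_formula,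
    Real.log_div (by positivity) (by positivity), Real.log_exp,
    Real.log_mul two_ne_zero (by positivity), Real.log_mul two_ne_zero (by positivity)]
  push_cast
  ring

theorem tendsto_log_det_hilbertMatrix :
    Tendsto (fun n : ℕ => 2 * (n : ℝ) ^ 2 * Real.log 2 - n * Real.log (2 * Real.pi)
      + Real.log (hilbertMatrix n).det + Real.log n / 4) atTop
      (nhds (Real.log 2 / 12 + 3 * (deriv riemannZeta (-1)).re)) := by
  have h2 : Tendsto (fun n : ℕ => 2 * n) atTop atTop :=
    tendsto_id.const_mul_atTop' (by norm_num)
  have h := ((tendsto_logSuperfactorial.const_mul 4).sub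
    (tendsto_logSuperfactorial.comp h2)).add_const (Real.log 2 / 12)
  rw [show ∀ z : ℝ, 4 * z - z + Real.log 2 / 12 = Real.log 2 / 12 + 3 * z from fun z => by ring] at h
  refine h.congr' ?_
  filter_upwards [eventually_ge_atTop 1] with n hn
  have hn' : (0:ℝ) < n := by exact_mod_cast hn
  simp only [Function.comp]
  rw [log_det_hilbertMatrix]
  push_cast
  rw [Real.log_mul two_ne_zero hn'.ne']
  ring

/-- The Toeplitz matrix of the characteristic function of the arc `θ < φ < 2π - θ`. -/
noncomputable def arcMatrix (n : ℕ) (θ : ℝ) : Matrix (Fin n) (Fin n) ℝ :=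
  Matrix.of fun j k => if j = k then 1 - θ / Real.pi
    else -(Real.sin (((j : ℝ) - k) * θ) / (Real.pi * ((j : ℝ) - k)))

/-- The vector `cos ((j - (n - 1) / 2) θ)`. -/
noncomputable def cosVec (n : ℕ) (θ : ℝ) : Fin n → ℝ := fun j => Real.cos (((j : ℝ) - (n - 1) / 2) * θ)

/-- The vector `sin ((j - (n - 1) / 2) θ)`. -/
noncomputable def sinVec (n : ℕ) (θ : ℝ) : Fin n → ℝ := fun j => Real.sin (((j : ℝ) - (n - 1) / 2) * θ)

/-- The bilinear form of the inverse of `arcMatrix n θ`. -/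
noncomputable def arcForm (n : ℕ) (θ : ℝ) (u v : Fin n → ℝ) : ℝ := u ⬝ᵥ (arcMatrix n θ)⁻¹.mulVec v

open Matrix in
theorem arcMatrix_transpose (n : ℕ) (θ : ℝ) : (arcMatrix n θ)ᵀ = arcMatrix n θ := by
  ext j k
  simp only [arcMatrix, transpose_apply, of_apply]
  by_cases h : j = k
  · simp [h]
  · rw [if_neg h, if_neg (Ne.symm h), show ((k : ℝ) - j) * θ = -(((j : ℝ) - k) * θ) by ring, Real.sin_neg,
      show (k : ℝ) - j = -((j : ℝ) - k) by ring, mul_neg, neg_div_neg_eq]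

theorem arcMatrix_zero (n : ℕ) : arcMatrix n 0 = 1 := by
  ext j k
  by_cases h : j = k <;> simp [arcMatrix, h, Matrix.one_apply]

theorem arcMatrix_pi (n : ℕ) : arcMatrix n Real.pi = 0 := by
  ext j k
  simp only [arcMatrix, Matrix.of_apply, Matrix.zero_apply]
  have : ((j : ℝ) - k) * Real.pi = (((j : ℤ) - k : ℤ) : ℝ) * Real.pi := by push_cast; ring
  rw [this, Real.sin_int_mul_pi]
  simp [Real.pi_ne_zero]

theorem cosVec_mul_add_sinVec_mul (n : ℕ) (θ : ℝ) (j k : Fin n) :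
    cosVec n θ j * cosVec n θ k + sinVec n θ j * sinVec n θ k = Real.cos (((j : ℝ) - k) * θ) := by
  simp only [cosVec, sinVec]
  rw [← Real.cos_sub]
  congr 1; ring

theorem hasDerivAt_arcMatrix_apply (n : ℕ) (θ : ℝ) (j k : Fin n) :
    HasDerivAt (fun t => arcMatrix n t j k)
      (-(cosVec n θ j * cosVec n θ k + sinVec n θ j * sinVec n θ k) / Real.pi) θ := by
  rw [cosVec_mul_add_sinVec_mul]
  simp only [arcMatrix, Matrix.of_apply]
  by_cases h : j = k
  · subst h
    simp only [if_true]
    refine (((hasDerivAt_id θ).div_const Real.pi).const_sub 1).congr_deriv ?_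
    simp [neg_div]
  · simp only [if_neg h]
    have hjk : (j : ℝ) - k ≠ 0 := by
      rw [sub_ne_zero]; exact_mod_cast fun h' => h (Fin.ext h')
    refine ((((hasDerivAt_id θ).const_mul ((j : ℝ) - k)).sin.div_const (Real.pi * ((j : ℝ) - k))).neg).congr_deriv ?_
    have := Real.pi_ne_zero
    simp only [id]
    field_simp

open scoped Matrix.Norms.Operator in
theorem hasDerivAt_arcMatrix (n : ℕ) (θ : ℝ) :
    HasDerivAt (arcMatrix n) (-(1 / Real.pi) • (Matrix.vecMulVec (cosVec n θ) (cosVec n θ) +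
      Matrix.vecMulVec (sinVec n θ) (sinVec n θ))) θ := by
  refine hasDerivAt_pi.mpr fun j => hasDerivAt_pi.mpr fun k => ?_
  refine (hasDerivAt_arcMatrix_apply n θ j k).congr_deriv ?_
  simp [Matrix.vecMulVec_apply]
  ring

theorem hasDerivAt_dotProduct_arcMatrix (n : ℕ) (θ : ℝ) (u v : Fin n → ℝ) :
    HasDerivAt (fun t => u ⬝ᵥ (arcMatrix n t).mulVec v)
      (-((cosVec n θ ⬝ᵥ u) * (cosVec n θ ⬝ᵥ v) + (sinVec n θ ⬝ᵥ u) * (sinVec n θ ⬝ᵥ v)) / Real.pi) θ := by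
  have : HasDerivAt (fun t => ∑ j, u j * ∑ k, arcMatrix n t j k * v k)
      (∑ j, u j * ∑ k, (-(cosVec n θ j * cosVec n θ k + sinVec n θ j * sinVec n θ k) / Real.pi) * v k) θ :=
    HasDerivAt.fun_sum fun j _ => HasDerivAt.const_mul _ (HasDerivAt.fun_sum fun k _ =>
      (hasDerivAt_arcMatrix_apply n θ j k).mul_const _)
  refine this.congr_deriv ?_
  simp only [dotProduct, Finset.sum_mul_sum]
  rw [← Finset.sum_add_distrib, ← Finset.sum_neg_distrib, Finset.sum_div]
  refine Finset.sum_congr rfl fun j _ => ?_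
  rw [← Finset.sum_add_distrib, ← Finset.sum_neg_distrib, Finset.sum_div, Finset.mul_sum]
  refine Finset.sum_congr rfl fun k _ => ?_
  ring

theorem eq_zero_of_dotProduct_cosVec_eq_zero {n : ℕ} {u : Fin n → ℝ} {s : Set ℝ} (hs : s.Infinite)
    (hsp : s ⊆ Set.Icc 0 Real.pi)
    (hc : ∀ t ∈ s, cosVec n t ⬝ᵥ u = 0) (hd : ∀ t ∈ s, sinVec n t ⬝ᵥ u = 0) : u = 0 := by
  classical
  let p : Polynomial ℂ := ∑ j : Fin n, Polynomial.C (u j : ℂ) * Polynomial.X ^ (j : ℕ)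
  have hp : ∀ t ∈ s, p.eval (Complex.exp (t * Complex.I)) = 0 := by
    intro t ht
    have h1 : p.eval (Complex.exp (t * Complex.I)) =
        Complex.exp ((((n : ℝ) - 1) / 2 * t : ℝ) * Complex.I) *
        (((cosVec n t ⬝ᵥ u : ℝ) : ℂ) + ((sinVec n t ⬝ᵥ u : ℝ) : ℂ) * Complex.I) := by
      set E := Complex.exp ((((n : ℝ) - 1) / 2 * t : ℝ) * Complex.I) with hE
      simp only [p, Polynomial.eval_finsetSum, Polynomial.eval_mul, Polynomial.eval_C, Polynomial.eval_pow,
        Polynomial.eval_X, dotProduct]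
      push_cast
      rw [Finset.sum_mul, ← Finset.sum_add_distrib, Finset.mul_sum]
      refine Finset.sum_congr rfl fun j _ => ?_
      have : ((cosVec n t j : ℝ) : ℂ) + ((sinVec n t j : ℝ) : ℂ) * Complex.I =
          Complex.exp ((((j : ℝ) - (n - 1) / 2) * t : ℝ) * Complex.I) := by
        simp only [cosVec, sinVec]
        rw [Complex.exp_mul_I, Complex.ofReal_cos, Complex.ofReal_sin]
      have h2 : Complex.exp (t * Complex.I) ^ (j : ℕ) = E *
          (((cosVec n t j : ℝ) : ℂ) + ((sinVec n t j : ℝ) : ℂ) * Complex.I) := by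
        rw [this, hE, ← Complex.exp_nat_mul, ← Complex.exp_add]
        congr 1
        push_cast
        ring
      rw [h2]
      ring
    rw [h1, hc t ht, hd t ht]; simp
  have hinj : Set.InjOn (fun t : ℝ => Complex.exp (t * Complex.I)) s := by
    intro x hx y hy hxy
    have := congrArg Complex.re hxy
    simp only [Complex.exp_ofReal_mul_I_re] at this
    exact Real.injOn_cos (hsp hx) (hsp hy) this
  have hp0 : p = 0 := by
    refine Polynomial.eq_zero_of_infinite_isRoot p ((hs.image hinj).mono ?_)
    rintro _ ⟨t, ht, rfl⟩
    exact hp t ht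
  funext i
  have := congrArg (fun q => Polynomial.coeff q (i : ℕ)) hp0
  simp only [p, Polynomial.finsetSum_coeff, Polynomial.coeff_C_mul_X_pow, Polynomial.coeff_zero] at this
  rw [Finset.sum_eq_single i] at this
  · simpa using this
  · intro b _ hb
    rw [if_neg]
    exact fun h => hb (Fin.ext h.symm)
  · simp

theorem antitone_dotProduct_arcMatrix (n : ℕ) (u : Fin n → ℝ) :
    Antitone fun t => u ⬝ᵥ (arcMatrix n t).mulVec u := by
  refine antitone_of_deriv_nonpos (fun t => (hasDerivAt_dotProduct_arcMatrix n t u u).differentiableAt) fun t => ?_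
  rw [(hasDerivAt_dotProduct_arcMatrix n t u u).deriv]
  have := Real.pi_pos
  have h1 := mul_self_nonneg (cosVec n t ⬝ᵥ u)
  have h2 := mul_self_nonneg (sinVec n t ⬝ᵥ u)
  apply div_nonpos_of_nonpos_of_nonneg <;> linarith

theorem dotProduct_arcMatrix_pos (n : ℕ) {θ : ℝ} (h0 : 0 ≤ θ) (hθ : θ < Real.pi) {u : Fin n → ℝ} (hu : u ≠ 0) :
    0 < u ⬝ᵥ (arcMatrix n θ).mulVec u := by
  have hanti := antitone_dotProduct_arcMatrix n u
  have hpi : u ⬝ᵥ (arcMatrix n Real.pi).mulVec u = 0 := by simp [arcMatrix_pi]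
  refine lt_of_le_of_ne (hpi ▸ hanti hθ.le) fun h => hu ?_
  have key : ∀ t ∈ Set.Ioo θ Real.pi, (cosVec n t ⬝ᵥ u) * (cosVec n t ⬝ᵥ u) +
      (sinVec n t ⬝ᵥ u) * (sinVec n t ⬝ᵥ u) = 0 := by
    intro t ht
    have h1 : HasDerivAt (fun t => u ⬝ᵥ (arcMatrix n t).mulVec u) 0 t := by
      refine (hasDerivAt_const t (0 : ℝ)).congr_of_eventuallyEq ?_
      filter_upwards [Ioo_mem_nhds ht.1 ht.2] with x hx
      exact le_antisymm (by have := hanti hx.1.le; simpa [← h] using this)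
        (by have := hanti hx.2.le; simpa [hpi] using this)
    have h2 := h1.unique (hasDerivAt_dotProduct_arcMatrix n t u u)
    have := Real.pi_ne_zero
    field_simp at h2
    linarith
  have hs : (Set.Ioo θ Real.pi).Infinite := Set.Ioo_infinite hθ
  refine eq_zero_of_dotProduct_cosVec_eq_zero hs (fun x hx => ⟨h0.trans hx.1.le, hx.2.le⟩) (fun t ht => ?_) (fun t ht => ?_)
  · have := key t ht; nlinarith [mul_self_nonneg (cosVec n t ⬝ᵥ u), mul_self_nonneg (sinVec n t ⬝ᵥ u)]
  · have := key t ht; nlinarith [mul_self_nonneg (cosVec n t ⬝ᵥ u), mul_self_nonneg (sinVec n t ⬝ᵥ u)]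

theorem posDef_arcMatrix (n : ℕ) {θ : ℝ} (h0 : 0 ≤ θ) (hθ : θ < Real.pi) : (arcMatrix n θ).PosDef := by
  refine Matrix.PosDef.of_dotProduct_mulVec_pos ?_ fun x hx => ?_
  · rw [Matrix.IsHermitian, Matrix.conjTranspose_eq_transpose_of_trivial, arcMatrix_transpose]
  · simpa using dotProduct_arcMatrix_pos n h0 hθ hx

theorem Fin.cast_val_rev {n : ℕ} (j : Fin n) : ((j.rev : ℕ) : ℝ) = n - 1 - j := by
  rw [Fin.val_rev, Nat.cast_sub (by omega)]
  push_cast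
  ring

theorem isUnit_det_arcMatrix (n : ℕ) {θ : ℝ} (h0 : 0 ≤ θ) (hθ : θ < Real.pi) : IsUnit (arcMatrix n θ).det :=
  (posDef_arcMatrix n h0 hθ).det_pos.ne'.isUnit

theorem arcForm_comm (n : ℕ) (θ : ℝ) (u v : Fin n → ℝ) : arcForm n θ u v = arcForm n θ v u := by
  rw [arcForm, arcForm, Matrix.dotProduct_mulVec, dotProduct_comm, ← Matrix.mulVec_transpose,
    Matrix.transpose_nonsing_inv, arcMatrix_transpose]

theorem arcForm_add_left (n : ℕ) (θ : ℝ) (u u' v : Fin n → ℝ) :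
    arcForm n θ (u + u') v = arcForm n θ u v + arcForm n θ u' v := by
  simp [arcForm, add_dotProduct]

theorem arcForm_smul_left (n : ℕ) (θ : ℝ) (a : ℝ) (u v : Fin n → ℝ) :
    arcForm n θ (a • u) v = a * arcForm n θ u v := by
  simp [arcForm, smul_dotProduct]

theorem arcForm_add_right (n : ℕ) (θ : ℝ) (u v v' : Fin n → ℝ) :
    arcForm n θ u (v + v') = arcForm n θ u v + arcForm n θ u v' := by
  simp [arcForm, Matrix.mulVec_add, dotProduct_add]

theorem arcForm_smul_right (n : ℕ) (θ : ℝ) (a : ℝ) (u v : Fin n → ℝ) :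
    arcForm n θ u (a • v) = a * arcForm n θ u v := by
  simp [arcForm, Matrix.mulVec_smul, dotProduct_smul]

theorem arcForm_mulVec (n : ℕ) {θ : ℝ} (h0 : 0 ≤ θ) (hθ : θ < Real.pi) (u v : Fin n → ℝ) :
    arcForm n θ u ((arcMatrix n θ).mulVec v) = u ⬝ᵥ v := by
  rw [arcForm, Matrix.mulVec_mulVec, Matrix.nonsing_inv_mul _ (isUnit_det_arcMatrix n h0 hθ), Matrix.one_mulVec]

theorem arcForm_self_pos (n : ℕ) {θ : ℝ} (h0 : 0 ≤ θ) (hθ : θ < Real.pi) {u : Fin n → ℝ} (hu : u ≠ 0) :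
    0 < arcForm n θ u u := by
  have := (posDef_arcMatrix n h0 hθ).inv.dotProduct_mulVec_pos hu
  simpa [arcForm] using this

theorem arcForm_self_nonneg (n : ℕ) {θ : ℝ} (h0 : 0 ≤ θ) (hθ : θ < Real.pi) (u : Fin n → ℝ) :
    0 ≤ arcForm n θ u u := by
  by_cases hu : u = 0
  · simp [hu, arcForm]
  · exact (arcForm_self_pos n h0 hθ hu).le

/-- Reversal of a vector preserves the form. -/
theorem arcForm_rev (n : ℕ) (θ : ℝ) (u v : Fin n → ℝ) :
    arcForm n θ (fun j => u j.rev) (fun j => v j.rev) = arcForm n θ u v := by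
  have h1 : (arcMatrix n θ).submatrix Fin.revPerm Fin.revPerm = arcMatrix n θ := by
    ext j k
    rw [← congrFun (congrFun (arcMatrix_transpose n θ) j) k]
    have hrev : ∀ i : Fin n, (((Fin.revPerm i : Fin n) : ℕ) : ℝ) = n - 1 - i := fun i => Fin.cast_val_rev i
    simp only [arcMatrix, Matrix.submatrix_apply, Matrix.of_apply, Matrix.transpose_apply, hrev,
      EmbeddingLike.apply_eq_iff_eq]
    rw [show (n : ℝ) - 1 - j - (n - 1 - k) = k - j by ring]
    by_cases h : j = k
    · simp [h]
    · simp [h, Ne.symm h]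
  have h2 : (arcMatrix n θ)⁻¹.submatrix Fin.revPerm Fin.revPerm = (arcMatrix n θ)⁻¹ := by
    rw [← Matrix.inv_submatrix_equiv, h1]
  have h3 : ∀ j k, (arcMatrix n θ)⁻¹ (Fin.rev j) (Fin.rev k) = (arcMatrix n θ)⁻¹ j k := fun j k =>
    congrFun (congrFun h2 j) k
  simp only [arcForm, dotProduct, Matrix.mulVec]
  rw [← Equiv.sum_comp Fin.revPerm]
  refine Finset.sum_congr rfl fun j _ => ?_
  rw [← Equiv.sum_comp Fin.revPerm]
  simp [Fin.revPerm_apply, h3]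

theorem cosVec_rev (n : ℕ) (θ : ℝ) : (fun j : Fin n => cosVec n θ j.rev) = cosVec n θ := by
  funext j
  simp only [cosVec, Fin.cast_val_rev]
  rw [← Real.cos_neg]; congr 1; ring

theorem sinVec_rev (n : ℕ) (θ : ℝ) : (fun j : Fin n => sinVec n θ j.rev) = -sinVec n θ := by
  funext j
  simp only [sinVec, Fin.cast_val_rev, Pi.neg_apply]
  rw [← Real.sin_neg]; congr 1; ring

theorem arcForm_cosVec_sinVec (n : ℕ) (θ : ℝ) : arcForm n θ (cosVec n θ) (sinVec n θ) = 0 := by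
  have := arcForm_rev n θ (cosVec n θ) (sinVec n θ)
  rw [cosVec_rev, sinVec_rev, ← neg_one_smul ℝ, arcForm_smul_right] at this
  linarith

open scoped Matrix.Norms.Operator in
theorem hasDerivAt_inv_arcMatrix (n : ℕ) {θ : ℝ} (h0 : 0 ≤ θ) (hθ : θ < Real.pi) :
    HasDerivAt (fun t => (arcMatrix n t)⁻¹) ((1 / Real.pi) • ((arcMatrix n θ)⁻¹ *
      (Matrix.vecMulVec (cosVec n θ) (cosVec n θ) + Matrix.vecMulVec (sinVec n θ) (sinVec n θ)) * (arcMatrix n θ)⁻¹)) θ := by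
  have hu := isUnit_det_arcMatrix n h0 hθ
  have hU : IsUnit (arcMatrix n θ) := (Matrix.isUnit_iff_isUnit_det _).2 hu
  obtain ⟨U, hUe⟩ := hU
  have h1 := hasFDerivAt_ringInverse (𝕜 := ℝ) U
  rw [hUe] at h1
  have h2 := h1.comp_hasDerivAt θ (hasDerivAt_arcMatrix n θ)
  have h3 : (Ring.inverse ∘ arcMatrix n) = fun t => (arcMatrix n t)⁻¹ := by
    funext t; simp [Matrix.nonsing_inv_eq_ringInverse]
  rw [h3] at h2
  refine h2.congr_deriv ?_
  have h4 : ((U⁻¹ : (Matrix (Fin n) (Fin n) ℝ)ˣ) : Matrix (Fin n) (Fin n) ℝ) = (arcMatrix n θ)⁻¹ := by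
    rw [← hUe, Matrix.coe_units_inv]
  rw [neg_apply, ContinuousLinearMap.mulLeftRight_apply, h4]
  simp only [neg_smul, mul_neg, neg_mul, neg_neg, mul_smul_comm, smul_mul_assoc]

theorem vecMulVec_dot (n : ℕ) (R : Matrix (Fin n) (Fin n) ℝ) (c : Fin n → ℝ) (hR : R.transpose = R) :
    R * Matrix.vecMulVec c c * R = Matrix.vecMulVec (R.mulVec c) (R.mulVec c) := by
  rw [Matrix.mul_vecMulVec, Matrix.vecMulVec_mul, ← Matrix.mulVec_transpose, hR]

theorem hasDerivAt_inv_arcMatrix_apply (n : ℕ) {θ : ℝ} (h0 : 0 ≤ θ) (hθ : θ < Real.pi) (j k : Fin n) :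
    HasDerivAt (fun t => (arcMatrix n t)⁻¹ j k) ((1 / Real.pi) *
      ((arcMatrix n θ)⁻¹.mulVec (cosVec n θ) j * (arcMatrix n θ)⁻¹.mulVec (cosVec n θ) k +
       (arcMatrix n θ)⁻¹.mulVec (sinVec n θ) j * (arcMatrix n θ)⁻¹.mulVec (sinVec n θ) k)) θ := by
  have h := hasDerivAt_pi.1 (hasDerivAt_pi.1 (hasDerivAt_inv_arcMatrix n h0 hθ) j) k
  refine h.congr_deriv ?_
  have hR : (arcMatrix n θ)⁻¹.transpose = (arcMatrix n θ)⁻¹ := by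
    rw [Matrix.transpose_nonsing_inv, arcMatrix_transpose]
  rw [mul_add, add_mul, vecMulVec_dot n _ _ hR, vecMulVec_dot n _ _ hR]
  simp [Matrix.vecMulVec_apply]

theorem hasDerivAt_arcForm (n : ℕ) {θ : ℝ} (h0 : 0 ≤ θ) (hθ : θ < Real.pi) {u v : ℝ → Fin n → ℝ}
    {u' v' : Fin n → ℝ} (hu : ∀ j, HasDerivAt (fun t => u t j) (u' j) θ)
    (hv : ∀ j, HasDerivAt (fun t => v t j) (v' j) θ) :
    HasDerivAt (fun t => arcForm n t (u t) (v t)) (arcForm n θ u' (v θ) + arcForm n θ (u θ) v' +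
      (arcForm n θ (u θ) (cosVec n θ) * arcForm n θ (v θ) (cosVec n θ) +
       arcForm n θ (u θ) (sinVec n θ) * arcForm n θ (v θ) (sinVec n θ)) / Real.pi) θ := by
  have h : HasDerivAt (fun t => ∑ j, u t j * ∑ k, (arcMatrix n t)⁻¹ j k * v t k) _ θ :=
    HasDerivAt.fun_sum fun j _ => HasDerivAt.fun_mul (hu j) (HasDerivAt.fun_sum fun k _ =>
      HasDerivAt.fun_mul (hasDerivAt_inv_arcMatrix_apply n h0 hθ j k) (hv k))
  refine h.congr_deriv ?_
  simp only [arcForm, dotProduct]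
  rw [Finset.sum_mul_sum, Finset.sum_mul_sum, ← Finset.sum_add_distrib (f := fun j => u' j * _),
    ← Finset.sum_add_distrib, Finset.sum_div, ← Finset.sum_add_distrib]
  refine Finset.sum_congr rfl fun j _ => ?_
  rw [← Finset.sum_add_distrib, Finset.sum_div, Finset.sum_add_distrib, mul_add]
  have : ∀ w : Fin n → ℝ, ((arcMatrix n θ)⁻¹.mulVec w) j = ∑ k, (arcMatrix n θ)⁻¹ j k * w k := fun w => rfl
  rw [this (v θ), this v', add_assoc, add_comm (u θ j * _)]
  congr 2
  rw [Finset.mul_sum]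
  refine Finset.sum_congr rfl fun k _ => ?_
  ring

open scoped Matrix.Norms.Operator in
theorem Matrix.hasDerivAt_det {n : ℕ} {M : ℝ → Matrix (Fin n) (Fin n) ℝ} {M' : Matrix (Fin n) (Fin n) ℝ} {x : ℝ}
    (hM : HasDerivAt M M' x) (hu : IsUnit (M x).det) :
    HasDerivAt (fun t => (M t).det) ((M x).det * ((M x)⁻¹ * M').trace) x := by
  have hd : Differentiable ℝ (fun M : Matrix (Fin n) (Fin n) ℝ => M.det) := by
    simp only [Matrix.det_apply]
    fun_prop
  have h1 := (hd (M x)).hasFDerivAt.comp_hasDerivAt x hM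
  refine h1.congr_deriv ?_
  have h2 : HasDerivAt (fun t : ℝ => M x + t • M') M' 0 :=
    (((hasDerivAt_id (0 : ℝ)).smul_const M').const_add (M x)).congr_deriv (by simp)
  have hd' : HasFDerivAt (fun M : Matrix (Fin n) (Fin n) ℝ => M.det)
      (fderiv ℝ (fun M : Matrix (Fin n) (Fin n) ℝ => M.det) (M x)) (M x + (0 : ℝ) • M') := by
    simpa using (hd (M x)).hasFDerivAt
  have h3 := hd'.comp_hasDerivAt (0 : ℝ) h2
  refine h3.unique ?_
  have h4 : ((fun M : Matrix (Fin n) (Fin n) ℝ => M.det) ∘ fun t : ℝ => M x + t • M') = fun t : ℝ =>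
      (M x).det * (1 + ((M x)⁻¹ * M').trace * t +
        (Matrix.det (1 + (Polynomial.X : Polynomial ℝ) • ((M x)⁻¹ * M').map Polynomial.C)).divX.divX.eval t * t ^ 2) := by
    funext t
    rw [← Matrix.det_one_add_smul, ← Matrix.det_mul, mul_add, mul_one, mul_smul_comm, Matrix.mul_nonsing_inv_cancel_left _ _ hu]
    rfl
  rw [h4]
  have h5 := ((((hasDerivAt_id (0 : ℝ)).const_mul ((M x)⁻¹ * M').trace).const_add 1).fun_add
    ((Polynomial.hasDerivAt
      ((Matrix.det (1 + (Polynomial.X : Polynomial ℝ) • ((M x)⁻¹ * M').map Polynomial.C)).divX.divX) (0 : ℝ)).fun_mul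
      ((hasDerivAt_id (0 : ℝ)).fun_pow 2))).const_mul (M x).det
  refine h5.congr_deriv ?_
  simp

theorem hasDerivAt_log_det_arcMatrix (n : ℕ) {θ : ℝ} (h0 : 0 ≤ θ) (hθ : θ < Real.pi) :
    HasDerivAt (fun t => Real.log (arcMatrix n t).det)
      (-(arcForm n θ (cosVec n θ) (cosVec n θ) + arcForm n θ (sinVec n θ) (sinVec n θ)) / Real.pi) θ := by
  have hu := isUnit_det_arcMatrix n h0 hθ
  refine ((Matrix.hasDerivAt_det (hasDerivAt_arcMatrix n θ) hu).log hu.ne_zero).congr_deriv ?_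
  rw [mul_div_cancel_left₀ _ hu.ne_zero, mul_smul_comm, Matrix.trace_smul, mul_add, Matrix.trace_add,
    Matrix.mul_vecMulVec, Matrix.mul_vecMulVec, Matrix.trace_vecMulVec, Matrix.trace_vecMulVec]
  simp only [arcForm, smul_eq_mul]
  rw [dotProduct_comm, dotProduct_comm (sinVec n θ)]
  ring

/-- A Christoffel–Darboux identity for symmetric Toeplitz matrices. -/
theorem christoffel_darboux_toeplitz {K : Type*} [Field K] {N : ℕ} (t : ℤ → K) (ht : ∀ i, t (-i) = t i)
    (T : Matrix (Fin (N + 1)) (Fin (N + 1)) K) (hT : ∀ i j : Fin (N + 1), T i j = t ((i : ℕ) - (j : ℕ) : ℤ))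
    (hinj : ∀ w, T.mulVec w = 0 → w = 0) {z : K} (hz : z ≠ 0) (e p x : Fin (N + 1) → K)
    (he : ∀ j : Fin N, e j.succ = z * e j.castSucc) (hp : T.mulVec p = e)
    (hx : T.mulVec x = Pi.single 0 1) (hx0 : x 0 ≠ 0) :
    (z - z⁻¹) * x 0 * (e ⬝ᵥ p) = z * (e ⬝ᵥ fun j => x j.rev) ^ 2 - z⁻¹ * (e ⬝ᵥ x) ^ 2 := by
  have hTs : T.transpose = T := by
    ext i j; rw [Matrix.transpose_apply, hT, hT, ← ht]; congr 1; ring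
  have hTr : ∀ i j : Fin (N + 1), T i.rev j.rev = T i j := by
    intro i j
    rw [hT, hT, ← ht]
    congr 1
    rw [Fin.val_rev, Fin.val_rev]
    omega
  have hsym : ∀ a b : Fin (N + 1) → K, T.mulVec a ⬝ᵥ b = a ⬝ᵥ T.mulVec b := by
    intro a b
    rw [Matrix.dotProduct_mulVec, ← Matrix.mulVec_transpose, hTs]
  set y : Fin (N + 1) → K := fun j => x j.rev with hy
  have hTy : T.mulVec y = Pi.single (Fin.last N) 1 := by
    funext i
    have h1 : T.mulVec y i = T.mulVec x i.rev := by
      simp only [Matrix.mulVec, dotProduct, hy]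
      rw [← Equiv.sum_comp Fin.revPerm (fun j => T i.rev j * x j)]
      refine Finset.sum_congr rfl fun j _ => ?_
      rw [Fin.revPerm_apply, hTr]
    rw [h1, hx, Pi.single_apply, Pi.single_apply]
    refine if_congr ?_ rfl rfl
    rw [Fin.rev_eq_iff, Fin.rev_zero]
  have hp0 : p 0 = e ⬝ᵥ x := by
    have : T.mulVec x ⬝ᵥ p = x ⬝ᵥ T.mulVec p := hsym x p
    rw [hx, hp, single_one_dotProduct] at this
    rw [this, dotProduct_comm]
  have hpN : p (Fin.last N) = e ⬝ᵥ y := by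
    have : T.mulVec y ⬝ᵥ p = y ⬝ᵥ T.mulVec p := hsym y p
    rw [hTy, hp, single_one_dotProduct] at this
    rw [this, dotProduct_comm]
  have hyN : y (Fin.last N) = x 0 := by simp [hy]
  let sh : (Fin (N + 1) → K) → Fin (N + 1) → K := fun v => Fin.cons 0 fun j => v j.castSucc
  have hsh : ∀ (v : Fin (N + 1) → K) (i : Fin N), T.mulVec (sh v) i.succ =
      T.mulVec v i.castSucc - t ((i : ℕ) - N) * v (Fin.last N) := by
    intro v i
    simp only [Matrix.mulVec, dotProduct]
    rw [Fin.sum_univ_succ, Fin.sum_univ_castSucc (fun j => T i.castSucc j * v j), hT i.castSucc (Fin.last N)]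
    simp only [sh, Fin.cons_zero, Fin.cons_succ, mul_zero, zero_add, Fin.val_castSucc, Fin.val_last, add_sub_cancel_right]
    refine Finset.sum_congr rfl fun j _ => ?_
    rw [hT, hT]
    congr 2
    simp
  have hdot : ∀ v : Fin (N + 1) → K, e ⬝ᵥ sh v = z * (e ⬝ᵥ v - e (Fin.last N) * v (Fin.last N)) := by
    intro v
    simp only [dotProduct]
    rw [Fin.sum_univ_succ, Fin.sum_univ_castSucc (fun j => e j * v j), add_sub_cancel_right, Finset.mul_sum]
    simp only [sh, Fin.cons_zero, Fin.cons_succ, mul_zero, zero_add, he, mul_assoc]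
  set w := sh p - (p (Fin.last N) / x 0) • sh y with hw
  set κ := T.mulVec w 0 - z⁻¹ * e 0 with hκ
  have hTw : T.mulVec w = z⁻¹ • e + κ • Pi.single 0 1 := by
    funext i
    refine Fin.cases ?_ (fun i => ?_) i
    · simp [hκ]
    · rw [hw, Matrix.mulVec_sub, Matrix.mulVec_smul, Pi.sub_apply, Pi.smul_apply, hsh, hsh, hp, hTy, hyN]
      have : (i.castSucc : Fin (N + 1)) ≠ Fin.last N := (Fin.castSucc_lt_last i).ne
      simp [he, this, hz]
      field_simp
      ring
  have hweq : w = z⁻¹ • p + κ • x := by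
    refine sub_eq_zero.1 (hinj _ ?_)
    rw [Matrix.mulVec_sub, Matrix.mulVec_add, Matrix.mulVec_smul, Matrix.mulVec_smul, hTw, hp, hx, sub_self]
  have h0 : 0 = z⁻¹ * p 0 + κ * x 0 := by
    have := congrFun hweq 0
    simpa [hw, sh] using this
  have hd : e ⬝ᵥ w = z⁻¹ * (e ⬝ᵥ p) + κ * (e ⬝ᵥ x) := by
    rw [hweq, dotProduct_add, dotProduct_smul, dotProduct_smul, smul_eq_mul, smul_eq_mul]
  rw [hw, dotProduct_sub, dotProduct_smul, smul_eq_mul, hdot, hdot, hyN, hpN] at hd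
  rw [hp0] at h0
  clear_value κ
  field_simp at hd h0 ⊢
  linear_combination hd - (e ⬝ᵥ x) * h0

/-- The first basis vector. -/
noncomputable def arcE (N : ℕ) : Fin (N + 1) → ℝ := Pi.single 0 1

/-- The form evaluated on the cosine vector. -/
noncomputable def arcCC (N : ℕ) (θ : ℝ) : ℝ := arcForm (N + 1) θ (cosVec (N + 1) θ) (cosVec (N + 1) θ)

/-- The form evaluated on the sine vector. -/
noncomputable def arcSS (N : ℕ) (θ : ℝ) : ℝ := arcForm (N + 1) θ (sinVec (N + 1) θ) (sinVec (N + 1) θ)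

/-- The form evaluated on the cosine vector and the first basis vector. -/
noncomputable def arcP (N : ℕ) (θ : ℝ) : ℝ := arcForm (N + 1) θ (cosVec (N + 1) θ) (arcE N)

/-- The form evaluated on the sine vector and the first basis vector. -/
noncomputable def arcS (N : ℕ) (θ : ℝ) : ℝ := arcForm (N + 1) θ (sinVec (N + 1) θ) (arcE N)

/-- The form evaluated on the first basis vector. -/
noncomputable def arcX (N : ℕ) (θ : ℝ) : ℝ := arcForm (N + 1) θ (arcE N) (arcE N)

/-- The centred index vector. -/
noncomputable def arcIdx (n : ℕ) : Fin n → ℝ := fun j => (j : ℝ) - (n - 1) / 2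

theorem hasDerivAt_cosVec (n : ℕ) (θ : ℝ) (j : Fin n) :
    HasDerivAt (fun t => cosVec n t j) (((-1 : ℝ) • (arcIdx n * sinVec n θ)) j) θ := by
  refine (((hasDerivAt_id θ).const_mul ((j : ℝ) - (n - 1) / 2)).cos).congr_deriv ?_
  simp [arcIdx, sinVec]
  ring

theorem hasDerivAt_sinVec (n : ℕ) (θ : ℝ) (j : Fin n) :
    HasDerivAt (fun t => sinVec n t j) ((arcIdx n * cosVec n θ) j) θ := by
  refine (((hasDerivAt_id θ).const_mul ((j : ℝ) - (n - 1) / 2)).sin).congr_deriv ?_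
  simp [arcIdx, cosVec]
  ring

theorem arcIdx_sub_mul_arcMatrix (n : ℕ) (θ : ℝ) (j k : Fin n) :
    (arcIdx n j - arcIdx n k) * arcMatrix n θ j k =
      -(sinVec n θ j * cosVec n θ k - cosVec n θ j * sinVec n θ k) / Real.pi := by
  have h : sinVec n θ j * cosVec n θ k - cosVec n θ j * sinVec n θ k = Real.sin (((j : ℝ) - k) * θ) := by
    simp only [cosVec, sinVec]
    rw [← Real.sin_sub]
    congr 1; ring
  rw [h]
  simp only [arcIdx, arcMatrix, Matrix.of_apply]
  by_cases hjk : j = k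
  · simp [hjk]
  · rw [if_neg hjk]
    have hjk' : (j : ℝ) - k ≠ 0 := by
      rw [sub_ne_zero]; exact_mod_cast fun h' => hjk (Fin.ext h')
    have := Real.pi_ne_zero
    rw [sub_sub_sub_cancel_right]
    field_simp

theorem arcForm_arcIdx_comm (n : ℕ) {θ : ℝ} (h0 : 0 ≤ θ) (hθ : θ < Real.pi) (u v : Fin n → ℝ) :
    arcForm n θ u (arcIdx n * v) - arcForm n θ (arcIdx n * u) v =
      -(arcForm n θ u (sinVec n θ) * arcForm n θ v (cosVec n θ) -
        arcForm n θ u (cosVec n θ) * arcForm n θ v (sinVec n θ)) / Real.pi := by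
  have hu := isUnit_det_arcMatrix n h0 hθ
  obtain ⟨p, rfl⟩ : ∃ p, u = (arcMatrix n θ).mulVec p := ⟨(arcMatrix n θ)⁻¹.mulVec u, by
    rw [Matrix.mulVec_mulVec, Matrix.mul_nonsing_inv _ hu, Matrix.one_mulVec]⟩
  obtain ⟨q, rfl⟩ : ∃ q, v = (arcMatrix n θ).mulVec q := ⟨(arcMatrix n θ)⁻¹.mulVec v, by
    rw [Matrix.mulVec_mulVec, Matrix.mul_nonsing_inv _ hu, Matrix.one_mulVec]⟩
  have hf : ∀ w r, arcForm n θ ((arcMatrix n θ).mulVec r) w = r ⬝ᵥ w := fun w r => by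
    rw [arcForm_comm, arcForm_mulVec n h0 hθ, dotProduct_comm]
  have h1 : ∀ j k, arcMatrix n θ k j = arcMatrix n θ j k := fun j k =>
    congrFun (congrFun (arcMatrix_transpose n θ) j) k
  have h2 : (arcIdx n * (arcMatrix n θ).mulVec p) ⬝ᵥ q = ∑ j, ∑ k, p j * (arcIdx n k * arcMatrix n θ j k) * q k := by
    simp only [Matrix.mulVec, dotProduct, Pi.mul_apply, Finset.mul_sum, Finset.sum_mul]
    rw [Finset.sum_comm]
    refine Finset.sum_congr rfl fun j _ => Finset.sum_congr rfl fun k _ => ?_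
    rw [h1]; ring
  have h3 : p ⬝ᵥ (arcIdx n * (arcMatrix n θ).mulVec q) = ∑ j, ∑ k, p j * (arcIdx n j * arcMatrix n θ j k) * q k := by
    simp only [Matrix.mulVec, dotProduct, Pi.mul_apply, Finset.mul_sum]
    refine Finset.sum_congr rfl fun j _ => Finset.sum_congr rfl fun k _ => ?_
    ring
  rw [hf, arcForm_mulVec n h0 hθ (arcIdx n * _), hf, hf, hf, hf, h2, h3]
  simp only [dotProduct, Finset.sum_mul_sum]
  rw [← Finset.sum_sub_distrib, ← Finset.sum_sub_distrib, ← Finset.sum_neg_distrib, Finset.sum_div]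
  refine Finset.sum_congr rfl fun j _ => ?_
  rw [← Finset.sum_sub_distrib, ← Finset.sum_sub_distrib, ← Finset.sum_neg_distrib, Finset.sum_div]
  refine Finset.sum_congr rfl fun k _ => ?_
  linear_combination p j * q k * arcIdx_sub_mul_arcMatrix n θ j k

theorem arcIdx_mul_arcE (N : ℕ) : arcIdx (N + 1) * arcE N = (-((N : ℝ) / 2)) • arcE N := by
  funext j
  by_cases h : j = 0 <;> simp [arcIdx, arcE, h]

theorem hasDerivAt_arcP (N : ℕ) {θ : ℝ} (h0 : 0 ≤ θ) (hθ : θ < Real.pi) :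
    HasDerivAt (arcP N) (N / 2 * arcS N θ + (arcCC N θ - arcSS N θ) / Real.pi * arcP N θ) θ := by
  refine (hasDerivAt_arcForm (N + 1) h0 hθ (hasDerivAt_cosVec (N + 1) θ)
    (v := fun _ => arcE N) (v' := (0 : ℝ) • arcE N) (fun j => (hasDerivAt_const θ _).congr_deriv (by simp))).congr_deriv ?_
  have h := arcForm_arcIdx_comm (N + 1) h0 hθ (sinVec (N + 1) θ) (arcE N)
  rw [arcIdx_mul_arcE] at h
  have h2 := arcForm_cosVec_sinVec (N + 1) θ
  have h3 := arcForm_comm (N + 1) θ (cosVec (N + 1) θ) (sinVec (N + 1) θ)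
  have h4 := arcForm_comm (N + 1) θ (arcE N) (sinVec (N + 1) θ)
  have h5 := arcForm_comm (N + 1) θ (arcE N) (cosVec (N + 1) θ)
  simp only [arcForm_smul_left, arcForm_smul_right, h2, ← h3, h4, h5] at h ⊢
  simp only [arcP, arcS, arcCC, arcSS]
  linear_combination h

theorem hasDerivAt_arcS (N : ℕ) {θ : ℝ} (h0 : 0 ≤ θ) (hθ : θ < Real.pi) :
    HasDerivAt (arcS N) (-(N / 2 * arcP N θ) - (arcCC N θ - arcSS N θ) / Real.pi * arcS N θ) θ := by
  refine (hasDerivAt_arcForm (N + 1) h0 hθ (hasDerivAt_sinVec (N + 1) θ)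
    (v := fun _ => arcE N) (v' := (0 : ℝ) • arcE N) (fun j => (hasDerivAt_const θ _).congr_deriv (by simp))).congr_deriv ?_
  have h := arcForm_arcIdx_comm (N + 1) h0 hθ (cosVec (N + 1) θ) (arcE N)
  rw [arcIdx_mul_arcE] at h
  have h2 := arcForm_cosVec_sinVec (N + 1) θ
  have h3 := arcForm_comm (N + 1) θ (cosVec (N + 1) θ) (sinVec (N + 1) θ)
  have h4 := arcForm_comm (N + 1) θ (arcE N) (sinVec (N + 1) θ)
  have h5 := arcForm_comm (N + 1) θ (arcE N) (cosVec (N + 1) θ)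
  simp only [arcForm_smul_right, h2, ← h3, h4, h5] at h ⊢
  simp only [arcP, arcS, arcCC, arcSS]
  linear_combination -h

theorem hasDerivAt_arcX (N : ℕ) {θ : ℝ} (h0 : 0 ≤ θ) (hθ : θ < Real.pi) :
    HasDerivAt (arcX N) ((arcP N θ ^ 2 + arcS N θ ^ 2) / Real.pi) θ := by
  refine (hasDerivAt_arcForm (N + 1) h0 hθ (u := fun _ => arcE N) (u' := (0 : ℝ) • arcE N)
    (v := fun _ => arcE N) (v' := (0 : ℝ) • arcE N) (fun j => (hasDerivAt_const θ _).congr_deriv (by simp))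
    (fun j => (hasDerivAt_const θ _).congr_deriv (by simp))).congr_deriv ?_
  have h4 := arcForm_comm (N + 1) θ (arcE N) (sinVec (N + 1) θ)
  have h5 := arcForm_comm (N + 1) θ (arcE N) (cosVec (N + 1) θ)
  simp only [arcForm_smul_left, arcForm_smul_right, h4, h5]
  simp only [arcP, arcS]
  ring

theorem differentiableAt_arcCC_add_arcSS (N : ℕ) {θ : ℝ} (h0 : 0 ≤ θ) (hθ : θ < Real.pi) :
    HasDerivAt (fun t => arcCC N t + arcSS N t) ((arcCC N θ - arcSS N θ) ^ 2 / Real.pi) θ := by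
  refine ((hasDerivAt_arcForm (N + 1) h0 hθ (hasDerivAt_cosVec (N + 1) θ) (hasDerivAt_cosVec (N + 1) θ)).add
    (hasDerivAt_arcForm (N + 1) h0 hθ (hasDerivAt_sinVec (N + 1) θ) (hasDerivAt_sinVec (N + 1) θ))).congr_deriv ?_
  have h := arcForm_arcIdx_comm (N + 1) h0 hθ (cosVec (N + 1) θ) (sinVec (N + 1) θ)
  have h2 := arcForm_cosVec_sinVec (N + 1) θ
  have h3 := arcForm_comm (N + 1) θ (cosVec (N + 1) θ) (sinVec (N + 1) θ)
  have h4 := arcForm_comm (N + 1) θ (sinVec (N + 1) θ) (arcIdx (N + 1) * cosVec (N + 1) θ)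
  have h5 := arcForm_comm (N + 1) θ (arcIdx (N + 1) * sinVec (N + 1) θ) (cosVec (N + 1) θ)
  simp only [arcForm_smul_left, arcForm_smul_right, h2, ← h3, h4, h5] at h ⊢
  simp only [arcCC, arcSS]
  linear_combination -2 * h

theorem arcX_pos (N : ℕ) {θ : ℝ} (h0 : 0 ≤ θ) (hθ : θ < Real.pi) : 0 < arcX N θ :=
  arcForm_self_pos _ h0 hθ (by simp [arcE])

theorem arcX_mul_sin (N : ℕ) {θ : ℝ} (h0 : 0 ≤ θ) (hθ : θ < Real.pi) :
    (arcCC N θ - arcSS N θ) * arcX N θ * Real.sin θ =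
      (arcP N θ ^ 2 - arcS N θ ^ 2) * Real.sin θ - 2 * arcP N θ * arcS N θ * Real.cos θ := by
  have hu := isUnit_det_arcMatrix (N + 1) h0 hθ
  set T := arcMatrix (N + 1) θ with hT
  let t : ℤ → ℂ := fun i => ((if i = 0 then 1 - θ / Real.pi else -(Real.sin (i * θ) / (Real.pi * i)) : ℝ) : ℂ)
  let of : (Fin (N + 1) → ℝ) → Fin (N + 1) → ℂ := fun v j => (v j : ℂ)
  let z : ℂ := Complex.exp (θ * Complex.I)
  have hmul : ∀ v, (T.map Complex.ofReal).mulVec (of v) = of (T.mulVec v) := by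
    intro v; funext j
    simp [of, Matrix.mulVec, dotProduct]
  have hR : ∀ v, T.mulVec (T⁻¹.mulVec v) = v := fun v => by
    rw [Matrix.mulVec_mulVec, Matrix.mul_nonsing_inv _ hu, Matrix.one_mulVec]
  have hzz : z = Real.cos θ + Real.sin θ * Complex.I := by
    simp only [z]; rw [Complex.exp_mul_I, Complex.ofReal_cos, Complex.ofReal_sin]
  have hz0 : z ≠ 0 := Complex.exp_ne_zero _
  have hzi : z⁻¹ = Real.cos θ - Real.sin θ * Complex.I := by
    simp only [z]; rw [← Complex.exp_neg, ← neg_mul, Complex.exp_mul_I, Complex.cos_neg, Complex.sin_neg,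
      Complex.ofReal_cos, Complex.ofReal_sin]; ring
  set c := cosVec (N + 1) θ with hc
  set s := sinVec (N + 1) θ with hs
  have key := christoffel_darboux_toeplitz t (z := z) (T := T.map Complex.ofReal)
    (e := of c + Complex.I • of s) (p := of (T⁻¹.mulVec c) + Complex.I • of (T⁻¹.mulVec s))
    (x := of (T⁻¹.mulVec (arcE N))) ?_ ?_ ?_ hz0 ?_ ?_ ?_ ?_
  · have hdot : ∀ u v, of u ⬝ᵥ of v = ((u ⬝ᵥ v : ℝ) : ℂ) := by
      intro u v; simp [of, dotProduct]
    have hrev : (fun j => of (T⁻¹.mulVec (arcE N)) (Fin.rev j)) = of fun j => T⁻¹.mulVec (arcE N) (Fin.rev j) := rfl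
    have hcx : c ⬝ᵥ (fun j => T⁻¹.mulVec (arcE N) (Fin.rev j)) = arcP N θ := by
      conv_lhs => rw [hc, ← cosVec_rev]
      simp only [dotProduct, arcP, arcForm]
      exact Equiv.sum_comp Fin.revPerm (fun j => cosVec (N + 1) θ j * T⁻¹.mulVec (arcE N) j)
    have hsx : s ⬝ᵥ (fun j => T⁻¹.mulVec (arcE N) (Fin.rev j)) = -arcS N θ := by
      have h1 : s = -(fun j => sinVec (N + 1) θ (Fin.rev j)) := by rw [sinVec_rev, neg_neg]
      rw [h1, neg_dotProduct]
      simp only [dotProduct, arcS, arcForm]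
      congr 1
      exact Equiv.sum_comp Fin.revPerm (fun j => sinVec (N + 1) θ j * T⁻¹.mulVec (arcE N) j)
    have hx0 : of (T⁻¹.mulVec (arcE N)) 0 = (arcX N θ : ℂ) := by
      simp [of, arcX, arcForm, arcE, hT]
    have e1 : c ⬝ᵥ T⁻¹.mulVec c = arcCC N θ := rfl
    have e2 : s ⬝ᵥ T⁻¹.mulVec s = arcSS N θ := rfl
    have e3 : c ⬝ᵥ T⁻¹.mulVec s = 0 := arcForm_cosVec_sinVec _ _
    have e4 : s ⬝ᵥ T⁻¹.mulVec c = 0 := (arcForm_comm _ _ _ _).trans (arcForm_cosVec_sinVec _ _)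
    have e5 : c ⬝ᵥ T⁻¹.mulVec (arcE N) = arcP N θ := rfl
    have e6 : s ⬝ᵥ T⁻¹.mulVec (arcE N) = arcS N θ := rfl
    rw [hrev, hx0] at key
    simp only [add_dotProduct, dotProduct_add, smul_dotProduct, dotProduct_smul, hdot, hcx, hsx, e1, e2, e3, e4, e5,
      e6, hzz ▸ hzi, hzz, smul_eq_mul] at key
    have h2 : (2 * Complex.I) * ((arcCC N θ - arcSS N θ) * arcX N θ * Real.sin θ : ℝ) = (2 * Complex.I) *
        ((arcP N θ ^ 2 - arcS N θ ^ 2) * Real.sin θ - 2 * arcP N θ * arcS N θ * Real.cos θ : ℝ) := by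
      push_cast at key ⊢
      linear_combination key + (-2 * Complex.sin θ * Complex.I * arcX N θ * arcSS N θ +
        2 * Complex.sin θ * Complex.I * arcS N θ ^ 2) * Complex.I_mul_I
    exact_mod_cast mul_left_cancel₀ (by simp) h2
  · intro i
    simp only [t]
    by_cases h : i = 0
    · simp [h]
    · simp [h]
  · intro i j
    simp only [t, hT, arcMatrix, Matrix.map_apply, Matrix.of_apply]
    by_cases h : i = j
    · simp [h]
    · have h' : (i : ℤ) - (j : ℤ) ≠ 0 := by
        rw [sub_ne_zero]; exact_mod_cast fun h' => h (Fin.ext h')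
      simp [h, h']
  · intro w hw
    refine Matrix.eq_zero_of_mulVec_eq_zero ?_ hw
    have h1 := RingHom.map_det Complex.ofRealHom T
    have h2 : Complex.ofRealHom.mapMatrix T = T.map Complex.ofReal := rfl
    rw [← h2, ← h1]
    simpa using hu.ne_zero
  · intro j
    have h1 : ∀ i, (of c + Complex.I • of s) i = Complex.exp ((((i : ℝ) - N / 2) * θ : ℝ) * Complex.I) := by
      intro i
      rw [Complex.exp_mul_I, ← Complex.ofReal_cos, ← Complex.ofReal_sin]
      simp [of, hc, hs, cosVec, sinVec]
      ring
    rw [h1, h1, ← Complex.exp_add]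
    congr 1
    push_cast [Fin.val_succ, Fin.val_castSucc]
    ring
  · rw [Matrix.mulVec_add, Matrix.mulVec_smul, hmul, hmul, hR, hR]
  · rw [hmul, hR]
    funext j
    by_cases h : j = 0 <;> simp [of, arcE, h]
  · have := arcX_pos N h0 hθ
    have hx0 : of (T⁻¹.mulVec (arcE N)) 0 = (arcX N θ : ℂ) := by
      simp [of, arcX, arcForm, arcE, hT]
    rw [hx0]
    exact_mod_cast this.ne'

theorem sum_mul_add_eq_sum_mul_sub {n : ℕ} (W g : ℕ → ℝ) (h0 : W 0 = 0) (hn : W n = 0) :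
    ∑ j : Fin n, (W (j + 1) - W j) * (g (j + 1) + g j) = ∑ j : Fin n, -(W j + W (j + 1)) * (g (j + 1) - g j) := by
  rw [Fin.sum_univ_eq_sum_range (fun j => (W (j + 1) - W j) * (g (j + 1) + g j)),
    Fin.sum_univ_eq_sum_range (fun j => -(W j + W (j + 1)) * (g (j + 1) - g j)), ← sub_eq_zero,
    ← Finset.sum_sub_distrib]
  have := Finset.sum_range_sub (fun j => 2 * (W j * g j)) n
  simp only [h0, hn, zero_mul, mul_zero, sub_zero] at this
  rw [← this]
  exact Finset.sum_congr rfl fun j _ => by ring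

theorem arcForm_sq_le (n : ℕ) {θ : ℝ} (h0 : 0 ≤ θ) (hθ : θ < Real.pi) (u v : Fin n → ℝ) :
    arcForm n θ u v ^ 2 ≤ arcForm n θ u u * arcForm n θ v v := by
  have h : ∀ x : ℝ, 0 ≤ arcForm n θ u u * (x * x) + 2 * arcForm n θ u v * x + arcForm n θ v v := by
    intro x
    have := arcForm_self_nonneg n h0 hθ (x • u + v)
    simp only [arcForm_add_left, arcForm_add_right, arcForm_smul_left, arcForm_smul_right] at this
    rw [arcForm_comm n θ v u] at this
    linarith
  have := discrim_le_zero h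
  rw [discrim] at this
  linarith

theorem cosVec_zero (n : ℕ) : cosVec n 0 = 1 := by funext j; simp [cosVec]
theorem sinVec_zero (n : ℕ) : sinVec n 0 = 0 := by funext j; simp [sinVec]
theorem arcForm_zero (n : ℕ) (u v : Fin n → ℝ) : arcForm n 0 u v = u ⬝ᵥ v := by
  simp [arcForm, arcMatrix_zero]
theorem arcP_zero (N : ℕ) : arcP N 0 = 1 := by simp [arcP, arcForm_zero, cosVec_zero, arcE]
theorem arcS_zero (N : ℕ) : arcS N 0 = 0 := by simp [arcS, arcForm_zero, sinVec_zero]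
theorem arcX_zero (N : ℕ) : arcX N 0 = 1 := by simp [arcX, arcForm_zero, arcE]
theorem arcCC_zero (N : ℕ) : arcCC N 0 = N + 1 := by simp [arcCC, arcForm_zero, cosVec_zero]
theorem arcSS_zero (N : ℕ) : arcSS N 0 = 0 := by simp [arcSS, arcForm_zero, sinVec_zero]

theorem arcSS_le_arcCC (N : ℕ) {θ : ℝ} (h0 : 0 < θ) (hθ : θ < Real.pi) : arcSS N θ ≤ arcCC N θ := by
  set n := N + 1 with hn
  have hu := isUnit_det_arcMatrix n h0.le hθ
  have hpi := Real.pi_pos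
  set T := arcMatrix n θ with hT
  set u := T⁻¹.mulVec (sinVec n θ) with hudef
  have hTu : T.mulVec u = sinVec n θ := by
    rw [hudef, Matrix.mulVec_mulVec, Matrix.mul_nonsing_inv _ hu, Matrix.one_mulVec]
  have hsum : ∑ j, u j = 0 := by
    have h1 : (fun _ => (1 : ℝ)) ⬝ᵥ u = arcForm n θ (fun _ => 1) (sinVec n θ) := rfl
    have h2 := arcForm_rev n θ (fun _ => (1 : ℝ)) (sinVec n θ)
    rw [sinVec_rev, ← neg_one_smul ℝ, arcForm_smul_right] at h2
    have h3 : ∑ j, u j = (fun _ => (1 : ℝ)) ⬝ᵥ u := by simp [dotProduct]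
    rw [h3, h1]
    linarith
  let W : ℕ → ℝ := fun k => ∑ i ∈ Finset.range k, if h : i < n then u ⟨i, h⟩ else 0
  have hW0 : W 0 = 0 := by simp [W]
  have hWn : W n = 0 := by
    simp only [W]
    rw [← hsum, Finset.sum_range]
    exact Finset.sum_congr rfl fun j _ => by simp
  have hWu : ∀ j : Fin n, W (j + 1) - W j = u j := by
    intro j
    simp only [W]
    rw [Finset.sum_range_succ, add_sub_cancel_left, dif_pos j.2]
  let v : Fin n → ℝ := fun j => -(W j + W (j + 1))
  have hcv : ∀ t, (cosVec n t ⬝ᵥ v) * Real.sin (t / 2) = Real.cos (t / 2) * (sinVec n t ⬝ᵥ u) := by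
    intro t
    have := sum_mul_add_eq_sum_mul_sub (n := n) W (fun j => Real.sin (((j : ℝ) - 1 / 2 - (n - 1) / 2) * t) / 2) hW0 hWn
    simp only [hWu] at this
    simp only [dotProduct, Finset.sum_mul, Finset.mul_sum]
    convert this.symm using 1
    · refine Finset.sum_congr rfl fun j _ => ?_
      simp only [v, cosVec]
      rw [show ((((j : ℕ) + 1 : ℕ) : ℝ) - 1 / 2 - (n - 1) / 2) * t = ((j : ℝ) - (n - 1) / 2) * t + t / 2 by push_cast; ring,
        show ((j : ℝ) - 1 / 2 - (n - 1) / 2) * t = ((j : ℝ) - (n - 1) / 2) * t - t / 2 by ring, Real.sin_add, Real.sin_sub]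
      ring
    · refine Finset.sum_congr rfl fun j _ => ?_
      simp only [sinVec]
      rw [show ((((j : ℕ) + 1 : ℕ) : ℝ) - 1 / 2 - (n - 1) / 2) * t = ((j : ℝ) - (n - 1) / 2) * t + t / 2 by push_cast; ring,
        show ((j : ℝ) - 1 / 2 - (n - 1) / 2) * t = ((j : ℝ) - (n - 1) / 2) * t - t / 2 by ring, Real.sin_add, Real.sin_sub]
      ring
  have hsv : ∀ t, (sinVec n t ⬝ᵥ v) * Real.sin (t / 2) = -(Real.cos (t / 2) * (cosVec n t ⬝ᵥ u)) := by
    intro t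
    have := sum_mul_add_eq_sum_mul_sub (n := n) W (fun j => -Real.cos (((j : ℝ) - 1 / 2 - (n - 1) / 2) * t) / 2) hW0 hWn
    simp only [hWu] at this
    simp only [dotProduct, Finset.sum_mul, Finset.mul_sum]
    rw [← Finset.sum_neg_distrib]
    convert this.symm using 1
    · refine Finset.sum_congr rfl fun j _ => ?_
      simp only [v, sinVec]
      rw [show ((((j : ℕ) + 1 : ℕ) : ℝ) - 1 / 2 - (n - 1) / 2) * t = ((j : ℝ) - (n - 1) / 2) * t + t / 2 by push_cast; ring,
        show ((j : ℝ) - 1 / 2 - (n - 1) / 2) * t = ((j : ℝ) - (n - 1) / 2) * t - t / 2 by ring, Real.cos_add, Real.cos_sub]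
      ring
    · refine Finset.sum_congr rfl fun j _ => ?_
      simp only [cosVec]
      rw [show ((((j : ℕ) + 1 : ℕ) : ℝ) - 1 / 2 - (n - 1) / 2) * t = ((j : ℝ) - (n - 1) / 2) * t + t / 2 by push_cast; ring,
        show ((j : ℝ) - 1 / 2 - (n - 1) / 2) * t = ((j : ℝ) - (n - 1) / 2) * t - t / 2 by ring, Real.cos_add, Real.cos_sub]
      ring
  have hE : Real.sin (θ / 2) ^ 2 * (v ⬝ᵥ T.mulVec v) ≤ Real.cos (θ / 2) ^ 2 * (u ⬝ᵥ T.mulVec u) := by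
    let E : ℝ → ℝ := fun t => Real.cos (θ / 2) ^ 2 * (u ⬝ᵥ (arcMatrix n t).mulVec u) -
      Real.sin (θ / 2) ^ 2 * (v ⬝ᵥ (arcMatrix n t).mulVec v)
    have hEd : ∀ t, HasDerivAt E _ t := fun t =>
      ((hasDerivAt_dotProduct_arcMatrix n t u u).const_mul (Real.cos (θ / 2) ^ 2)).sub
      ((hasDerivAt_dotProduct_arcMatrix n t v v).const_mul (Real.sin (θ / 2) ^ 2))
    have hanti : AntitoneOn E (Set.Icc θ Real.pi) := by
      refine antitoneOn_of_deriv_nonpos (convex_Icc _ _) (fun t _ => (hEd t).continuousAt.continuousWithinAt)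
        (fun t _ => (hEd t).differentiableAt.differentiableWithinAt) fun t ht => ?_
      rw [interior_Icc] at ht
      rw [(hEd t).deriv]
      have hs : 0 < Real.sin (t / 2) := Real.sin_pos_of_pos_of_lt_pi (by linarith [ht.1]) (by linarith [ht.2])
      have hss : Real.sin (θ / 2) ≤ Real.sin (t / 2) :=
        Real.sin_le_sin_of_le_of_le_pi_div_two (by linarith) (by linarith [ht.2]) (by linarith [ht.1])
      have hs0 : 0 < Real.sin (θ / 2) := Real.sin_pos_of_pos_of_lt_pi (by linarith) (by linarith)
      have h1 := hcv t
      have h2 := hsv t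
      set cu := cosVec n t ⬝ᵥ u
      set su := sinVec n t ⬝ᵥ u
      set cv := cosVec n t ⬝ᵥ v
      set sv := sinVec n t ⬝ᵥ v
      have e1 := Real.sin_sq_add_cos_sq (t / 2)
      have e2 := Real.sin_sq_add_cos_sq (θ / 2)
      have key : (cv ^ 2 + sv ^ 2) * Real.sin (t / 2) ^ 2 = Real.cos (t / 2) ^ 2 * (cu ^ 2 + su ^ 2) := by
        linear_combination (cv * Real.sin (t / 2) + Real.cos (t / 2) * su) * h1 +
          (sv * Real.sin (t / 2) - Real.cos (t / 2) * cu) * h2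
      have key2 : Real.sin (t / 2) ^ 2 * (Real.cos (θ / 2) ^ 2 * (cu ^ 2 + su ^ 2) - Real.sin (θ / 2) ^ 2 * (cv ^ 2 + sv ^ 2)) =
          (cu ^ 2 + su ^ 2) * (Real.sin (t / 2) ^ 2 - Real.sin (θ / 2) ^ 2) := by
        linear_combination (-Real.sin (θ / 2) ^ 2) * key + (cu ^ 2 + su ^ 2) * Real.sin (t / 2) ^ 2 * e2 -
          (cu ^ 2 + su ^ 2) * Real.sin (θ / 2) ^ 2 * e1
      have key3 : 0 ≤ Real.cos (θ / 2) ^ 2 * (cu ^ 2 + su ^ 2) - Real.sin (θ / 2) ^ 2 * (cv ^ 2 + sv ^ 2) := by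
        refine nonneg_of_mul_nonneg_right (a := Real.sin (t / 2) ^ 2) ?_ (by positivity)
        rw [key2]
        refine mul_nonneg (by positivity) ?_
        nlinarith
      have : Real.cos (θ / 2) ^ 2 * (-(cu * cu + su * su) / Real.pi) - Real.sin (θ / 2) ^ 2 * (-(cv * cv + sv * sv) / Real.pi) =
        -((Real.cos (θ / 2) ^ 2 * (cu ^ 2 + su ^ 2) - Real.sin (θ / 2) ^ 2 * (cv ^ 2 + sv ^ 2)) / Real.pi) := by ring
      rw [this]
      exact neg_nonpos.2 (div_nonneg key3 hpi.le)
    have h := hanti (Set.left_mem_Icc.2 hθ.le) (Set.right_mem_Icc.2 hθ.le) hθ.le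
    simp only [E, arcMatrix_pi] at h
    simp at h
    linarith
  have hcs := arcForm_sq_le n h0.le hθ (cosVec n θ) (T.mulVec v)
  rw [arcForm_mulVec n h0.le hθ, arcForm_mulVec n h0.le hθ, dotProduct_comm (T.mulVec v)] at hcs
  have h1 := hcv θ
  have h2 : sinVec n θ ⬝ᵥ u = arcSS N θ := rfl
  have h3 : u ⬝ᵥ T.mulVec u = arcSS N θ := by rw [hTu, dotProduct_comm]; rfl
  have h4 : arcForm n θ (cosVec n θ) (cosVec n θ) = arcCC N θ := rfl
  have hγ : 0 ≤ arcCC N θ := arcForm_self_nonneg n h0.le hθ _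
  have hσ : 0 ≤ arcSS N θ := arcForm_self_nonneg n h0.le hθ _
  rw [h2] at h1
  rw [h3] at hE
  rw [h4] at hcs
  have hc : 0 < Real.cos (θ / 2) := Real.cos_pos_of_mem_Ioo ⟨by linarith, by linarith⟩
  have h5 : Real.cos (θ / 2) ^ 2 * arcSS N θ ^ 2 ≤ Real.cos (θ / 2) ^ 2 * (arcCC N θ * arcSS N θ) := by
    calc Real.cos (θ / 2) ^ 2 * arcSS N θ ^ 2 = (cosVec n θ ⬝ᵥ v) ^ 2 * Real.sin (θ / 2) ^ 2 := by
          rw [← mul_pow, ← h1]; ring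
      _ ≤ (arcCC N θ * (v ⬝ᵥ T.mulVec v)) * Real.sin (θ / 2) ^ 2 := by gcongr
      _ = arcCC N θ * (Real.sin (θ / 2) ^ 2 * (v ⬝ᵥ T.mulVec v)) := by ring
      _ ≤ arcCC N θ * (Real.cos (θ / 2) ^ 2 * arcSS N θ) := by gcongr
      _ = _ := by ring
  have h6 := le_of_mul_le_mul_left h5 (by positivity)
  rcases hσ.eq_or_lt with h | h
  · rw [← h]; exact hγ
  · nlinarith

theorem differentiableAt_arcCC (N : ℕ) {θ : ℝ} (h0 : 0 ≤ θ) (hθ : θ < Real.pi) : DifferentiableAt ℝ (arcCC N) θ :=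
  (hasDerivAt_arcForm (N + 1) h0 hθ (hasDerivAt_cosVec (N + 1) θ) (hasDerivAt_cosVec (N + 1) θ)).differentiableAt

theorem differentiableAt_arcSS (N : ℕ) {θ : ℝ} (h0 : 0 ≤ θ) (hθ : θ < Real.pi) : DifferentiableAt ℝ (arcSS N) θ :=
  (hasDerivAt_arcForm (N + 1) h0 hθ (hasDerivAt_sinVec (N + 1) θ) (hasDerivAt_sinVec (N + 1) θ)).differentiableAt

/-- The logarithmic derivative scale `(arcCC - arcSS) / π`. -/
noncomputable def arcβ (N : ℕ) (θ : ℝ) : ℝ := (arcCC N θ - arcSS N θ) / Real.pi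

theorem arcβ_eq (N : ℕ) {θ : ℝ} (h0 : 0 < θ) (hθ : θ < Real.pi) :
    arcβ N θ = ((arcP N θ ^ 2 - arcS N θ ^ 2) - 2 * arcP N θ * arcS N θ * (Real.cos θ / Real.sin θ)) / (Real.pi * arcX N θ) := by
  have h := arcX_mul_sin N h0.le hθ
  have hs := (Real.sin_pos_of_pos_of_lt_pi h0 hθ).ne'
  have hx := (arcX_pos N h0.le hθ).ne'
  have := Real.pi_ne_zero
  rw [arcβ]
  field_simp
  linear_combination h

theorem arcCC_add_arcSS_eq (N : ℕ) {θ : ℝ} (h0 : 0 ≤ θ) (hθ : θ < Real.pi) :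
    arcCC N θ + arcSS N θ = ((N + 1) * (arcP N θ ^ 2 + arcS N θ ^ 2) + 2 * arcP N θ * arcS N θ * arcβ N θ) / arcX N θ := by
  rcases h0.eq_or_lt with rfl | h0
  · simp [arcCC_zero, arcSS_zero, arcP_zero, arcS_zero, arcX_zero]
  have hpi := Real.pi_ne_zero
  set h : ℝ → ℝ := fun t => arcCC N t + arcSS N t - ((N + 1) * (arcP N t ^ 2 + arcS N t ^ 2) +
    2 * arcP N t * arcS N t * arcβ N t) / arcX N t with hh
  have hdβ : ∀ t, 0 ≤ t → t < Real.pi → DifferentiableAt ℝ (arcβ N) t := fun t a b =>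
    ((differentiableAt_arcCC N a b).sub (differentiableAt_arcSS N a b)).div_const _
  have hcont : ContinuousOn h (Set.Icc 0 θ) := by
    intro t ht
    have a := ht.1
    have b := ht.2.trans_lt hθ
    have d1 := (hasDerivAt_arcP N a b).continuousAt
    have d2 := (hasDerivAt_arcS N a b).continuousAt
    have d3 := (hasDerivAt_arcX N a b).continuousAt
    have d4 := (differentiableAt_arcCC N a b).continuousAt
    have d5 := (differentiableAt_arcSS N a b).continuousAt
    have d6 := (hdβ t a b).continuousAt
    have := (arcX_pos N a b).ne'
    refine ContinuousAt.continuousWithinAt ?_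
    fun_prop (disch := assumption)
  have hder : ∀ t ∈ Set.Ioo 0 θ, HasDerivAt h 0 t := by
    intro t ht
    have a := ht.1
    have b := ht.2.trans hθ
    have d1 := (hasDerivAt_arcP N a.le b)
    have d2 := (hasDerivAt_arcS N a.le b)
    have d3 := (hasDerivAt_arcX N a.le b)
    have d4 := (differentiableAt_arcCC_add_arcSS N a.le b)
    have hx := (arcX_pos N a.le b).ne'
    have hs := (Real.sin_pos_of_pos_of_lt_pi a b).ne'
    have dβ : HasDerivAt (arcβ N) _ t := HasDerivAt.congr_of_eventuallyEq
      ((((d1.fun_pow 2).fun_sub (d2.fun_pow 2)).fun_sub (((d1.const_mul 2).fun_mul d2).fun_mul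
        ((Real.hasDerivAt_cos t).fun_div (Real.hasDerivAt_sin t) hs))).fun_div (d3.const_mul Real.pi) (mul_ne_zero hpi hx))
      (by filter_upwards [Ioo_mem_nhds a b] with y hy using arcβ_eq N hy.1 hy.2)
    have e := arcβ_eq N a b
    have e1 : (arcCC N t - arcSS N t) / Real.pi = arcβ N t := rfl
    have dβ' : HasDerivAt (arcβ N) ((N * (2 * arcP N t * arcS N t) + arcβ N t * (arcP N t ^ 2 + arcS N t ^ 2) +
        N * (arcP N t ^ 2 - arcS N t ^ 2) * (Real.cos t / Real.sin t) +
        2 * arcP N t * arcS N t * (1 + (Real.cos t / Real.sin t) ^ 2)) / (Real.pi * arcX N t)) t := by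
      refine dβ.congr_deriv ?_
      rw [e1]
      have e3 := Real.sin_sq_add_cos_sq t
      have e5 : arcβ N t * (Real.pi * arcX N t) * Real.sin t =
        ((arcP N t ^ 2 - arcS N t ^ 2) * Real.sin t - 2 * arcP N t * arcS N t * Real.cos t) := by rw [e]; field_simp
      set β := arcβ N t
      set p := arcP N t
      set s := arcS N t
      set X := arcX N t
      set sn := Real.sin t
      set cs := Real.cos t
      field_simp
      simp only [Nat.cast_ofNat, Nat.add_one_sub_one, pow_one]
      linear_combination (2 * sn * (p ^ 2 + s ^ 2)) * e5
    refine (d4.fun_sub ((((d1.fun_pow 2).fun_add (d2.fun_pow 2)).const_mul ((N : ℝ) + 1)).fun_add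
      (((d1.const_mul 2).fun_mul d2).fun_mul dβ') |>.fun_div d3 hx)).congr_deriv ?_
    have e2 : (arcCC N t - arcSS N t) ^ 2 / Real.pi = Real.pi * arcβ N t ^ 2 := by rw [← e1]; field_simp
    rw [e1, e2]
    set k := Real.cos t / Real.sin t
    have e5 : arcβ N t * (Real.pi * arcX N t) =
        ((arcP N t ^ 2 - arcS N t ^ 2) - 2 * arcP N t * arcS N t * k) := by rw [e]; field_simp
    set β := arcβ N t
    set p := arcP N t
    set s := arcS N t
    set X := arcX N t
    clear_value k β p s X
    field_simp
    simp only [Nat.cast_ofNat, Nat.add_one_sub_one, pow_one]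
    linear_combination 2 * (β * (Real.pi * X) - ((N + 1) * (p ^ 2 - s ^ 2) + 2 * p * s * k)) * e5
  have hc : h θ = h 0 := by
    obtain ⟨c, hc, hc'⟩ := exists_hasDerivAt_eq_slope h (fun _ => 0) h0 hcont hder
    have : θ - 0 ≠ 0 := by simpa using h0.ne'
    field_simp at hc'
    linarith
  have h00 : h 0 = 0 := by
    simp [hh, arcCC_zero, arcSS_zero, arcP_zero, arcS_zero, arcX_zero]
  have := hc.trans h00
  simp only [hh] at this
  linarith

theorem arcP_sq_add_arcS_sq_pos (N : ℕ) {θ : ℝ} (h0 : 0 ≤ θ) (hθ : θ < Real.pi) :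
    0 < arcP N θ ^ 2 + arcS N θ ^ 2 := by
  by_contra hcon
  have hP : arcP N θ = 0 := by nlinarith [sq_nonneg (arcP N θ), sq_nonneg (arcS N θ)]
  have hS : arcS N θ = 0 := by nlinarith [sq_nonneg (arcP N θ), sq_nonneg (arcS N θ)]
  have h := arcCC_add_arcSS_eq N h0 hθ
  rw [hP, hS] at h
  have hγ : 0 ≤ arcCC N θ := arcForm_self_nonneg _ h0 hθ _
  have hσ : 0 ≤ arcSS N θ := arcForm_self_nonneg _ h0 hθ _
  have hc : cosVec (N + 1) θ = 0 := by
    by_contra hc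
    have := arcForm_self_pos _ h0 hθ hc
    have : 0 < arcCC N θ := this
    simp at h
    linarith
  have hs : sinVec (N + 1) θ = 0 := by
    by_contra hc
    have := arcForm_self_pos _ h0 hθ hc
    have : 0 < arcSS N θ := this
    simp at h
    linarith
  have := cosVec_mul_add_sinVec_mul (N + 1) θ 0 0
  rw [hc, hs] at this
  simp at this

theorem arcβ_pos (N : ℕ) {θ : ℝ} (h0 : 0 < θ) (hθ : θ < Real.pi) : 0 < arcβ N θ := by
  have hpi := Real.pi_pos
  have hnn : ∀ t, 0 < t → t < Real.pi → 0 ≤ arcβ N t := fun t a b =>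
    div_nonneg (sub_nonneg.2 (arcSS_le_arcCC N a b)) hpi.le
  refine lt_of_le_of_ne (hnn θ h0 hθ) fun hz => ?_
  let G : ℝ → ℝ := fun t => (arcP N t ^ 2 - arcS N t ^ 2) * Real.sin t - 2 * arcP N t * arcS N t * Real.cos t
  have hG : ∀ t, 0 < t → t < Real.pi → G t = arcβ N t * Real.pi * arcX N t * Real.sin t := fun t a b => by
    have := arcX_mul_sin N a.le b
    simp only [G, arcβ]
    rw [← this]
    field_simp
  have hG0 : G θ = 0 := by rw [hG θ h0 hθ, ← hz]; simp
  have hmin : IsLocalMin G θ := by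
    filter_upwards [Ioo_mem_nhds h0 hθ] with y hy
    rw [hG0, hG y hy.1 hy.2]
    have := hnn y hy.1 hy.2
    have := arcX_pos N hy.1.le hy.2
    have := Real.sin_pos_of_pos_of_lt_pi hy.1 hy.2
    positivity
  have d1 := (hasDerivAt_arcP N h0.le hθ)
  have d2 := (hasDerivAt_arcS N h0.le hθ)
  have hd : HasDerivAt G _ θ := (((d1.fun_pow 2).fun_sub (d2.fun_pow 2)).fun_mul (Real.hasDerivAt_sin θ)).fun_sub
    (((d1.const_mul 2).fun_mul d2).fun_mul (Real.hasDerivAt_cos θ))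
  have h := hmin.hasDerivAt_eq_zero hd
  have e1 : (arcCC N θ - arcSS N θ) / Real.pi = 0 := hz.symm
  rw [e1] at h
  simp only [Nat.cast_ofNat, Nat.add_one_sub_one, pow_one] at h
  simp only [G] at hG0
  have h' : (N + 1) * ((arcP N θ ^ 2 - arcS N θ ^ 2) * Real.cos θ + 2 * arcP N θ * arcS N θ * Real.sin θ) = 0 := by
    linear_combination h
  have hN : (N : ℝ) + 1 ≠ 0 := by positivity
  have h2 := (mul_eq_zero.1 h').resolve_left hN
  have h3 : (arcP N θ ^ 2 + arcS N θ ^ 2) ^ 2 = 0 := by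
    have e3 := Real.sin_sq_add_cos_sq θ
    linear_combination ((arcP N θ ^ 2 - arcS N θ ^ 2) * Real.sin θ - 2 * arcP N θ * arcS N θ * Real.cos θ) * hG0 +
      ((arcP N θ ^ 2 - arcS N θ ^ 2) * Real.cos θ + 2 * arcP N θ * arcS N θ * Real.sin θ) * h2 -
      (arcP N θ ^ 2 + arcS N θ ^ 2) ^ 2 * e3
  have := arcP_sq_add_arcS_sq_pos N h0.le hθ
  exact this.ne' (pow_eq_zero_iff (two_ne_zero) |>.1 h3)

theorem arcP_pos (N : ℕ) {θ : ℝ} (h0 : 0 ≤ θ) (hθ : θ < Real.pi) : 0 < arcP N θ := by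
  by_contra hcon
  have hcont : ContinuousOn (arcP N) (Set.Icc 0 θ) := fun t ht =>
    (hasDerivAt_arcP N ht.1 (ht.2.trans_lt hθ)).continuousAt.continuousWithinAt
  obtain ⟨t, ht, hPt⟩ := intermediate_value_Icc' h0 hcont ⟨not_lt.1 hcon, by rw [arcP_zero]; norm_num⟩
  have ht0 : 0 < t := by
    refine lt_of_le_of_ne ht.1 fun h => ?_
    rw [← h, arcP_zero] at hPt
    norm_num at hPt
  have htπ := ht.2.trans_lt hθ
  have h1 := arcX_mul_sin N ht0.le htπ
  rw [hPt] at h1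
  have h2 := arcβ_pos N ht0 htπ
  have h3 := arcX_pos N ht0.le htπ
  have h4 := Real.sin_pos_of_pos_of_lt_pi ht0 htπ
  have h5 : 0 < arcCC N t - arcSS N t := (div_pos_iff_of_pos_right Real.pi_pos).1 h2
  have : 0 < (arcCC N t - arcSS N t) * arcX N t * Real.sin t := by positivity
  nlinarith [mul_nonneg (sq_nonneg (arcS N t)) h4.le]

theorem arcS_neg (N : ℕ) (hN : 0 < N) {θ : ℝ} (h0 : 0 < θ) (hθ : θ < Real.pi) : arcS N θ < 0 := by
  have hN' : (0 : ℝ) < N := by exact_mod_cast hN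
  have hle : ∀ t, 0 < t → t < Real.pi → arcS N t ≤ 0 := by
    intro t a b
    refine image_le_of_deriv_right_lt_deriv_boundary' (f := arcS N) (B := fun _ => 0) (B' := fun _ => 0) (a := 0) (b := t)
      (fun x hx => (hasDerivAt_arcS N hx.1 (hx.2.trans_lt b)).continuousAt.continuousWithinAt)
      (fun x hx => (hasDerivAt_arcS N hx.1 (hx.2.trans b)).hasDerivWithinAt) (arcS_zero N).le continuousOn_const
      (fun x _ => hasDerivWithinAt_const _ _ _) (fun x hx h => ?_) ⟨a.le, le_rfl⟩
    rw [h]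
    have := arcP_pos N hx.1 (hx.2.trans b)
    have : 0 < N / 2 * arcP N x := by positivity
    linarith
  refine lt_of_le_of_ne (hle θ h0 hθ) fun hz => ?_
  have hmax : IsLocalMax (arcS N) θ := by
    filter_upwards [Ioo_mem_nhds h0 hθ] with y hy
    rw [hz]; exact hle y hy.1 hy.2
  have := hmax.hasDerivAt_eq_zero (hasDerivAt_arcS N h0.le hθ)
  rw [hz] at this
  have := arcP_pos N h0.le hθ
  have : 0 < N / 2 * arcP N θ := by positivity
  linarith

/-- The function `sech (τ / k)`. -/
noncomputable def flowR (k τ : ℝ) : ℝ := 1 / Real.cosh (τ / k)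

/-- The function `k tanh (τ / k)`. -/
noncomputable def flowL (k τ : ℝ) : ℝ := k * (Real.sinh (τ / k) / Real.cosh (τ / k))

theorem flowR_pos (k τ : ℝ) : 0 < flowR k τ := one_div_pos.2 (Real.cosh_pos _)

theorem flowR_le_one (k τ : ℝ) : flowR k τ ≤ 1 :=
  (div_le_one (Real.cosh_pos _)).2 (Real.one_le_cosh _)

theorem flowL_sq {k : ℝ} (hk : 0 < k) (τ : ℝ) : flowL k τ ^ 2 = k ^ 2 * (1 - flowR k τ ^ 2) := by
  have h := (Real.cosh_pos (τ / k)).ne'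
  have h2 := Real.cosh_sq (τ / k)
  simp only [flowL, flowR]
  field_simp
  linarith

theorem flowL_pos {k τ : ℝ} (hk : 0 < k) (hτ : 0 < τ) : 0 < flowL k τ :=
  mul_pos hk (div_pos (Real.sinh_pos_iff.2 (div_pos hτ hk)) (Real.cosh_pos _))

theorem flowL_lt {k : ℝ} (hk : 0 < k) (τ : ℝ) : flowL k τ < k := by
  have : Real.sinh (τ / k) / Real.cosh (τ / k) < 1 := (div_lt_one (Real.cosh_pos _)).2 (Real.sinh_lt_cosh _)
  rw [flowL]
  nlinarith

theorem hasDerivAt_flowL {k : ℝ} (hk : 0 < k) (τ : ℝ) : HasDerivAt (flowL k) (flowR k τ ^ 2) τ := by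
  have h := (Real.cosh_pos (τ / k)).ne'
  have h1 : HasDerivAt (fun t : ℝ => t / k) (1 / k) τ := (hasDerivAt_id τ).div_const k
  refine ((h1.sinh.fun_div h1.cosh h).const_mul k).congr_deriv ?_
  have h2 := Real.cosh_sq (τ / k)
  simp only [flowR]
  field_simp
  linarith

theorem hasDerivAt_flowR {k : ℝ} (hk : 0 < k) (τ : ℝ) :
    HasDerivAt (flowR k) (-(flowL k τ / k ^ 2) * flowR k τ) τ := by
  have h := (Real.cosh_pos (τ / k)).ne'
  have h1 : HasDerivAt (fun t : ℝ => t / k) (1 / k) τ := (hasDerivAt_id τ).div_const k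
  refine ((hasDerivAt_const τ (1 : ℝ)).fun_div h1.cosh h).congr_deriv ?_
  simp only [flowR, flowL]
  field_simp
  ring

theorem flowL_strictMono {k : ℝ} (hk : 0 < k) : StrictMono (flowL k) :=
  strictMono_of_deriv_pos fun τ => by rw [(hasDerivAt_flowL hk τ).deriv]; exact pow_pos (flowR_pos _ _) 2

theorem flowL_sub_le {k : ℝ} (hk : 0 < k) {a b : ℝ} (hab : a ≤ b) : flowL k b - flowL k a ≤ b - a := by
  have : Monotone fun t => t - flowL k t := by
    refine monotone_of_deriv_nonneg (fun t => ((hasDerivAt_id t).sub (hasDerivAt_flowL hk t)).differentiableAt) fun t => ?_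
    rw [((hasDerivAt_id' t).fun_sub (hasDerivAt_flowL hk t)).deriv]
    have := flowR_le_one k t
    have := flowR_pos k t
    nlinarith
  have := this hab
  simp only at this
  linarith

theorem flowL_zero (k : ℝ) : flowL k 0 = 0 := by simp [flowL]

theorem tendsto_flowR {k : ℝ} (hk : 0 < k) : Tendsto (flowR k) atTop (nhds 0) := by
  have h1 : Tendsto (fun τ : ℝ => Real.cosh (τ / k)) atTop atTop := by
    refine tendsto_atTop_mono (f := fun τ => Real.exp (τ / k) / 2) (fun τ => ?_) ?_
    · rw [Real.cosh_eq]
      have := Real.exp_pos (-(τ / k))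
      linarith
    · exact (Real.tendsto_exp_atTop.comp (tendsto_id.atTop_div_const hk)).atTop_div_const (by norm_num)
  exact (tendsto_inv_atTop_zero.comp h1).congr fun τ => by simp [flowR]

theorem tendsto_flowL {k : ℝ} (hk : 0 < k) : Tendsto (flowL k) atTop (nhds k) := by
  have h1 : Tendsto (fun τ => Real.sqrt (k ^ 2 * (1 - flowR k τ ^ 2))) atTop (nhds (Real.sqrt (k ^ 2 * (1 - 0 ^ 2)))) :=
    (Real.continuous_sqrt.tendsto _).comp ((((tendsto_flowR hk).pow 2).const_sub 1).const_mul (k ^ 2))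
  have h2 : Real.sqrt (k ^ 2 * (1 - 0 ^ 2)) = k := by
    rw [show k ^ 2 * (1 - 0 ^ 2) = k ^ 2 by ring, Real.sqrt_sq hk.le]
  rw [h2] at h1
  refine h1.congr' ?_
  filter_upwards [eventually_gt_atTop 0] with τ hτ
  rw [← flowL_sq hk, Real.sqrt_sq (flowL_pos hk hτ).le]

theorem hasDerivAt_arctan_sinh {k : ℝ} (hk : 0 < k) (τ : ℝ) :
    HasDerivAt (fun t => Real.arctan (Real.sinh (t / k))) (flowR k τ / k) τ := by
  have h := (Real.cosh_pos (τ / k)).ne'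
  have h1 : HasDerivAt (fun t : ℝ => t / k) (1 / k) τ := (hasDerivAt_id τ).div_const k
  refine h1.sinh.arctan.congr_deriv ?_
  have h2 := Real.cosh_sq (τ / k)
  rw [add_comm, ← h2, flowR]
  field_simp

theorem HasDerivAt.sub_le_mul_sub {f f' : ℝ → ℝ} {a b m : ℝ} (hab : a ≤ b)
    (hf : ∀ t ∈ Set.Icc a b, HasDerivAt f (f' t) t) (hm : ∀ t ∈ Set.Icc a b, f' t ≤ m) : f b - f a ≤ m * (b - a) := by
  rcases hab.eq_or_lt with rfl | hlt
  · simp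
  obtain ⟨c, hc, hc'⟩ := exists_hasDerivAt_eq_slope f f' hlt (fun t ht => (hf t ht).continuousAt.continuousWithinAt)
    fun t ht => hf t (Set.Ioo_subset_Icc_self ht)
  have h1 := hm c (Set.Ioo_subset_Icc_self hc)
  rw [hc', div_le_iff₀ (sub_pos.2 hlt)] at h1
  exact h1

theorem HasDerivAt.mul_sub_le_sub {f f' : ℝ → ℝ} {a b m : ℝ} (hab : a ≤ b)
    (hf : ∀ t ∈ Set.Icc a b, HasDerivAt f (f' t) t) (hm : ∀ t ∈ Set.Icc a b, m ≤ f' t) : m * (b - a) ≤ f b - f a := by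
  have := HasDerivAt.sub_le_mul_sub (f := fun t => -f t) (f' := fun t => -f' t) (m := -m) hab
    (fun t ht => (hf t ht).neg) (fun t ht => neg_le_neg (hm t ht))
  linarith

/-- A function whose derivative exceeds `-m` whenever it is at most `b₀` cannot drop faster than `m`. -/
theorem HasDerivAt.sub_mul_le_of_drop {f f' : ℝ → ℝ} {a b m b₀ : ℝ} (hab : a ≤ b) (hm0 : 0 ≤ m)
    (hf : ∀ t ∈ Set.Icc a b, HasDerivAt f (f' t) t) (h0 : b₀ ≤ f a)
    (hm : ∀ t ∈ Set.Icc a b, f t ≤ b₀ → -m < f' t) : b₀ - m * (b - a) ≤ f b := by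
  have := image_le_of_deriv_right_lt_deriv_boundary' (f := fun t => -f t) (f' := fun t => -f' t)
    (B := fun t => -b₀ + m * (t - a)) (B' := fun _ => m) (a := a) (b := b)
    (fun t ht => (hf t ht).neg.continuousAt.continuousWithinAt)
    (fun t ht => (hf t (Set.Ico_subset_Icc_self ht)).neg.hasDerivWithinAt) (by simp; exact h0) (by fun_prop)
    (fun x _ => ((((hasDerivAt_id x).sub_const a).const_mul m).const_add (-b₀)).hasDerivWithinAt.congr_deriv (by simp))
    (fun x hx hxe => ?_) (Set.right_mem_Icc.2 hab)
  · linarith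
  · have h1 := hm x (Set.Ico_subset_Icc_self hx) (by nlinarith [mul_nonneg hm0 (sub_nonneg.2 hx.1)])
    linarith

/-- Solutions of the differential system satisfied by the logarithmic derivatives of the arc determinants,
together with the boundary behaviour at both ends. -/
structure IsDysonFlow (k : ℝ) (q w L : ℝ → ℝ) (Linf : ℝ) : Prop where
  one_le : 1 ≤ k
  q_pos : ∀ τ, 0 < τ → 0 < q τ
  w_sq_lt : ∀ τ, 0 < τ → w τ ^ 2 < 1
  hasDerivAt_q : ∀ τ, 0 < τ → HasDerivAt q (q τ / flowL k τ - √(1 - flowR k τ ^ 2 * w τ ^ 2) * w τ) τ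
  hasDerivAt_w : ∀ τ, 0 < τ → HasDerivAt w
    (-(√(1 - flowR k τ ^ 2 * w τ ^ 2) * (q τ - 1 + w τ ^ 2) / q τ) + flowL k τ / k ^ 2 * w τ) τ
  hasDerivAt_L : ∀ τ, 0 < τ → HasDerivAt L (-(flowL k τ / 4) * (w τ ^ 2 / q τ ^ 2 - 1 / flowL k τ ^ 2
    - (q τ - 1) ^ 2 / q τ ^ 2 - 2 * (q τ - 1) / (k * q τ))) τ
  w_pos_near : ∀ᶠ τ in nhdsWithin 0 (Set.Ioi 0), 0 < w τ
  tendsto_q : Tendsto q atTop (nhds 1)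
  tendsto_mu : Tendsto (fun τ => flowL k τ ^ 2 / flowR k τ *
    (√(1 - flowR k τ ^ 2 * w τ ^ 2) * w τ - 1 / flowL k τ) * (q τ - 1)) atTop (nhds 0)
  tendsto_L : Tendsto L atTop (nhds Linf)

namespace IsDysonFlow

variable {k Linf : ℝ} {q w L : ℝ → ℝ}

theorem pos (F : IsDysonFlow k q w L Linf) : 0 < k := lt_of_lt_of_le one_pos F.one_le

theorem abs_w_lt (F : IsDysonFlow k q w L Linf) {τ : ℝ} (hτ : 0 < τ) : |w τ| < 1 :=
  (sq_lt_one_iff_abs_lt_one _).1 (F.w_sq_lt τ hτ)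

theorem r_sq_le_one (k τ : ℝ) : flowR k τ ^ 2 ≤ 1 := pow_le_one₀ (flowR_pos k τ).le (flowR_le_one k τ)

theorem C_sq (F : IsDysonFlow k q w L Linf) {τ : ℝ} (hτ : 0 < τ) :
    √(1 - flowR k τ ^ 2 * w τ ^ 2) ^ 2 = 1 - flowR k τ ^ 2 * w τ ^ 2 := by
  rw [Real.sq_sqrt]
  have h1 := F.w_sq_lt τ hτ
  have h2 := r_sq_le_one k τ
  nlinarith [sq_nonneg (w τ), sq_nonneg (flowR k τ)]

theorem C_pos (F : IsDysonFlow k q w L Linf) {τ : ℝ} (hτ : 0 < τ) :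
    0 < √(1 - flowR k τ ^ 2 * w τ ^ 2) := by
  rw [Real.sqrt_pos]
  have h1 := F.w_sq_lt τ hτ
  have h2 := r_sq_le_one k τ
  nlinarith [sq_nonneg (w τ), sq_nonneg (flowR k τ)]

theorem C_le_one : √(1 - flowR k τ ^ 2 * w τ ^ 2) ≤ 1 := by
  rw [Real.sqrt_le_one]
  have := mul_nonneg (sq_nonneg (flowR k τ)) (sq_nonneg (w τ))
  linarith

theorem hasDerivAt_div_sqrt (F : IsDysonFlow k q w L Linf) {τ : ℝ} (hτ : 0 < τ) :
    HasDerivAt (fun t => q t * (flowR k t / flowL k t))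
      (-(√(1 - flowR k τ ^ 2 * w τ ^ 2) * w τ) * (flowR k τ / flowL k τ)) τ := by
  have hl := flowL_pos F.pos hτ
  have hk := F.pos
  have hl2 := flowL_sq hk τ
  refine ((F.hasDerivAt_q τ hτ).fun_mul ((hasDerivAt_flowR hk τ).fun_div (hasDerivAt_flowL hk τ) hl.ne')).congr_deriv ?_
  field_simp
  linear_combination (-(flowR k τ * q τ)) * hl2

theorem tendsto_div (F : IsDysonFlow k q w L Linf) :
    Tendsto (fun t => q t * (flowR k t / flowL k t)) atTop (nhds 0) := by
  have := F.tendsto_q.mul ((tendsto_flowR F.pos).div (tendsto_flowL F.pos) F.pos.ne')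
  simpa using this

theorem w_pos (F : IsDysonFlow k q w L Linf) {τ : ℝ} (hτ : 0 < τ) : 0 < w τ := by
  have hk := F.pos
  by_contra hneg
  push Not at hneg
  -- the first zero of `w`
  obtain ⟨a, ha0, haw, haq⟩ : ∃ a, 0 < a ∧ w a ≤ 0 ∧ 1 ≤ q a := by
    obtain ⟨b, hb0, hb⟩ := mem_nhdsGT_iff_exists_Ioo_subset.1 F.w_pos_near
    have hb0 : 0 < b := hb0
    set t₀ := min (b / 2) (τ / 2) with ht₀
    have ht₀0 : 0 < t₀ := lt_min (half_pos hb0) (half_pos hτ)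
    have ht₀b : t₀ < b := lt_of_le_of_lt (min_le_left _ _) (half_lt_self hb0)
    have ht₀τ : t₀ < τ := lt_of_le_of_lt (min_le_right _ _) (half_lt_self hτ)
    have hcont : ContinuousOn w (Set.Icc t₀ τ) := fun t ht =>
      (F.hasDerivAt_w t (ht₀0.trans_le ht.1)).continuousAt.continuousWithinAt
    have hcl : IsClosed {t ∈ Set.Icc t₀ τ | w t ≤ 0} :=
      isClosed_Icc.isClosed_le hcont continuousOn_const
    have hne : {t ∈ Set.Icc t₀ τ | w t ≤ 0}.Nonempty := ⟨τ, ⟨ht₀τ.le, le_rfl⟩, hneg⟩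
    have hbd : BddBelow {t ∈ Set.Icc t₀ τ | w t ≤ 0} := ⟨t₀, fun t ht => ht.1.1⟩
    set a := sInf {t ∈ Set.Icc t₀ τ | w t ≤ 0} with haDef
    have ham := hcl.csInf_mem hne hbd
    rw [← haDef] at ham
    have hbef : ∀ t ∈ Set.Ico t₀ a, 0 < w t := by
      intro t ht
      by_contra! hcon
      exact absurd (csInf_le hbd (show t ∈ _ from ⟨⟨ht.1, ht.2.le.trans ham.1.2⟩, hcon⟩)) (not_le.2 ht.2)
    have ha0 : 0 < a := ht₀0.trans_le ham.1.1
    have hta : t₀ < a := lt_of_le_of_ne ham.1.1 fun h => by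
      have := hb ⟨ht₀0, ht₀b⟩
      rw [h] at this
      exact absurd this (not_lt.2 ham.2)
    refine ⟨a, ha0, ham.2, ?_⟩
    have hca := (F.hasDerivAt_w a ha0).continuousAt
    have hev : ∀ᶠ t in nhdsWithin a (Set.Iio a), 0 < w t := by
      filter_upwards [Ioo_mem_nhdsLT hta] with t ht using hbef t ⟨ht.1.le, ht.2⟩
    have hwa : w a = 0 := le_antisymm ham.2
      (ge_of_tendsto (hca.tendsto.mono_left nhdsWithin_le_nhds) (hev.mono fun t ht => ht.le))
    have hd := F.hasDerivAt_w a ha0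
    have hdle : -(√(1 - flowR k a ^ 2 * w a ^ 2) * (q a - 1 + w a ^ 2) / q a) + flowL k a / k ^ 2 * w a ≤ 0 := by
      have h2 := hd.tendsto_slope.mono_left (nhdsWithin_mono a (fun t ht => ne_of_lt ht : Set.Iio a ⊆ {a}ᶜ))
      refine le_of_tendsto h2 ?_
      filter_upwards [hev, self_mem_nhdsWithin] with t ht hta
      rw [slope_def_field, hwa]
      have : t < a := hta
      exact div_nonpos_of_nonneg_of_nonpos (by linarith) (by linarith)
    rw [hwa] at hdle
    have hq := F.q_pos a ha0
    simp at hdle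
    rw [le_div_iff₀ hq] at hdle
    linarith
  -- the region `w ≤ 0, 1 ≤ q` is forward invariant
  have key : ∀ b, a ≤ b → w b ≤ 0 := by
    intro b hb
    have hpos : ∀ t, a ≤ t → 0 < t := fun t ht => ha0.trans_le ht
    have hcl : IsClosed ({t | w t ≤ 0 ∧ 1 ≤ q t} ∩ Set.Icc a b) := by
      have h1 : IsClosed {t ∈ Set.Icc a b | w t ≤ 0} := isClosed_Icc.isClosed_le (fun t ht =>
        (F.hasDerivAt_w t (hpos t ht.1)).continuousAt.continuousWithinAt) continuousOn_const
      have h2 : IsClosed {t ∈ Set.Icc a b | 1 ≤ q t} := isClosed_Icc.isClosed_le continuousOn_const (fun t ht =>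
        (F.hasDerivAt_q t (hpos t ht.1)).continuousAt.continuousWithinAt)
      convert h1.inter h2 using 1
      ext t
      simp only [Set.mem_inter_iff, Set.mem_ofPred_eq]
      tauto
    refine (hcl.Icc_subset_of_forall_exists_gt (a := a) ⟨haw, haq⟩ ?_ (Set.right_mem_Icc.2 hb)).1
    rintro x ⟨⟨hxw, hxq⟩, hx⟩ y hxy
    have hxy : x < y := hxy
    have hx0 := hpos x hx.1
    have hqd : 0 < q x / flowL k x - √(1 - flowR k x ^ 2 * w x ^ 2) * w x := by
      have h1 := div_pos (F.q_pos x hx0) (flowL_pos hk hx0)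
      have h2 := mul_nonpos_of_nonneg_of_nonpos (F.C_pos hx0).le hxw
      linarith
    have h2 := (F.hasDerivAt_q x hx0).tendsto_slope.mono_left
      (nhdsWithin_mono x (fun t ht => ne_of_gt ht : Set.Ioi x ⊆ {x}ᶜ))
    have h3 : ∀ᶠ t in nhdsWithin x (Set.Ioi x), 1 < q t := by
      filter_upwards [h2.eventually (lt_mem_nhds hqd), self_mem_nhdsWithin] with t ht hxt
      have hxt : x < t := hxt
      rw [slope_def_field, div_pos_iff_of_pos_right (sub_pos.2 hxt)] at ht
      linarith
    obtain ⟨z, hz, hzs⟩ := mem_nhdsGT_iff_exists_Ioo_subset.1 h3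
    have hz : x < z := hz
    by_contra hno
    rw [Set.not_nonempty_iff_eq_empty] at hno
    set m := min ((x + z) / 2) y with hm
    have hxm : x < m := lt_min (by linarith) hxy
    have hmz : m < z := lt_of_le_of_lt (min_le_left _ _) (by linarith)
    have hwpos : ∀ t ∈ Set.Ioc x m, 0 < w t := by
      intro t ht
      by_contra! hcon
      have : t ∈ {t | w t ≤ 0 ∧ 1 ≤ q t} ∩ Set.Ioc x y :=
        ⟨⟨hcon, le_of_lt (hzs ⟨ht.1, ht.2.trans_lt hmz⟩)⟩, ht.1, ht.2.trans (min_le_right _ _)⟩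
      rw [hno] at this
      exact this
    have hanti : AntitoneOn (fun t => w t * Real.exp (-(1 / k) * t)) (Set.Icc x m) := by
      have hder : ∀ t, 0 < t → HasDerivAt (fun t => w t * Real.exp (-(1 / k) * t))
          ((-(√(1 - flowR k t ^ 2 * w t ^ 2) * (q t - 1 + w t ^ 2) / q t) + (flowL k t / k ^ 2 - 1 / k) * w t)
            * Real.exp (-(1 / k) * t)) t := fun t ht => by
        refine ((F.hasDerivAt_w t ht).fun_mul ((hasDerivAt_id' t).const_mul (-(1 / k))).exp).congr_deriv ?_
        ring
      refine antitoneOn_of_deriv_nonpos (convex_Icc _ _) (fun t ht =>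
        (hder t (hx0.trans_le ht.1)).continuousAt.continuousWithinAt) (fun t ht => ?_) fun t ht => ?_
      · rw [interior_Icc] at ht
        exact (hder t (hx0.trans ht.1)).differentiableAt.differentiableWithinAt
      · rw [interior_Icc] at ht
        have ht0 := hx0.trans ht.1
        rw [(hder t ht0).deriv]
        refine mul_nonpos_of_nonpos_of_nonneg ?_ (Real.exp_pos _).le
        have h4 : 1 < q t := hzs ⟨ht.1, ht.2.trans hmz⟩
        have h5 := hwpos t ⟨ht.1, ht.2.le⟩
        have h6 : 0 ≤ √(1 - flowR k t ^ 2 * w t ^ 2) * (q t - 1 + w t ^ 2) / q t :=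
          div_nonneg (mul_nonneg (F.C_pos ht0).le (by nlinarith)) (by linarith)
        have h7 : flowL k t / k ^ 2 - 1 / k ≤ 0 := by
          rw [sub_nonpos, div_le_div_iff₀ (by positivity) hk]
          nlinarith [flowL_lt hk t]
        nlinarith
    have h8 := hanti (Set.left_mem_Icc.2 hxm.le) (Set.right_mem_Icc.2 hxm.le) hxm.le
    have h9 := mul_pos (hwpos m ⟨hxm, le_rfl⟩) (Real.exp_pos (-(1 / k) * m))
    have h10 := mul_nonpos_of_nonpos_of_nonneg hxw (Real.exp_pos (-(1 / k) * x)).le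
    simp only at h8
    linarith
  have hmono : MonotoneOn (fun t => q t * (flowR k t / flowL k t)) (Set.Ici a) := by
    refine monotoneOn_of_deriv_nonneg (convex_Ici _) (fun t ht =>
      (F.hasDerivAt_div_sqrt (ha0.trans_le ht)).continuousAt.continuousWithinAt) (fun t ht => ?_) fun t ht => ?_
    all_goals
      rw [interior_Ici] at ht
      have ht : a < t := ht
      have ht0 := ha0.trans ht
    · exact (F.hasDerivAt_div_sqrt ht0).differentiableAt.differentiableWithinAt
    · rw [(F.hasDerivAt_div_sqrt ht0).deriv]
      have h1 := mul_nonpos_of_nonneg_of_nonpos (F.C_pos ht0).le (key t ht.le)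
      have h2 := div_pos (flowR_pos k t) (flowL_pos hk ht0)
      exact mul_nonneg (by linarith) h2.le
  have h1 : q a * (flowR k a / flowL k a) ≤ 0 := by
    refine ge_of_tendsto F.tendsto_div ?_
    filter_upwards [eventually_ge_atTop a] with t ht using hmono Set.self_mem_Ici ht ht
  exact absurd h1 (not_le.2 (mul_pos (F.q_pos a ha0) (div_pos (flowR_pos k a) (flowL_pos hk ha0))))

end IsDysonFlow

namespace IsDysonFlow

variable {k Linf : ℝ} {q w L : ℝ → ℝ}

theorem w_lt_one (F : IsDysonFlow k q w L Linf) {τ : ℝ} (hτ : 0 < τ) : w τ < 1 :=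
  (abs_lt.1 (F.abs_w_lt hτ)).2

theorem hasDerivAt_w' (F : IsDysonFlow k q w L Linf) {τ : ℝ} (hτ : 0 < τ) : HasDerivAt w
    (√(1 - flowR k τ ^ 2 * w τ ^ 2) * ((1 - w τ ^ 2) / q τ - 1) + flowL k τ / k ^ 2 * w τ) τ := by
  refine (F.hasDerivAt_w τ hτ).congr_deriv ?_
  have := (F.q_pos τ hτ).ne'
  field_simp
  ring

theorem hasDerivAt_z (F : IsDysonFlow k q w L Linf) {τ : ℝ} (hτ : 0 < τ) :
    HasDerivAt (fun t => (1 - w t ^ 2) / q t)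
      (√(1 - flowR k τ ^ 2 * w τ ^ 2) * w τ / q τ * (2 - (1 - w τ ^ 2) / q τ)
        - 2 * (flowL k τ / k ^ 2) * w τ ^ 2 / q τ - (1 - w τ ^ 2) / q τ / flowL k τ) τ := by
  have hq := (F.q_pos τ hτ).ne'
  have hl := (flowL_pos F.pos hτ).ne'
  have h := F.pos.ne'
  refine ((((F.hasDerivAt_w τ hτ).fun_pow 2).const_sub 1).fun_div (F.hasDerivAt_q τ hτ) hq).congr_deriv ?_
  simp only [Nat.cast_ofNat, Nat.add_one_sub_one, pow_one]
  field_simp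
  ring

theorem z_pos (F : IsDysonFlow k q w L Linf) {τ : ℝ} (hτ : 0 < τ) : 0 < (1 - w τ ^ 2) / q τ :=
  div_pos (sub_pos.2 (F.w_sq_lt τ hτ)) (F.q_pos τ hτ)

theorem hasDerivAt_sqrt_one_sub (F : IsDysonFlow k q w L Linf) {τ : ℝ} (hτ : 0 < τ) :
    HasDerivAt (fun t => √(1 - w t)) (-(√(1 - flowR k τ ^ 2 * w τ ^ 2) * ((1 - w τ ^ 2) / q τ - 1)
      + flowL k τ / k ^ 2 * w τ) / (2 * √(1 - w τ))) τ :=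
  ((F.hasDerivAt_w' hτ).const_sub 1).sqrt (sub_pos.2 (F.w_lt_one hτ)).ne'

theorem sqrt_one_sub_le_C (F : IsDysonFlow k q w L Linf) {τ : ℝ} (hτ : 0 < τ) :
    √(1 - w τ) ≤ √(1 - flowR k τ ^ 2 * w τ ^ 2) := by
  refine Real.sqrt_le_sqrt ?_
  have h1 := r_sq_le_one k τ
  have h2 := F.w_pos hτ
  have h3 := F.w_lt_one hτ
  nlinarith [mul_nonneg (sub_nonneg.2 h1) (sq_nonneg (w τ))]

theorem kappa_le (F : IsDysonFlow k q w L Linf) {τ : ℝ} (hτ : 0 < τ) :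
    flowL k τ / k ^ 2 ≤ √(1 - flowR k τ ^ 2 * w τ ^ 2) / k := by
  have h1 : flowL k τ / k ≤ √(1 - flowR k τ ^ 2 * w τ ^ 2) := by
    refine Real.le_sqrt_of_sq_le ?_
    rw [div_pow, flowL_sq F.pos, mul_div_cancel_left₀ _ (pow_pos F.pos 2).ne']
    have := F.w_sq_lt τ hτ
    nlinarith [sq_nonneg (flowR k τ)]
  rw [pow_two, ← div_div]
  exact div_le_div_of_nonneg_right h1 F.pos.le

theorem sqrt_pos (F : IsDysonFlow k q w L Linf) {τ : ℝ} (hτ : 0 < τ) : 0 < √(1 - w τ) :=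
  Real.sqrt_pos.2 (sub_pos.2 (F.w_lt_one hτ))

theorem sqrt_lt_one (F : IsDysonFlow k q w L Linf) {τ : ℝ} (hτ : 0 < τ) : √(1 - w τ) < 1 := by
  rw [Real.sqrt_lt' one_pos]
  have := F.w_pos hτ
  linarith

theorem z_drop (F : IsDysonFlow k q w L Linf) (hk : 4 ≤ k) {a b b₀ : ℝ} (ha : 0 < a) (hab : a ≤ b) (hb0 : b₀ ≤ 3 / 2)
    (h0 : b₀ ≤ (1 - w a ^ 2) / q a) : b₀ - 2 / flowL k a * (b - a) ≤ (1 - w b ^ 2) / q b := by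
  have hla := flowL_pos F.pos ha
  refine HasDerivAt.sub_mul_le_of_drop (f := fun t => (1 - w t ^ 2) / q t) hab (by positivity)
    (fun t ht => F.hasDerivAt_z (ha.trans_le ht.1)) h0 fun t ht htb => ?_
  have ht0 := ha.trans_le ht.1
  have hw := F.w_pos ht0
  have hw1 := F.w_lt_one ht0
  have hq := F.q_pos t ht0
  have hC := F.C_pos ht0
  have hκ := F.kappa_le ht0
  have hl : flowL k a ≤ flowL k t := (flowL_strictMono F.pos).monotone ht.1
  have hz := F.z_pos ht0
  set z := (1 - w t ^ 2) / q t
  set C := √(1 - flowR k t ^ 2 * w t ^ 2)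
  have h1 : z / flowL k t < 2 / flowL k a := by
    rw [div_lt_div_iff₀ (hla.trans_le hl) hla]
    nlinarith
  have h2 : C / k ≤ C / 4 := div_le_div_of_nonneg_left hC.le (by norm_num) hk
  have h3 : 2 * (flowL k t / k ^ 2) * w t ^ 2 / q t ≤ C * w t / q t * (1 / 2) := by
    rw [div_mul_eq_mul_div, div_le_div_iff_of_pos_right hq]
    have h4 : flowL k t / k ^ 2 * w t ≤ C / 4 := by
      have : flowL k t / k ^ 2 * w t ≤ C / 4 * w t := mul_le_mul_of_nonneg_right (hκ.trans h2) hw.le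
      nlinarith
    nlinarith
  have h5 : C * w t / q t * (1 / 2) ≤ C * w t / q t * (2 - z) := by
    refine mul_le_mul_of_nonneg_left (by linarith) (by positivity)
  linarith

theorem z_lt_one_add (F : IsDysonFlow k q w L Linf) {c τ : ℝ} (hc : 0 < c) (hc2 : c ≤ 1 / 2) (hk : 4 ≤ k) (hτ : 0 < τ)
    (hl : 16 / c ^ 2 ≤ flowL k τ) : (1 - w τ ^ 2) / q τ < 1 + c := by
  by_contra! hcon
  have hlp := flowL_pos F.pos hτ
  have h4c : (0 : ℝ) < 4 / c := by positivity
  have hz : ∀ t ∈ Set.Icc τ (τ + 4 / c), 1 + c / 2 ≤ (1 - w t ^ 2) / q t := by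
    intro t ht
    have h1 := F.z_drop hk hτ ht.1 (by linarith) hcon
    have h2 : 2 / flowL k τ * (t - τ) ≤ c / 2 := by
      rw [div_mul_eq_mul_div, div_le_iff₀ hlp]
      have h3 : t - τ ≤ 4 / c := by linarith [ht.2]
      have h4 : c / 2 * (16 / c ^ 2) ≤ c / 2 * flowL k τ := mul_le_mul_of_nonneg_left hl (by positivity)
      have h5 : c / 2 * (16 / c ^ 2) = 2 * (4 / c) := by field_simp; norm_num
      linarith
    linarith
  have h := HasDerivAt.sub_le_mul_sub (f := fun t => √(1 - w t)) (m := -(c / 4)) (a := τ) (b := τ + 4 / c) (by linarith)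
    (fun t ht => F.hasDerivAt_sqrt_one_sub (hτ.trans_le ht.1)) fun t ht => ?_
  · have h1 := F.sqrt_lt_one hτ
    have h2 := F.sqrt_pos (τ := τ + 4 / c) (by linarith)
    have h3 : -(c / 4) * (τ + 4 / c - τ) = -1 := by field_simp; ring
    simp only [h3] at h
    linarith
  · have ht0 := hτ.trans_le ht.1
    have hy := F.sqrt_pos ht0
    have hyC := F.sqrt_one_sub_le_C ht0
    have h1 := hz t ht
    have h2 : 0 ≤ flowL k t / k ^ 2 * w t :=
      mul_nonneg (div_nonneg (flowL_pos F.pos ht0).le (by positivity)) (F.w_pos ht0).le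
    rw [div_le_iff₀ (by linarith)]
    nlinarith

theorem one_sub_lt_z (F : IsDysonFlow k q w L Linf) {c τ : ℝ} (hc : 0 < c) (hk : 4 ≤ k) (hkc : 4 / c ≤ k) (hτ : 0 < τ)
    (hl : 32 / c ^ 2 + 8 / c < flowL k τ) : 1 - c < (1 - w τ ^ 2) / q τ := by
  by_contra! hcon
  have hlp := flowL_pos F.pos hτ
  have h8c : (0 : ℝ) < 8 / c := by positivity
  have h32c : (0 : ℝ) < 32 / c ^ 2 := by positivity
  have hτ8 : 8 / c < τ := by
    have := flowL_sub_le F.pos hτ.le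
    rw [flowL_zero] at this
    linarith
  have hz : ∀ t ∈ Set.Icc (τ - 8 / c) τ, (1 - w t ^ 2) / q t ≤ 1 - c / 2 := by
    intro t ht
    by_contra! hlt
    have ht0 : 0 < t := by linarith [ht.1]
    have h1 := F.z_drop hk ht0 ht.2 (by linarith) hlt.le
    have h2 : 2 / flowL k t * (τ - t) < c / 2 := by
      have h6 := flowL_sub_le F.pos ht.2
      rw [div_mul_eq_mul_div, div_lt_iff₀ (flowL_pos F.pos ht0)]
      have h3 : τ - t ≤ 8 / c := by linarith [ht.1]
      have h4 : c / 2 * (32 / c ^ 2) < c / 2 * flowL k t := mul_lt_mul_of_pos_left (by linarith) (by positivity)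
      have h5 : c / 2 * (32 / c ^ 2) = 2 * (8 / c) := by field_simp; norm_num
      linarith
    linarith
  have h := HasDerivAt.mul_sub_le_sub (f := fun t => √(1 - w t)) (m := c / 8) (a := τ - 8 / c) (b := τ) (by linarith)
    (fun t ht => F.hasDerivAt_sqrt_one_sub (by linarith [ht.1])) fun t ht => ?_
  · have h1 := F.sqrt_lt_one hτ
    have h2 := F.sqrt_pos (τ := τ - 8 / c) (by linarith)
    have h3 : c / 8 * (τ - (τ - 8 / c)) = 1 := by field_simp; ring
    simp only [h3] at h
    linarith
  · have ht0 : 0 < t := by linarith [ht.1]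
    have hy := F.sqrt_pos ht0
    have hyC := F.sqrt_one_sub_le_C ht0
    have h1 := hz t ht
    have hw := F.w_pos ht0
    have hw1 := F.w_lt_one ht0
    have hC := F.C_pos ht0
    set C := √(1 - flowR k t ^ 2 * w t ^ 2)
    have h2 : flowL k t / k ^ 2 * w t ≤ C * (c / 4) := by
      have h3 : C / k ≤ C * (c / 4) := by
        rw [div_le_iff₀ F.pos]
        rw [div_le_iff₀ hc] at hkc
        nlinarith
      have h4 : flowL k t / k ^ 2 * w t ≤ C * (c / 4) * w t :=
        mul_le_mul_of_nonneg_right ((F.kappa_le ht0).trans h3) hw.le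
      nlinarith [mul_pos hC hc]
    rw [le_div_iff₀ (by linarith)]
    nlinarith

theorem w_lt (F : IsDysonFlow k q w L Linf) {s c τ : ℝ} (hs : 0 < s) (hs1 : s < 1) (hc : 0 < c) (hcs : c ≤ s / 64)
    (hk : 8 ≤ k) (hτ : 0 < τ) (hz : ∀ t, τ ≤ t → |(1 - w t ^ 2) / q t - 1| ≤ c) (hl : 32 / s ≤ flowL k τ) : w τ < s := by
  by_contra! hcon
  have hlp := flowL_pos F.pos hτ
  have hwt : ∀ t ∈ Set.Icc τ (τ + 1), s / 2 ≤ w t := by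
    intro t ht
    have h := HasDerivAt.mul_sub_le_sub (f := w) (m := -c) (a := τ) (b := t) ht.1
      (fun x hx => F.hasDerivAt_w' (hτ.trans_le hx.1)) fun x hx => ?_
    · nlinarith [ht.1, ht.2]
    · have hx0 := hτ.trans_le hx.1
      have h1 := (abs_le.1 (hz x hx.1)).1
      have h2 : 0 ≤ flowL k x / k ^ 2 * w x :=
        mul_nonneg (div_nonneg (flowL_pos F.pos hx0).le (by positivity)) (F.w_pos hx0).le
      have h3 := F.C_pos hx0
      have h4 : √(1 - flowR k x ^ 2 * w x ^ 2) ≤ 1 := C_le_one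
      nlinarith
  have h := HasDerivAt.mul_sub_le_sub (f := fun t => (1 - w t ^ 2) / q t) (m := s / 16) (a := τ) (b := τ + 1)
    (by linarith) (fun x hx => F.hasDerivAt_z (hτ.trans_le hx.1)) fun t ht => ?_
  · have h1 := abs_le.1 (hz τ le_rfl)
    have h2 := abs_le.1 (hz (τ + 1) (by linarith))
    linarith
  · have ht0 := hτ.trans_le ht.1
    have h1 := abs_le.1 (hz t ht.1)
    have hw := hwt t ht
    have hw0 := F.w_pos ht0
    have hw1 := F.w_lt_one ht0
    have hC := F.C_pos ht0
    have hCz : (1 - w t ^ 2) / q t ≤ √(1 - flowR k t ^ 2 * w t ^ 2) / q t := by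
      refine div_le_div_of_nonneg_right ?_ (F.q_pos t ht0).le
      have h2 : √(1 - flowR k t ^ 2 * w t ^ 2) ≤ 1 := C_le_one
      have h3 := F.C_sq ht0
      have h4 := r_sq_le_one k t
      nlinarith [mul_nonneg (sub_nonneg.2 h4) (sq_nonneg (w t))]
    have hlt : flowL k τ ≤ flowL k t := (flowL_strictMono F.pos).monotone ht.1
    have hκ := F.kappa_le ht0
    have hq := F.q_pos t ht0
    set z := (1 - w t ^ 2) / q t
    set C := √(1 - flowR k t ^ 2 * w t ^ 2)
    have h2 : C / k ≤ C / 8 := div_le_div_of_nonneg_left hC.le (by norm_num) hk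
    have h3 : 2 * (flowL k t / k ^ 2) * w t ^ 2 / q t ≤ C * w t / q t * (1 / 4) := by
      rw [div_mul_eq_mul_div, div_le_div_iff_of_pos_right hq]
      have h4 : flowL k t / k ^ 2 * w t ≤ C / 8 := by
        have : flowL k t / k ^ 2 * w t ≤ C / 8 * w t := mul_le_mul_of_nonneg_right (hκ.trans h2) hw0.le
        nlinarith
      nlinarith
    have h5 : C * w t / q t * (3 / 4) ≤ C * w t / q t * (2 - z) := by
      refine mul_le_mul_of_nonneg_left (by linarith) (by positivity)
    have h6 : z / flowL k t ≤ s / 16 := by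
      rw [div_le_iff₀ (hlp.trans_le hlt)]
      rw [div_le_iff₀ hs] at hl
      nlinarith
    have h7 : s / 4 ≤ C * w t / q t := by
      have : C * w t / q t = C / q t * w t := by ring
      rw [this]
      have : (1 : ℝ) / 2 ≤ C / q t := by linarith
      nlinarith
    linarith

/-- Far from the origin the flow stays close to its equilibrium. -/
theorem exists_near_equilibrium (s : ℝ) (hs : 0 < s) (hs1 : s ≤ 1 / 2) : ∃ K₀ > 0, ∃ k₀ ≥ 8,
    ∀ (k Linf : ℝ) (q w L : ℝ → ℝ), IsDysonFlow k q w L Linf → k₀ ≤ k → ∀ τ, 0 < τ → K₀ ≤ flowL k τ →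
      0 < w τ ∧ w τ < s ∧ |(1 - w τ ^ 2) / q τ - 1| ≤ s := by
  set c := s / 64 with hc
  have hc0 : 0 < c := by positivity
  refine ⟨32 / c ^ 2 + 8 / c + 1, by positivity, 8 + 4 / c, by simp; positivity, fun k Linf q w L F hk τ hτ hl => ?_⟩
  have h4c : (0 : ℝ) < 4 / c := by positivity
  have h8c : (0 : ℝ) < 8 / c := by positivity
  have h16 : (16 : ℝ) / c ^ 2 ≤ 32 / c ^ 2 := div_le_div_of_nonneg_right (by norm_num) (by positivity)
  have hz : ∀ t, τ ≤ t → |(1 - w t ^ 2) / q t - 1| ≤ c := by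
    intro t ht
    have hlt : flowL k τ ≤ flowL k t := (flowL_strictMono F.pos).monotone ht
    have h1 := F.z_lt_one_add hc0 (by linarith) (by linarith) (hτ.trans_le ht) (by linarith)
    have h2 := F.one_sub_lt_z hc0 (by linarith) (by linarith) (hτ.trans_le ht) (by linarith)
    rw [abs_le]
    constructor <;> linarith
  refine ⟨F.w_pos hτ, F.w_lt hs (by linarith) hc0 hc.le (by linarith) hτ hz ?_, (hz τ le_rfl).trans (by linarith)⟩
  have : 32 / s ≤ 32 / c ^ 2 := div_le_div_of_nonneg_left (by norm_num) (by positivity) (by nlinarith)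
  linarith

end IsDysonFlow

namespace IsDysonFlow

variable {k Linf : ℝ} {q w L : ℝ → ℝ}

theorem hasDerivAt_C (F : IsDysonFlow k q w L Linf) {τ : ℝ} (hτ : 0 < τ) :
    HasDerivAt (fun t => √(1 - flowR k t ^ 2 * w t ^ 2))
      (flowR k τ ^ 2 * w τ * (q τ - 1 + w τ ^ 2) / q τ) τ := by
  have hC := F.C_pos hτ
  have hq := F.q_pos τ hτ
  have hk := F.pos
  have h := ((((hasDerivAt_flowR hk τ).fun_pow 2).fun_mul ((F.hasDerivAt_w τ hτ).fun_pow 2)).const_sub 1).sqrt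
    (Real.sqrt_pos.1 hC).ne'
  refine h.congr_deriv ?_
  simp only [Nat.cast_ofNat, Nat.add_one_sub_one, pow_one]
  field_simp
  ring

/-- The scaled discrepancy `C w - 1 / ℓ`. -/
theorem hasDerivAt_g (F : IsDysonFlow k q w L Linf) {τ : ℝ} (hτ : 0 < τ) :
    HasDerivAt (fun t => √(1 - flowR k t ^ 2 * w t ^ 2) * w t - 1 / flowL k t)
      (-((1 - 2 * flowR k τ ^ 2 * w τ ^ 2) * (q τ - 1 + w τ ^ 2) / q τ)
        + flowL k τ / k ^ 2 * (√(1 - flowR k τ ^ 2 * w τ ^ 2) * w τ - 1 / flowL k τ) + 1 / flowL k τ ^ 2) τ := by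
  have hC2 := F.C_sq hτ
  have hq := F.q_pos τ hτ
  have hk := F.pos
  have hl := flowL_pos hk hτ
  have hl2 := flowL_sq hk τ
  refine (((F.hasDerivAt_C hτ).fun_mul (F.hasDerivAt_w τ hτ)).fun_sub
    ((hasDerivAt_const τ (1 : ℝ)).fun_div (hasDerivAt_flowL hk τ) hl.ne')).congr_deriv ?_
  set C := √(1 - flowR k τ ^ 2 * w τ ^ 2)
  have h1 : flowR k τ ^ 2 / flowL k τ ^ 2 = 1 / flowL k τ ^ 2 - 1 / k ^ 2 := by
    field_simp
    linarith
  have h2 : flowL k τ / k ^ 2 * (1 / flowL k τ) = 1 / k ^ 2 := by field_simp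
  have h3 : (0 * flowL k τ - 1 * flowR k τ ^ 2) / flowL k τ ^ 2 = -(flowR k τ ^ 2 / flowL k τ ^ 2) := by ring
  rw [h3, h1]
  linear_combination (-((q τ - 1 + w τ ^ 2) / q τ)) * hC2 + h2

/-- The virial-type quantity and its derivative. -/
theorem hasDerivAt_muE (F : IsDysonFlow k q w L Linf) {τ : ℝ} (hτ : 0 < τ) :
    HasDerivAt (fun t => -(flowL k t ^ 2 / flowR k t *
        (√(1 - flowR k t ^ 2 * w t ^ 2) * w t - 1 / flowL k t) * (q t - 1)))
      (flowL k τ ^ 2 / flowR k τ * (q τ * (√(1 - flowR k τ ^ 2 * w τ ^ 2) * w τ - 1 / flowL k τ) ^ 2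
        + (1 - 2 * flowR k τ ^ 2 * w τ ^ 2) * ((1 - w τ ^ 2) / q τ) * (q τ - 1) ^ 2
        - (√(1 - flowR k τ ^ 2 * w τ ^ 2) * w τ - 1 / flowL k τ) * (q τ - 1) / flowL k τ
        - flowR k τ ^ 2 * w τ ^ 4 * (q τ - 1))) τ := by
  have hC2 := F.C_sq hτ
  have hq := F.q_pos τ hτ
  have hk := F.pos
  have hl := flowL_pos hk hτ
  have hr := flowR_pos k τ
  have hl2 := flowL_sq hk τ
  refine (((((hasDerivAt_flowL hk τ).fun_pow 2).fun_div (hasDerivAt_flowR hk τ) hr.ne').fun_mul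
    (F.hasDerivAt_g hτ)).fun_mul ((F.hasDerivAt_q τ hτ).sub_const 1)).fun_neg.congr_deriv ?_
  simp only [Nat.cast_ofNat, Nat.add_one_sub_one, pow_one]
  set C := √(1 - flowR k τ ^ 2 * w τ ^ 2)
  set l := flowL k τ
  set r := flowR k τ
  set g := C * w τ - 1 / l with hg
  have hCw : C * w τ = g + 1 / l := by rw [hg]; ring
  rw [hCw]
  have hw2 : g ^ 2 + 2 * g / l + 1 / l ^ 2 + r ^ 2 * w τ ^ 4 = w τ ^ 2 := by
    have : (g + 1 / l) ^ 2 = C ^ 2 * w τ ^ 2 := by rw [← hCw]; ring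
    rw [hC2] at this
    have h2 : (g + 1 / l) ^ 2 = g ^ 2 + 2 * g / l + 1 / l ^ 2 := by field_simp; ring
    linarith
  have hk2 : 1 / k ^ 2 = (1 - r ^ 2) / l ^ 2 := by
    rw [hl2]
    have : 1 - r ^ 2 ≠ 0 := by
      intro h
      rw [h] at hl2
      have := pow_pos hl 2
      linarith
    field_simp
  rw [div_eq_mul_one_div l (k ^ 2), hk2]
  clear_value g C
  have e1 : (q τ - 1 + w τ ^ 2) / q τ = 1 - (1 - w τ ^ 2) / q τ := by field_simp; ring
  rw [mul_div_assoc, e1]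
  set z := (1 - w τ ^ 2) / q τ with hz
  have hzq : z * q τ = 1 - w τ ^ 2 := by rw [hz]; field_simp
  clear_value z
  field_simp at hw2 ⊢
  linear_combination (-(l ^ 2 * (1 - 2 * r ^ 2 * w τ ^ 2) * (q τ - 1))) * hzq - (q τ - 1) * hw2
end IsDysonFlow

namespace IsDysonFlow

theorem pow_four_le {C w g u : ℝ} (hC : 3 / 4 ≤ C ^ 2) (h : C * w = g + u) : w ^ 4 ≤ 15 * (g ^ 4 + u ^ 4) := by
  have h1 : C ^ 2 * w ^ 2 = (g + u) ^ 2 := by rw [← h]; ring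
  have h2 : w ^ 2 ≤ 8 / 3 * (g ^ 2 + u ^ 2) := by
    nlinarith [sq_nonneg (g - u), mul_nonneg (sub_nonneg.2 hC) (sq_nonneg w)]
  have h3 : (w ^ 2) ^ 2 ≤ (8 / 3 * (g ^ 2 + u ^ 2)) ^ 2 := pow_le_pow_left₀ (sq_nonneg w) h2 2
  nlinarith [sq_nonneg (g ^ 2 - u ^ 2), sq_nonneg (g ^ 2), sq_nonneg (u ^ 2)]

theorem sq_add_sq_le {g δ u r w q e z : ℝ} (hu0 : 0 < u) (hu : u ≤ 1 / 256) (hr0 : 0 ≤ r) (hr : r ≤ 1)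
    (hw4 : w ^ 4 ≤ 15 * (g ^ 4 + u ^ 4)) (hg : |g| ≤ 1 / 256) (hδ : |δ| ≤ 1 / 128) (hq : q = 1 + δ)
    (he : 7 / 8 ≤ e) (hz : 7 / 8 ≤ z) :
    1 / 2 * (g ^ 2 + δ ^ 2) ≤ q * g ^ 2 + e * z * δ ^ 2 - g * δ * u - r ^ 2 * w ^ 4 * δ + 450 * r ^ 4 * u ^ 8 := by
  have h1 : 15 / 16 * g ^ 2 ≤ q * g ^ 2 := mul_le_mul_of_nonneg_right (by rw [hq]; linarith [(abs_le.1 hδ).1]) (sq_nonneg g)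
  have h2 : 3 / 4 * δ ^ 2 ≤ e * z * δ ^ 2 := mul_le_mul_of_nonneg_right (by nlinarith) (sq_nonneg δ)
  have h3 : g * δ * u ≤ (g ^ 2 + δ ^ 2) / 512 := by
    have : g * δ * u ≤ (g ^ 2 + δ ^ 2) / 2 * u := mul_le_mul_of_nonneg_right (by nlinarith [sq_nonneg (g - δ)]) hu0.le
    nlinarith [sq_nonneg g, sq_nonneg δ]
  have h4 : r ^ 2 * w ^ 4 * δ ≤ r ^ 2 * (15 * (g ^ 4 + u ^ 4)) * |δ| :=
    (mul_le_mul_of_nonneg_left (le_abs_self δ) (by positivity)).trans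
      (mul_le_mul_of_nonneg_right (mul_le_mul_of_nonneg_left hw4 (sq_nonneg r)) (abs_nonneg δ))
  have hg2 : g ^ 2 ≤ 1 / 256 := by
    rw [← sq_abs]; nlinarith [abs_nonneg g]
  have hr2 : r ^ 2 ≤ 1 := pow_le_one₀ hr0 hr
  have h5 : r ^ 2 * g ^ 4 * |δ| ≤ g ^ 2 / 256 := by
    have a1 : r ^ 2 * g ^ 4 ≤ g ^ 2 / 256 := by
      have : r ^ 2 * g ^ 4 ≤ 1 * g ^ 4 := mul_le_mul_of_nonneg_right hr2 (by positivity)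
      nlinarith [sq_nonneg g]
    have : r ^ 2 * g ^ 4 * |δ| ≤ r ^ 2 * g ^ 4 * 1 := mul_le_mul_of_nonneg_left (by linarith) (by positivity)
    linarith
  have h6 : 15 * (r ^ 2 * u ^ 4) * |δ| ≤ δ ^ 2 / 8 + 450 * r ^ 4 * u ^ 8 := by
    have := sq_nonneg (|δ| - 60 * (r ^ 2 * u ^ 4))
    rw [← sq_abs δ]
    nlinarith
  have h7 : r ^ 2 * (15 * (g ^ 4 + u ^ 4)) * |δ| = 15 * (r ^ 2 * g ^ 4 * |δ|) + 15 * (r ^ 2 * u ^ 4) * |δ| := by ring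
  nlinarith [sq_nonneg g, sq_nonneg δ]

theorem L_identity {l k q w g r δ : ℝ} (hl : l ≠ 0) (hk : k ≠ 0) (hq : q ≠ 0) (hδ : q = 1 + δ)
    (hw : w ^ 2 = (g + 1 / l) ^ 2 + r ^ 2 * w ^ 4) :
    -(l / 4) * (w ^ 2 / q ^ 2 - 1 / l ^ 2 - (q - 1) ^ 2 / q ^ 2 - 2 * (q - 1) / (k * q)) - 1 / 2 * (δ / l - g) =
      1 / 2 * (δ / l - g) * (1 / q ^ 2 - 1) - l / (4 * q ^ 2) * (g ^ 2 + r ^ 2 * w ^ 4 - δ ^ 2 / l ^ 2 - δ ^ 2)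
        + l * δ / (2 * k * q) := by
  obtain rfl : δ = q - 1 := by linarith
  generalize w ^ 4 = v at *
  rw [hw]
  field_simp
  ring

set_option maxHeartbeats 800000 in
theorem abs_L_le {l l₁ k q w g r δ : ℝ} (hl : 256 ≤ l) (hl₁ : 0 < l₁) (hk : 0 < k) (hr0 : 0 < r) (hr : r ≤ 1)
    (hg : |g| ≤ 1 / 256) (hδ' : |δ| ≤ 1 / 128) (hδ : q = 1 + δ)
    (hw : w ^ 2 = (g + 1 / l) ^ 2 + r ^ 2 * w ^ 4) (hw4 : w ^ 4 ≤ 15 * (g ^ 4 + (1 / l) ^ 4)) :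
    |-(l / 4) * (w ^ 2 / q ^ 2 - 1 / l ^ 2 - (q - 1) ^ 2 / q ^ 2 - 2 * (q - 1) / (k * q)) - 1 / 2 * (δ / l - g)| ≤
      10 * l * (g ^ 2 + δ ^ 2) + 8 * r ^ 2 / l ^ 3 + 1 / 2 * (l ^ 2 / r) * δ ^ 2 / l₁ + 1 / 2 * l₁ * r / k ^ 2 := by
  have hl0 : 0 < l := by linarith
  have hδ1 := abs_le.1 hδ'
  have hq : 1 / 2 ≤ q := by linarith
  have hq0 : 0 < q := by linarith
  have hiq : 1 / q ^ 2 ≤ 4 / 3 := by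
    rw [div_le_div_iff₀ (by positivity) (by norm_num)]
    have : 127 / 128 ≤ q := by linarith
    nlinarith
  have hu : 0 < 1 / l := by positivity
  have hu1 : 1 / l ≤ 1 / 256 := one_div_le_one_div_of_le (by norm_num) hl
  rw [L_identity hl0.ne' hk.ne' hq0.ne' hδ hw]
  have b1 : |1 / 2 * (δ / l - g) * (1 / q ^ 2 - 1)| ≤ 4 * (g ^ 2 + δ ^ 2) := by
    have e1 : 1 / q ^ 2 - 1 = -(δ * (2 + δ)) * (1 / q ^ 2) := by
      rw [hδ] at hq0 ⊢
      field_simp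
      ring
    rw [e1, abs_mul, abs_mul, abs_mul, abs_neg, abs_mul, abs_of_pos (by positivity : (0:ℝ) < 1 / q ^ 2),
      abs_of_pos (by norm_num : (0:ℝ) < 1 / 2)]
    have a1 : |δ / l - g| ≤ |δ| + |g| := by
      refine (abs_sub _ _).trans (add_le_add ?_ le_rfl)
      rw [abs_div, abs_of_pos hl0]
      exact div_le_self (abs_nonneg _) (by linarith)
    have a2 : |2 + δ| ≤ 3 := by rw [abs_le]; constructor <;> linarith
    have a3 : |δ| * |2 + δ| * (1 / q ^ 2) ≤ |δ| * 3 * (4 / 3) :=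
      mul_le_mul (mul_le_mul_of_nonneg_left a2 (abs_nonneg _)) hiq (by positivity) (by positivity)
    have a4 : 1 / 2 * |δ / l - g| * (|δ| * |2 + δ| * (1 / q ^ 2)) ≤ 1 / 2 * (|δ| + |g|) * (|δ| * 3 * (4 / 3)) :=
      mul_le_mul (by linarith) a3 (by positivity) (by positivity)
    have := sq_abs δ
    have := sq_abs g
    nlinarith [sq_nonneg (|δ| - |g|), abs_nonneg δ, abs_nonneg g]
  have hg2 : g ^ 2 ≤ 1 / 256 := by
    rw [← sq_abs]; nlinarith [abs_nonneg g]
  have hr2 : r ^ 2 ≤ 1 := pow_le_one₀ hr0.le hr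
  have b2 : |l / (4 * q ^ 2) * (g ^ 2 + r ^ 2 * w ^ 4 - δ ^ 2 / l ^ 2 - δ ^ 2)| ≤
      5 * l * (g ^ 2 + δ ^ 2) + 8 * r ^ 2 / l ^ 3 := by
    have a1 : |g ^ 2 + r ^ 2 * w ^ 4 - δ ^ 2 / l ^ 2 - δ ^ 2| ≤ 2 * (g ^ 2 + δ ^ 2) + 15 * r ^ 2 * (1 / l) ^ 4 := by
      have c1 : r ^ 2 * w ^ 4 ≤ r ^ 2 * (15 * (g ^ 4 + (1 / l) ^ 4)) := mul_le_mul_of_nonneg_left hw4 (sq_nonneg r)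
      have c2 : r ^ 2 * g ^ 4 ≤ g ^ 2 / 256 := by
        have : r ^ 2 * g ^ 4 ≤ 1 * g ^ 4 := mul_le_mul_of_nonneg_right hr2 (by positivity)
        nlinarith [sq_nonneg g]
      have c3 : 0 ≤ r ^ 2 * w ^ 4 := by positivity
      have c4 : δ ^ 2 / l ^ 2 ≤ δ ^ 2 := div_le_self (sq_nonneg _) (by nlinarith)
      have c5 : 0 ≤ δ ^ 2 / l ^ 2 := by positivity
      have c6 : 0 ≤ 15 * r ^ 2 * (1 / l) ^ 4 := by positivity
      rw [abs_le]
      constructor <;> nlinarith [sq_nonneg g, sq_nonneg δ]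
    have a2 : l / (4 * q ^ 2) ≤ l / 3 := by
      have : l / (4 * q ^ 2) = l / 4 * (1 / q ^ 2) := by field_simp
      rw [this]
      nlinarith
    rw [abs_mul, abs_of_pos (by positivity : 0 < l / (4 * q ^ 2))]
    have a3 := mul_le_mul a2 a1 (abs_nonneg _) (by positivity)
    have a4 : l / 3 * (15 * r ^ 2 * (1 / l) ^ 4) = 5 * r ^ 2 / l ^ 3 := by field_simp; norm_num
    have a5 : 5 * r ^ 2 / l ^ 3 ≤ 8 * r ^ 2 / l ^ 3 :=
      div_le_div_of_nonneg_right (by linarith [sq_nonneg r]) (by positivity)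
    rw [mul_add, a4] at a3
    have a6 := mul_nonneg hl0.le (add_nonneg (sq_nonneg g) (sq_nonneg δ))
    have a7 : l / 3 * (2 * (g ^ 2 + δ ^ 2)) = 2 / 3 * (l * (g ^ 2 + δ ^ 2)) := by ring
    have a8 : 5 * l * (g ^ 2 + δ ^ 2) = 5 * (l * (g ^ 2 + δ ^ 2)) := by ring
    rw [a7] at a3
    rw [a8]
    linarith
  have b3 : |l * δ / (2 * k * q)| ≤ 1 / 2 * (l ^ 2 / r) * δ ^ 2 / l₁ + 1 / 2 * l₁ * r / k ^ 2 := by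
    rw [abs_div, abs_mul, abs_of_pos hl0, abs_of_pos (by positivity : 0 < 2 * k * q)]
    have a1 : l * |δ| / (2 * k * q) ≤ l * |δ| / k :=
      div_le_div_of_nonneg_left (by positivity) hk (by
        have := mul_le_mul_of_nonneg_left (by linarith : 1 ≤ 2 * q) hk.le
        linarith)
    refine a1.trans ?_
    have a2 : 1 / 2 * (l ^ 2 / r) * δ ^ 2 / l₁ + 1 / 2 * l₁ * r / k ^ 2 - l * |δ| / k =
        (l * |δ| * k - l₁ * r) ^ 2 / (2 * r * l₁ * k ^ 2) := by
      rw [← sq_abs δ]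
      field_simp
      ring
    have a3 : 0 ≤ (l * |δ| * k - l₁ * r) ^ 2 / (2 * r * l₁ * k ^ 2) := by positivity
    linarith
  have := abs_add_le (1 / 2 * (δ / l - g) * (1 / q ^ 2 - 1) - l / (4 * q ^ 2) * (g ^ 2 + r ^ 2 * w ^ 4 - δ ^ 2 / l ^ 2 - δ ^ 2))
    (l * δ / (2 * k * q))
  have := abs_sub (1 / 2 * (δ / l - g) * (1 / q ^ 2 - 1)) (l / (4 * q ^ 2) * (g ^ 2 + r ^ 2 * w ^ 4 - δ ^ 2 / l ^ 2 - δ ^ 2))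
  have c1 : 4 * (g ^ 2 + δ ^ 2) ≤ 5 * l * (g ^ 2 + δ ^ 2) :=
    mul_le_mul_of_nonneg_right (by linarith) (add_nonneg (sq_nonneg g) (sq_nonneg δ))
  have c2 : 10 * l * (g ^ 2 + δ ^ 2) = 5 * l * (g ^ 2 + δ ^ 2) + 5 * l * (g ^ 2 + δ ^ 2) := by ring
  linarith

end IsDysonFlow

namespace IsDysonFlow

variable {k Linf : ℝ} {q w L : ℝ → ℝ}

theorem abs_q_sub_one_le {w q s : ℝ} (hq : 0 < q) (hs : s ≤ 1 / 4) (hw0 : 0 < w) (hw : w < s)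
    (hz : |(1 - w ^ 2) / q - 1| ≤ s) : |q - 1| ≤ 2 * s := by
  have hz := abs_le.1 hz
  set z := (1 - w ^ 2) / q with hzd
  have hzq : z * q = 1 - w ^ 2 := by rw [hzd]; field_simp
  have hz0 : 3 / 4 ≤ z := by linarith
  have hq1 : q ≤ 4 / 3 := by nlinarith
  rw [abs_le]
  constructor <;> nlinarith

theorem near_facts (F : IsDysonFlow k q w L Linf) {τ : ℝ} (hτ : 0 < τ) (hl : 256 ≤ flowL k τ) (hw : w τ < 1 / 256)
    (hz : |(1 - w τ ^ 2) / q τ - 1| ≤ 1 / 256) :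
    |q τ - 1| ≤ 1 / 128 ∧ |√(1 - flowR k τ ^ 2 * w τ ^ 2) * w τ - 1 / flowL k τ| ≤ 1 / 256 ∧
    7 / 8 ≤ 1 - 2 * flowR k τ ^ 2 * w τ ^ 2 ∧ 7 / 8 ≤ (1 - w τ ^ 2) / q τ ∧
    w τ ^ 4 ≤ 15 * ((√(1 - flowR k τ ^ 2 * w τ ^ 2) * w τ - 1 / flowL k τ) ^ 4 + (1 / flowL k τ) ^ 4) ∧
    w τ ^ 2 = (√(1 - flowR k τ ^ 2 * w τ ^ 2) * w τ - 1 / flowL k τ + 1 / flowL k τ) ^ 2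
      + flowR k τ ^ 2 * w τ ^ 4 := by
  have hw0 := F.w_pos hτ
  have hC2 := F.C_sq hτ
  have hC0 := F.C_pos hτ
  have hC1 : √(1 - flowR k τ ^ 2 * w τ ^ 2) ≤ 1 := C_le_one
  have hr := r_sq_le_one k τ
  have hrw : flowR k τ ^ 2 * w τ ^ 2 ≤ 1 / 256 := by
    have : flowR k τ ^ 2 * w τ ^ 2 ≤ 1 * w τ ^ 2 := mul_le_mul_of_nonneg_right hr (sq_nonneg _)
    nlinarith
  set C := √(1 - flowR k τ ^ 2 * w τ ^ 2)
  refine ⟨(abs_q_sub_one_le (F.q_pos τ hτ) (by norm_num) hw0 hw hz).trans (by norm_num), ?_, by linarith,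
    by linarith [(abs_le.1 hz).1], pow_four_le (C := C) (by linarith) (by ring), ?_⟩
  · have h1 : 0 < 1 / flowL k τ := by positivity
    have h2 : 1 / flowL k τ ≤ 1 / 256 := one_div_le_one_div_of_le (by norm_num) hl
    rw [abs_le]
    constructor <;> nlinarith
  · rw [sub_add_cancel, mul_pow, hC2]
    ring

theorem hasDerivAt_Phi (F : IsDysonFlow k q w L Linf) {τ : ℝ} (hτ : 0 < τ) :
    HasDerivAt (fun t => -(flowL k t ^ 2 / flowR k t *
        (√(1 - flowR k t ^ 2 * w t ^ 2) * w t - 1 / flowL k t) * (q t - 1)) - 90 / flowL k t ^ 5)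
      (flowL k τ ^ 2 / flowR k τ * (q τ * (√(1 - flowR k τ ^ 2 * w τ ^ 2) * w τ - 1 / flowL k τ) ^ 2
        + (1 - 2 * flowR k τ ^ 2 * w τ ^ 2) * ((1 - w τ ^ 2) / q τ) * (q τ - 1) ^ 2
        - (√(1 - flowR k τ ^ 2 * w τ ^ 2) * w τ - 1 / flowL k τ) * (q τ - 1) / flowL k τ
        - flowR k τ ^ 2 * w τ ^ 4 * (q τ - 1)) + 450 * flowR k τ ^ 2 / flowL k τ ^ 6) τ := by
  have hl := (flowL_pos F.pos hτ).ne'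
  refine ((F.hasDerivAt_muE hτ).fun_sub ((hasDerivAt_const τ (90 : ℝ)).fun_div
    ((hasDerivAt_flowL F.pos τ).fun_pow 5) (pow_ne_zero 5 hl))).congr_deriv ?_
  have : (0 * flowL k τ ^ 5 - 90 * ((5 : ℕ) * flowL k τ ^ (5 - 1) * flowR k τ ^ 2)) / (flowL k τ ^ 5) ^ 2 =
      -(450 * flowR k τ ^ 2 / flowL k τ ^ 6) := by
    simp only [Nat.cast_ofNat, Nat.reduceSub]
    field_simp
    ring
  rw [this, sub_neg_eq_add]

theorem half_mul_le_deriv_Phi (F : IsDysonFlow k q w L Linf) {τ : ℝ} (hτ : 0 < τ) (hl : 256 ≤ flowL k τ)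
    (hw : w τ < 1 / 256) (hz : |(1 - w τ ^ 2) / q τ - 1| ≤ 1 / 256) :
    1 / 2 * (flowL k τ ^ 2 / flowR k τ) * ((√(1 - flowR k τ ^ 2 * w τ ^ 2) * w τ - 1 / flowL k τ) ^ 2 + (q τ - 1) ^ 2)
      ≤ flowL k τ ^ 2 / flowR k τ * (q τ * (√(1 - flowR k τ ^ 2 * w τ ^ 2) * w τ - 1 / flowL k τ) ^ 2
        + (1 - 2 * flowR k τ ^ 2 * w τ ^ 2) * ((1 - w τ ^ 2) / q τ) * (q τ - 1) ^ 2
        - (√(1 - flowR k τ ^ 2 * w τ ^ 2) * w τ - 1 / flowL k τ) * (q τ - 1) / flowL k τ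
        - flowR k τ ^ 2 * w τ ^ 4 * (q τ - 1)) + 450 * flowR k τ ^ 2 / flowL k τ ^ 6 := by
  obtain ⟨h1, h2, h3, h4, h5, h6⟩ := F.near_facts hτ hl hw hz
  have hlp := flowL_pos F.pos hτ
  have hr := flowR_pos k τ
  have hr1 := flowR_le_one k τ
  have hu := one_div_le_one_div_of_le (by norm_num) hl
  have key := sq_add_sq_le (one_div_pos.2 hlp) hu hr.le hr1 h5 h2 h1 (by ring) h3 h4
  have hμ : 0 < flowL k τ ^ 2 / flowR k τ := by positivity
  have key2 := mul_le_mul_of_nonneg_left key hμ.le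
  have e1 : flowL k τ ^ 2 / flowR k τ * (450 * flowR k τ ^ 4 * (1 / flowL k τ) ^ 8) =
      450 * flowR k τ ^ 3 / flowL k τ ^ 6 := by field_simp
  have e2 : 450 * flowR k τ ^ 3 / flowL k τ ^ 6 ≤ 450 * flowR k τ ^ 2 / flowL k τ ^ 6 := by
    refine div_le_div_of_nonneg_right ?_ (by positivity)
    have := mul_le_mul_of_nonneg_left hr1 (sq_nonneg (flowR k τ))
    nlinarith
  rw [mul_add (flowL k τ ^ 2 / flowR k τ) _ (450 * flowR k τ ^ 4 * (1 / flowL k τ) ^ 8), e1, mul_one_div] at key2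
  linarith

/-- Derivative bound for the comparison function. -/
theorem abs_deriv_L_le (F : IsDysonFlow k q w L Linf) {τ l₁ : ℝ} (hτ : 0 < τ) (hl : 256 ≤ flowL k τ)
    (hl₁ : 256 ≤ l₁) (hll : l₁ ≤ flowL k τ)
    (hw : w τ < 1 / 256) (hz : |(1 - w τ ^ 2) / q τ - 1| ≤ 1 / 256) {P : ℝ}
    (hP : 1 / 2 * (flowL k τ ^ 2 / flowR k τ) *
      ((√(1 - flowR k τ ^ 2 * w τ ^ 2) * w τ - 1 / flowL k τ) ^ 2 + (q τ - 1) ^ 2) ≤ P) :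
    |-(flowL k τ / 4) * (w τ ^ 2 / q τ ^ 2 - 1 / flowL k τ ^ 2
      - (q τ - 1) ^ 2 / q τ ^ 2 - 2 * (q τ - 1) / (k * q τ))
      - 1 / 2 * (q τ / flowL k τ - √(1 - flowR k τ ^ 2 * w τ ^ 2) * w τ)| ≤
    21 / l₁ * P + 8 * flowR k τ ^ 2 / flowL k τ ^ 3 + l₁ / (2 * k) * (flowR k τ / k) := by
  obtain ⟨h1, h2, h3, h4, h5, h6⟩ := F.near_facts hτ hl hw hz
  have hr := flowR_pos k τ
  have hr1 := flowR_le_one k τ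
  have hk := F.pos
  have hlp := flowL_pos F.pos hτ
  have h := abs_L_le (l₁ := l₁) hl (by linarith) F.pos hr hr1 h2 h1 (by ring) h6 h5
  have e1 : (q τ - 1) / flowL k τ - (√(1 - flowR k τ ^ 2 * w τ ^ 2) * w τ - 1 / flowL k τ) =
    q τ / flowL k τ - √(1 - flowR k τ ^ 2 * w τ ^ 2) * w τ := by ring
  rw [e1] at h
  refine h.trans ?_
  set g := √(1 - flowR k τ ^ 2 * w τ ^ 2) * w τ - 1 / flowL k τ
  set δ := q τ - 1
  set l := flowL k τ
  set r := flowR k τ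
  have e2 : 1 / 2 * l₁ * r / k ^ 2 = l₁ / (2 * k) * (r / k) := by field_simp
  rw [e2]
  have hS : 0 ≤ g ^ 2 + δ ^ 2 := add_nonneg (sq_nonneg _) (sq_nonneg _)
  have e3 : 10 * l * (g ^ 2 + δ ^ 2) ≤ 20 / l₁ * (1 / 2 * (l ^ 2 / r) * (g ^ 2 + δ ^ 2)) := by
    have : 10 * l ≤ 20 / l₁ * (1 / 2 * (l ^ 2 / r)) := by
      have : 20 / l₁ * (1 / 2 * (l ^ 2 / r)) = 10 * l * (l / (l₁ * r)) := by field_simp; norm_num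
      rw [this]
      refine le_mul_of_one_le_right (by positivity) ?_
      rw [one_le_div (by positivity)]
      nlinarith
    have := mul_le_mul_of_nonneg_right this hS
    linarith
  have e4 : 1 / 2 * (l ^ 2 / r) * δ ^ 2 / l₁ ≤ 1 / l₁ * (1 / 2 * (l ^ 2 / r) * (g ^ 2 + δ ^ 2)) := by
    have : 1 / l₁ * (1 / 2 * (l ^ 2 / r) * (g ^ 2 + δ ^ 2)) - 1 / 2 * (l ^ 2 / r) * δ ^ 2 / l₁ =
      1 / l₁ * (1 / 2 * (l ^ 2 / r) * g ^ 2) := by ring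
    have h0 : 0 ≤ 1 / l₁ * (1 / 2 * (l ^ 2 / r) * g ^ 2) := by positivity
    linarith
  have e5 : 21 / l₁ * (1 / 2 * (l ^ 2 / r) * (g ^ 2 + δ ^ 2)) ≤ 21 / l₁ * P :=
    mul_le_mul_of_nonneg_left hP (by positivity)
  have e6 : 21 / l₁ * (1 / 2 * (l ^ 2 / r) * (g ^ 2 + δ ^ 2)) = 20 / l₁ * (1 / 2 * (l ^ 2 / r) * (g ^ 2 + δ ^ 2))
    + 1 / l₁ * (1 / 2 * (l ^ 2 / r) * (g ^ 2 + δ ^ 2)) := by ring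
  linarith

theorem exists_flowL_eq {k K : ℝ} (hk : 0 < k) (hK : 0 < K) (hKk : K < k) : ∃ τ, 0 < τ ∧ flowL k τ = K := by
  obtain ⟨b, hb⟩ := ((tendsto_flowL hk).eventually (lt_mem_nhds hKk)).exists_forall_of_atTop
  have hb' := hb (max b 0) (le_max_left _ _)
  have hcont : ContinuousOn (flowL k) (Set.Icc 0 (max b 0)) := fun t _ =>
    (hasDerivAt_flowL hk t).continuousAt.continuousWithinAt
  obtain ⟨τ, hτ, hτK⟩ := intermediate_value_Icc (le_max_right b 0) hcont ⟨by rw [flowL_zero]; exact hK.le, hb'.le⟩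
  refine ⟨τ, lt_of_le_of_ne hτ.1 fun h => ?_, hτK⟩
  rw [← h, flowL_zero] at hτK
  exact hK.ne hτK

/-- Quantitative comparison of `L` with its limit. -/
theorem abs_L_sub_le (F : IsDysonFlow k q w L Linf) {K₀ τ₁ : ℝ} (hK₀ : 256 ≤ K₀) (hk : 2 * K₀ ≤ k)
    (hnear : ∀ τ, 0 < τ → K₀ ≤ flowL k τ → w τ < 1 / 256 ∧ |(1 - w τ ^ 2) / q τ - 1| ≤ 1 / 256)
    (hτ₁ : 0 < τ₁) (hl : K₀ ≤ flowL k τ₁) :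
    |L τ₁ - 1 / 2 * (q τ₁ - 1) - Linf| ≤
      21 / flowL k τ₁ * (2 * K₀ ^ 2 + 1) + 4 / flowL k τ₁ ^ 2 + flowL k τ₁ / (2 * k) * (Real.pi / 2) := by
  have hk0 := F.pos
  set l₁ := flowL k τ₁ with hl₁
  set Φ := fun t => -(flowL k t ^ 2 / flowR k t *
        (√(1 - flowR k t ^ 2 * w t ^ 2) * w t - 1 / flowL k t) * (q t - 1)) - 90 / flowL k t ^ 5 with hΦ
  set Φ' := fun τ => flowL k τ ^ 2 / flowR k τ * (q τ * (√(1 - flowR k τ ^ 2 * w τ ^ 2) * w τ - 1 / flowL k τ) ^ 2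
        + (1 - 2 * flowR k τ ^ 2 * w τ ^ 2) * ((1 - w τ ^ 2) / q τ) * (q τ - 1) ^ 2
        - (√(1 - flowR k τ ^ 2 * w τ ^ 2) * w τ - 1 / flowL k τ) * (q τ - 1) / flowL k τ
        - flowR k τ ^ 2 * w τ ^ 4 * (q τ - 1)) + 450 * flowR k τ ^ 2 / flowL k τ ^ 6 with hΦ'
  have hdΦ : ∀ t, 0 < t → HasDerivAt Φ (Φ' t) t := fun t ht => F.hasDerivAt_Phi ht
  have hΦge : ∀ t, 0 < t → K₀ ≤ flowL k t → 1 / 2 * (flowL k t ^ 2 / flowR k t) *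
      ((√(1 - flowR k t ^ 2 * w t ^ 2) * w t - 1 / flowL k t) ^ 2 + (q t - 1) ^ 2) ≤ Φ' t := fun t ht htl =>
    F.half_mul_le_deriv_Phi ht (hK₀.trans htl) (hnear t ht htl).1 (hnear t ht htl).2
  obtain ⟨τ₀, hτ₀, hτ₀K⟩ := exists_flowL_eq hk0 (by linarith : 0 < K₀) (by linarith)
  have hmono : (flowL k) τ₀ ≤ flowL k τ₁ := by rw [hτ₀K]; exact hl
  have hτ01 : τ₀ ≤ τ₁ := (flowL_strictMono hk0).le_iff_le.1 hmono
  have hge : ∀ t, τ₀ ≤ t → K₀ ≤ flowL k t := fun t ht => by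
    rw [← hτ₀K]; exact (flowL_strictMono hk0).monotone ht
  have hΦmono : ∀ a b, τ₀ ≤ a → a ≤ b → Φ a ≤ Φ b := fun a b ha hab => by
    have := HasDerivAt.mul_sub_le_sub (f := Φ) (m := 0) hab (fun t ht => hdΦ t (hτ₀.trans_le (ha.trans ht.1)))
      fun t ht => by
        refine le_trans ?_ (hΦge t (hτ₀.trans_le (ha.trans ht.1)) (hge t (ha.trans ht.1)))
        have := flowR_pos k t
        positivity
    linarith
  have hΦlim : Tendsto Φ atTop (nhds (-0 - 90 / k ^ 5)) :=
    F.tendsto_mu.neg.sub (tendsto_const_nhds.div ((tendsto_flowL hk0).pow 5) (pow_pos hk0 5).ne')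
  have hΦle : ∀ t, τ₀ ≤ t → Φ t ≤ 0 := fun t ht => by
    have h1 : Φ t ≤ -0 - 90 / k ^ 5 := ge_of_tendsto hΦlim (by
      filter_upwards [eventually_ge_atTop t] with s hs using hΦmono t s ht hs)
    have : 0 ≤ 90 / k ^ 5 := by positivity
    linarith
  have hΦ₀ : -(2 * K₀ ^ 2 + 1) ≤ Φ τ₀ := by
    obtain ⟨h1, h2, -⟩ := F.near_facts hτ₀ (by rw [hτ₀K]; exact hK₀) (hnear τ₀ hτ₀ hτ₀K.ge).1 (hnear τ₀ hτ₀ hτ₀K.ge).2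
    simp only [hΦ]
    rw [hτ₀K] at h2 ⊢
    have hr := flowR_pos k τ₀
    have hr2 : 1 / 2 ≤ flowR k τ₀ := by
      have h3 := flowL_sq hk0 τ₀
      rw [hτ₀K] at h3
      by_contra! hcon
      have h4 : flowR k τ₀ ^ 2 < 1 / 4 := by nlinarith
      have h5 : 3 / 4 * k ^ 2 ≤ K₀ ^ 2 := by
        rw [h3]
        have := mul_le_mul_of_nonneg_left h4.le (sq_nonneg k)
        linarith
      nlinarith
    set g := √(1 - flowR k τ₀ ^ 2 * w τ₀ ^ 2) * w τ₀ - 1 / K₀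
    have h3 : K₀ ^ 2 / flowR k τ₀ * g * (q τ₀ - 1) ≤ 2 * K₀ ^ 2 := by
      have h4 : g * (q τ₀ - 1) ≤ 1 := by
        have := abs_mul g (q τ₀ - 1)
        have := le_abs_self (g * (q τ₀ - 1))
        nlinarith [abs_nonneg g, abs_nonneg (q τ₀ - 1)]
      have h5 : K₀ ^ 2 / flowR k τ₀ ≤ 2 * K₀ ^ 2 := by
        rw [div_le_iff₀ hr]
        nlinarith [sq_nonneg K₀]
      have h6 : K₀ ^ 2 / flowR k τ₀ * (g * (q τ₀ - 1)) ≤ K₀ ^ 2 / flowR k τ₀ * 1 :=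
        mul_le_mul_of_nonneg_left h4 (by positivity)
      linarith
    have h7 : 90 / K₀ ^ 5 ≤ 1 := by
      rw [div_le_one (by positivity)]
      have : (256 : ℝ) ^ 5 ≤ K₀ ^ 5 := pow_le_pow_left₀ (by norm_num) hK₀ 5
      norm_num at this
      linarith
    linarith
  set W := fun t => 21 / l₁ * Φ t - 4 / flowL k t ^ 2 + l₁ / (2 * k) * Real.arctan (Real.sinh (t / k)) with hW
  have hl₁0 : 0 < l₁ := by linarith
  have hdW : ∀ t, 0 < t → HasDerivAt W
      (21 / l₁ * Φ' t + 8 * flowR k t ^ 2 / flowL k t ^ 3 + l₁ / (2 * k) * (flowR k t / k)) t := by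
    intro t ht
    have hlt := (flowL_pos hk0 ht).ne'
    refine ((((hdΦ t ht).const_mul (21 / l₁)).fun_sub ((hasDerivAt_const t (4 : ℝ)).fun_div
      ((hasDerivAt_flowL hk0 t).fun_pow 2) (pow_ne_zero 2 hlt))).fun_add
      ((hasDerivAt_arctan_sinh hk0 t).const_mul (l₁ / (2 * k)))).congr_deriv ?_
    have : (0 * flowL k t ^ 2 - 4 * ((2 : ℕ) * flowL k t ^ (2 - 1) * flowR k t ^ 2)) / (flowL k t ^ 2) ^ 2 =
        -(8 * flowR k t ^ 2 / flowL k t ^ 3) := by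
      simp only [Nat.cast_ofNat, Nat.add_one_sub_one, pow_one]
      field_simp
      ring
    rw [this, sub_neg_eq_add]
  have hdL : ∀ t, 0 < t → HasDerivAt (fun t => L t - 1 / 2 * (q t - 1)) _ t := fun t ht =>
    (F.hasDerivAt_L t ht).fun_sub (((F.hasDerivAt_q t ht).sub_const 1).const_mul (1 / 2))
  have hbound := fun t (ht : τ₁ ≤ t) => by
    have ht0 : 0 < t := hτ₁.trans_le ht
    have hl₁t : l₁ ≤ flowL k t := (flowL_strictMono hk0).monotone ht
    have hK := hge t (hτ01.trans ht)
    exact abs_le.1 (F.abs_deriv_L_le (l₁ := l₁) ht0 (hK₀.trans hK) (hK₀.trans hl) hl₁t (hnear t ht0 hK).1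
      (hnear t ht0 hK).2 (hΦge t ht0 hK))
  have hW1 : -(21 / l₁ * (2 * K₀ ^ 2 + 1)) - 4 / l₁ ^ 2 ≤ W τ₁ := by
    have h1 : 21 / l₁ * -(2 * K₀ ^ 2 + 1) ≤ 21 / l₁ * Φ τ₁ :=
      mul_le_mul_of_nonneg_left (hΦ₀.trans (hΦmono _ _ le_rfl hτ01)) (by positivity)
    have h2 : 0 ≤ l₁ / (2 * k) * Real.arctan (Real.sinh (τ₁ / k)) :=
      mul_nonneg (by positivity) (Real.arctan_nonneg.2 (Real.sinh_nonneg_iff.2 (by positivity)))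
    simp only [hW]
    rw [← hl₁]
    linarith
  have hW2 : ∀ t, τ₁ ≤ t → W t ≤ l₁ / (2 * k) * (Real.pi / 2) := by
    intro t ht
    have h1 : 21 / l₁ * Φ t ≤ 0 := mul_nonpos_of_nonneg_of_nonpos (by positivity) (hΦle t (hτ01.trans ht))
    have h2 : l₁ / (2 * k) * Real.arctan (Real.sinh (t / k)) ≤ l₁ / (2 * k) * (Real.pi / 2) :=
      mul_le_mul_of_nonneg_left (Real.arctan_lt_pi_div_two _).le (by positivity)
    have h3 : 0 ≤ 4 / flowL k t ^ 2 := by positivity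
    simp only [hW]
    linarith
  have hcmp : ∀ t, τ₁ ≤ t → |L τ₁ - 1 / 2 * (q τ₁ - 1) - (L t - 1 / 2 * (q t - 1))| ≤
      21 / l₁ * (2 * K₀ ^ 2 + 1) + 4 / l₁ ^ 2 + l₁ / (2 * k) * (Real.pi / 2) := by
    intro t ht
    have h1 := HasDerivAt.mul_sub_le_sub (f := fun t => W t - (L t - 1 / 2 * (q t - 1))) (m := 0) ht
      (fun s hs => (hdW s (hτ₁.trans_le hs.1)).fun_sub (hdL s (hτ₁.trans_le hs.1)))
      fun s hs => by linarith [(hbound s hs.1).2]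
    have h2 := HasDerivAt.mul_sub_le_sub (f := fun t => W t + (L t - 1 / 2 * (q t - 1))) (m := 0) ht
      (fun s hs => (hdW s (hτ₁.trans_le hs.1)).fun_add (hdL s (hτ₁.trans_le hs.1)))
      fun s hs => by linarith [(hbound s hs.1).1]
    have h3 := hW2 t ht
    rw [abs_le]
    constructor <;> linarith
  have hlim : Tendsto (fun t => |L τ₁ - 1 / 2 * (q τ₁ - 1) - (L t - 1 / 2 * (q t - 1))|) atTop
      (nhds |L τ₁ - 1 / 2 * (q τ₁ - 1) - (Linf - 1 / 2 * (1 - 1))|) :=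
    ((F.tendsto_L.sub ((F.tendsto_q.sub_const 1).const_mul (1 / 2))).const_sub _).abs
  rw [sub_self, mul_zero, sub_zero] at hlim
  refine le_of_tendsto hlim ?_
  filter_upwards [eventually_ge_atTop τ₁] with t ht using hcmp t ht

/-- Uniform convergence of `L` to its limit along Dyson flows. -/
theorem uniform_limit (ε : ℝ) (hε : 0 < ε) : ∃ K > 0, ∀ K', ∃ k₀, ∀ (k Linf : ℝ) (q w L : ℝ → ℝ),
    IsDysonFlow k q w L Linf → k₀ ≤ k → ∀ τ, 0 < τ → K ≤ flowL k τ → flowL k τ ≤ K' → |L τ - Linf| ≤ ε := by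
  obtain ⟨K₁, hK₁, k₁, hk₁, h₁⟩ := exists_near_equilibrium (1 / 256) (by norm_num) (by norm_num)
  obtain ⟨K₂, hK₂, k₂, hk₂, h₂⟩ := exists_near_equilibrium (min (ε / 4) (1 / 4)) (by positivity)
    ((min_le_right _ _).trans (by norm_num))
  set K₀ := max K₁ 256 with hK₀
  have hK₀p : 0 < K₀ := lt_max_of_lt_right (by norm_num)
  refine ⟨max (max K₀ K₂) (max (21 * (2 * K₀ ^ 2 + 1) * (4 / ε)) (16 / ε + 1)), by positivity, fun K' => ?_⟩
  refine ⟨max (max (2 * K₀) (max k₁ k₂)) (K' * Real.pi / ε), fun k Linf q w L F hk τ hτ hl hl' => ?_⟩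
  simp only [max_le_iff] at hl hk
  obtain ⟨⟨hlK₀, hlK₂⟩, hl3, hl4⟩ := hl
  obtain ⟨⟨hk0, hk1, hk2⟩, hk3⟩ := hk
  have hkp := F.pos
  have hlp := flowL_pos hkp hτ
  have main := F.abs_L_sub_le (le_max_right K₁ 256) hk0
    (fun t ht htl => (h₁ k Linf q w L F hk1 t ht ((le_max_left _ _).trans htl)).2) hτ hlK₀
  obtain ⟨a1, a2, a3⟩ := h₂ k Linf q w L F hk2 τ hτ hlK₂
  have hδ := abs_q_sub_one_le (F.q_pos τ hτ) (min_le_right _ _) a1 a2 a3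
  have hδ2 : |1 / 2 * (q τ - 1)| ≤ ε / 4 := by
    rw [abs_mul, abs_of_pos (by norm_num : (0:ℝ) < 1 / 2)]
    have := min_le_left (ε / 4) (1 / 4)
    linarith
  have b1 : 21 / flowL k τ * (2 * K₀ ^ 2 + 1) ≤ ε / 4 := by
    rw [div_mul_eq_mul_div, div_le_iff₀ hlp]
    have : ε / 4 * (21 * (2 * K₀ ^ 2 + 1) * (4 / ε)) = 21 * (2 * K₀ ^ 2 + 1) := by field_simp
    rw [← this]
    exact mul_le_mul_of_nonneg_left hl3 (by positivity)
  have b2 : 4 / flowL k τ ^ 2 ≤ ε / 4 := by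
    rw [div_le_iff₀ (by positivity)]
    have h1 : 16 / ε ≤ flowL k τ := by linarith
    have h2 : (0 : ℝ) < 16 / ε := by positivity
    have h3 : 1 ≤ flowL k τ := by linarith
    rw [div_le_iff₀ hε] at h1
    nlinarith
  have b3 : flowL k τ / (2 * k) * (Real.pi / 2) ≤ ε / 4 := by
    have hpi := Real.pi_pos
    rw [div_le_iff₀ hε] at hk3
    rw [div_mul_div_comm, div_le_div_iff₀ (by positivity) (by norm_num)]
    nlinarith
  have : L τ - Linf = (L τ - 1 / 2 * (q τ - 1) - Linf) + 1 / 2 * (q τ - 1) := by ring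
  rw [this]
  refine (abs_add_le _ _).trans ?_
  linarith

end IsDysonFlow

/-- Cosine of the shifted phase of the boundary vector `(arcP, arcS)`. -/
noncomputable def arcCos (N : ℕ) (θ : ℝ) : ℝ :=
  ((arcP N θ ^ 2 - arcS N θ ^ 2) * Real.cos (θ / 2) + 2 * arcP N θ * arcS N θ * Real.sin (θ / 2))
    / (arcP N θ ^ 2 + arcS N θ ^ 2)

/-- Sine of the shifted phase of the boundary vector `(arcP, arcS)`. -/
noncomputable def arcSin (N : ℕ) (θ : ℝ) : ℝ :=
  ((arcP N θ ^ 2 - arcS N θ ^ 2) * Real.sin (θ / 2) - 2 * arcP N θ * arcS N θ * Real.cos (θ / 2))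
    / (arcP N θ ^ 2 + arcS N θ ^ 2)

/-- The logarithmic derivative of `arcX`. -/
noncomputable def arcV (N : ℕ) (θ : ℝ) : ℝ := (arcP N θ ^ 2 + arcS N θ ^ 2) / (Real.pi * arcX N θ)

theorem arcV_pos (N : ℕ) {θ : ℝ} (h0 : 0 ≤ θ) (hθ : θ < Real.pi) : 0 < arcV N θ :=
  div_pos (arcP_sq_add_arcS_sq_pos N h0 hθ) (mul_pos Real.pi_pos (arcX_pos N h0 hθ))

theorem arcCos_sq_add_arcSin_sq (N : ℕ) {θ : ℝ} (h0 : 0 ≤ θ) (hθ : θ < Real.pi) :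
    arcCos N θ ^ 2 + arcSin N θ ^ 2 = 1 := by
  have h := (arcP_sq_add_arcS_sq_pos N h0 hθ).ne'
  have h1 := Real.sin_sq_add_cos_sq (θ / 2)
  simp only [arcCos, arcSin]
  field_simp
  linear_combination (arcP N θ ^ 2 + arcS N θ ^ 2) ^ 2 * h1

theorem sin_eq_half (θ : ℝ) : Real.sin θ = 2 * Real.sin (θ / 2) * Real.cos (θ / 2) := by
  rw [← Real.sin_two_mul]; ring_nf

theorem cos_eq_half (θ : ℝ) : Real.cos θ = 2 * Real.cos (θ / 2) ^ 2 - 1 := by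
  rw [← Real.cos_two_mul]; ring_nf

theorem cos_half_pos {θ : ℝ} (h0 : 0 ≤ θ) (hθ : θ < Real.pi) : 0 < Real.cos (θ / 2) :=
  Real.cos_pos_of_mem_Ioo ⟨by linarith, by linarith⟩

/-- `arcβ` in terms of the phase. -/
theorem arcβ_mul_sin (N : ℕ) {θ : ℝ} (h0 : 0 < θ) (hθ : θ < Real.pi) :
    arcβ N θ * Real.sin θ = arcV N θ * (arcCos N θ * Real.sin (θ / 2) + arcSin N θ * Real.cos (θ / 2)) := by
  have hs := (Real.sin_pos_of_pos_of_lt_pi h0 hθ).ne'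
  have h := (arcP_sq_add_arcS_sq_pos N h0.le hθ).ne'
  have hX := (arcX_pos N h0.le hθ).ne'
  have hpi := Real.pi_pos.ne'
  have h1 := Real.sin_sq_add_cos_sq (θ / 2)
  rw [arcβ_eq N h0 hθ, arcV, arcCos, arcSin]
  field_simp
  rw [sin_eq_half θ, cos_eq_half θ]
  linear_combination (-2 * arcP N θ * arcS N θ) * h1

theorem arcPS_eq (N : ℕ) {θ : ℝ} (h0 : 0 ≤ θ) (hθ : θ < Real.pi) :
    -(2 * arcP N θ * arcS N θ) =
      (arcP N θ ^ 2 + arcS N θ ^ 2) * (arcSin N θ * Real.cos (θ / 2) - arcCos N θ * Real.sin (θ / 2)) := by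
  have h := (arcP_sq_add_arcS_sq_pos N h0 hθ).ne'
  have h1 := Real.sin_sq_add_cos_sq (θ / 2)
  rw [arcCos, arcSin]
  field_simp
  linear_combination (2 * arcP N θ * arcS N θ) * h1

theorem arcA_eq (N : ℕ) {θ : ℝ} (h0 : 0 ≤ θ) (hθ : θ < Real.pi) :
    arcP N θ ^ 2 - arcS N θ ^ 2 =
      (arcP N θ ^ 2 + arcS N θ ^ 2) * (arcCos N θ * Real.cos (θ / 2) + arcSin N θ * Real.sin (θ / 2)) := by
  have h := (arcP_sq_add_arcS_sq_pos N h0 hθ).ne'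
  have h1 := Real.sin_sq_add_cos_sq (θ / 2)
  rw [arcCos, arcSin]
  field_simp
  linear_combination (-(arcP N θ ^ 2 - arcS N θ ^ 2)) * h1

theorem arc_phase_bounds (N : ℕ) (hN : 0 < N) {θ : ℝ} (h0 : 0 < θ) (hθ : θ < Real.pi) :
    0 < arcSin N θ ∧ arcCos N θ ^ 2 < Real.cos (θ / 2) ^ 2 := by
  have hs := Real.sin_pos_of_pos_of_lt_pi h0 hθ
  have hV := arcV_pos N h0.le hθ
  have hβ := mul_pos (arcβ_pos N h0 hθ) hs
  rw [arcβ_mul_sin N h0 hθ, mul_pos_iff_of_pos_left hV] at hβ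
  have hPS : 0 < -(2 * arcP N θ * arcS N θ) := by
    nlinarith [mul_pos (arcP_pos N h0.le hθ) (neg_pos.2 (arcS_neg N hN h0 hθ))]
  rw [arcPS_eq N h0.le hθ, mul_pos_iff_of_pos_left (arcP_sq_add_arcS_sq_pos N h0.le hθ)] at hPS
  have hc := cos_half_pos h0.le hθ
  constructor
  · by_contra! h
    nlinarith
  · have h1 := mul_pos hβ hPS
    have h2 := arcCos_sq_add_arcSin_sq N h0.le hθ
    have h3 := Real.sin_sq_add_cos_sq (θ / 2)
    have : (arcCos N θ * Real.sin (θ / 2) + arcSin N θ * Real.cos (θ / 2)) *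
      (arcSin N θ * Real.cos (θ / 2) - arcCos N θ * Real.sin (θ / 2)) = Real.cos (θ / 2) ^ 2 - arcCos N θ ^ 2 := by
      linear_combination Real.cos (θ / 2) ^ 2 * h2 - arcCos N θ ^ 2 * h3
    linarith

theorem hasDerivAt_arcCos (N : ℕ) {θ : ℝ} (h0 : 0 < θ) (hθ : θ < Real.pi) :
    HasDerivAt (arcCos N) (arcSin N θ * (-((2 * N + 1) / 2) +
      2 * arcV N θ * (Real.cos (θ / 2) ^ 2 - arcCos N θ ^ 2) / Real.sin θ)) θ := by
  have hn := (arcP_sq_add_arcS_sq_pos N h0.le hθ).ne'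
  have hs := (Real.sin_pos_of_pos_of_lt_pi h0 hθ).ne'
  have hP := hasDerivAt_arcP N h0.le hθ
  have hS := hasDerivAt_arcS N h0.le hθ
  have hh : HasDerivAt (fun t : ℝ => t / 2) (1 / 2) θ := (hasDerivAt_id θ).div_const 2
  have hβ := arcβ_mul_sin N h0 hθ
  have e2 := arcCos_sq_add_arcSin_sq N h0.le hθ
  have e3 := Real.sin_sq_add_cos_sq (θ / 2)
  have eB := arcPS_eq N h0.le hθ
  have eA := arcA_eq N h0.le hθ
  have hβd : (arcCC N θ - arcSS N θ) / Real.pi = arcβ N θ := rfl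
  rw [hβd] at hP hS
  refine (((((hP.fun_pow 2).fun_sub (hS.fun_pow 2)).fun_mul hh.cos).fun_add
    (((hP.const_mul 2).fun_mul hS).fun_mul hh.sin)).fun_div ((hP.fun_pow 2).fun_add (hS.fun_pow 2)) hn).congr_deriv ?_
  simp only [Nat.cast_ofNat, Nat.add_one_sub_one, pow_one]
  have hβ2 : arcβ N θ = arcV N θ * (arcCos N θ * Real.sin (θ / 2) + arcSin N θ * Real.cos (θ / 2)) / Real.sin θ := by
    rw [← hβ]; field_simp
  set V := arcV N θ
  set s := arcCos N θ
  set C := arcSin N θ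
  set P := arcP N θ
  set S := arcS N θ
  set b := arcβ N θ
  set c := Real.cos (θ / 2)
  set d := Real.sin (θ / 2)
  set n := P ^ 2 + S ^ 2 with hnd
  have es : (P ^ 2 - S ^ 2) * c + 2 * P * S * d = n * s := by
    linear_combination c * eA - d * eB + n * s * e3
  have eC : (P ^ 2 - S ^ 2) * d - 2 * P * S * c = n * C := by
    linear_combination d * eA + c * eB + n * C * e3
  rw [es]
  have eq1 : C * (-((2 * N + 1) / 2) + 2 * V * (c ^ 2 - s ^ 2) / Real.sin θ) =
      C * (-((2 * N + 1) / 2)) + 2 * b * C * (C * c - s * d) := by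
    rw [hβ2]
    field_simp
    linear_combination (-4 * C * V * c ^ 2) * e2 + 4 * C * V * s ^ 2 * e3
  rw [eq1, div_eq_iff (pow_ne_zero 2 hn)]
  clear_value n
  subst hnd
  linear_combination (-((N : ℝ) + 1 / 2)) * (P ^ 2 + S ^ 2) * eC - 2 * b * (P ^ 2 + S ^ 2) * s * eA
    - 2 * b * (P ^ 2 + S ^ 2) ^ 2 * c * e2

theorem hasDerivAt_arcV (N : ℕ) {θ : ℝ} (h0 : 0 < θ) (hθ : θ < Real.pi) :
    HasDerivAt (arcV N) (arcV N θ ^ 2 * (2 * arcCos N θ * arcSin N θ) / Real.sin θ) θ := by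
  have hs := (Real.sin_pos_of_pos_of_lt_pi h0 hθ).ne'
  have hX := (arcX_pos N h0.le hθ).ne'
  have hpi := Real.pi_pos.ne'
  have hn := (arcP_sq_add_arcS_sq_pos N h0.le hθ).ne'
  have hP := hasDerivAt_arcP N h0.le hθ
  have hS := hasDerivAt_arcS N h0.le hθ
  have hβ := arcβ_mul_sin N h0 hθ
  have e2 := arcCos_sq_add_arcSin_sq N h0.le hθ
  have e3 := Real.sin_sq_add_cos_sq (θ / 2)
  have eA := arcA_eq N h0.le hθ
  have hβd : (arcCC N θ - arcSS N θ) / Real.pi = arcβ N θ := rfl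
  have hsd := sin_eq_half θ
  rw [hβd] at hP hS
  refine (((hP.fun_pow 2).fun_add (hS.fun_pow 2)).fun_div ((hasDerivAt_arcX N h0.le hθ).const_mul Real.pi)
    (mul_ne_zero hpi hX)).congr_deriv ?_
  simp only [Nat.cast_ofNat, Nat.add_one_sub_one, pow_one]
  have key : arcV N θ ^ 2 * (2 * arcCos N θ * arcSin N θ) / Real.sin θ =
      arcV N θ * (2 * arcβ N θ * (arcCos N θ * Real.cos (θ / 2) + arcSin N θ * Real.sin (θ / 2)) - arcV N θ) := by
    rw [div_eq_iff hs]
    linear_combination (-2 * arcV N θ * (arcCos N θ * Real.cos (θ / 2) + arcSin N θ * Real.sin (θ / 2))) * hβ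
      + arcV N θ ^ 2 * hsd - 2 * arcV N θ ^ 2 * Real.sin (θ / 2) * Real.cos (θ / 2) * e2
      - 2 * arcV N θ ^ 2 * arcCos N θ * arcSin N θ * e3
  rw [key, arcV]
  field_simp
  linear_combination (2 * arcX N θ * arcβ N θ * Real.pi) * eA

theorem hasDerivAt_log_det_arcMatrix_succ (N : ℕ) {θ : ℝ} (h0 : 0 < θ) (hθ : θ < Real.pi) :
    HasDerivAt (fun t => Real.log (arcMatrix (N + 1) t).det)
      (-((N + 1) * arcV N θ) + arcV N θ ^ 2 * (Real.cos (θ / 2) ^ 2 - arcCos N θ ^ 2) / Real.sin θ) θ := by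
  have hs := (Real.sin_pos_of_pos_of_lt_pi h0 hθ).ne'
  have hX := (arcX_pos N h0.le hθ).ne'
  have hpi := Real.pi_pos.ne'
  have hβ := arcβ_mul_sin N h0 hθ
  have e2 := arcCos_sq_add_arcSin_sq N h0.le hθ
  have e3 := Real.sin_sq_add_cos_sq (θ / 2)
  have eB := arcPS_eq N h0.le hθ
  refine (hasDerivAt_log_det_arcMatrix (N + 1) h0.le hθ).congr_deriv ?_
  have h1 := arcCC_add_arcSS_eq N h0.le hθ
  rw [arcCC, arcSS] at h1
  rw [h1]
  have key : arcV N θ ^ 2 * (Real.cos (θ / 2) ^ 2 - arcCos N θ ^ 2) / Real.sin θ =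
      arcV N θ * arcβ N θ * (arcSin N θ * Real.cos (θ / 2) - arcCos N θ * Real.sin (θ / 2)) := by
    rw [div_eq_iff hs]
    linear_combination (-(arcV N θ * (arcSin N θ * Real.cos (θ / 2) - arcCos N θ * Real.sin (θ / 2)))) * hβ
      - arcV N θ ^ 2 * Real.cos (θ / 2) ^ 2 * e2 + arcV N θ ^ 2 * arcCos N θ ^ 2 * e3
  rw [key, arcV]
  field_simp
  linear_combination (arcβ N θ) * eB

/-- The angle as a function of the flow parameter. -/
noncomputable def flowθ (k τ : ℝ) : ℝ := 2 * Real.arctan (Real.sinh (τ / k))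

theorem flowθ_pos {k τ : ℝ} (hk : 0 < k) (hτ : 0 < τ) : 0 < flowθ k τ :=
  mul_pos two_pos (Real.arctan_pos.2 (Real.sinh_pos_iff.2 (div_pos hτ hk)))

theorem flowθ_lt_pi (k τ : ℝ) : flowθ k τ < Real.pi := by
  have := Real.arctan_lt_pi_div_two (Real.sinh (τ / k))
  rw [flowθ]; linarith

theorem hasDerivAt_flowθ {k : ℝ} (hk : 0 < k) (τ : ℝ) : HasDerivAt (flowθ k) (2 * (flowR k τ / k)) τ :=
  (hasDerivAt_arctan_sinh hk τ).const_mul 2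

theorem cos_flowθ_half (k τ : ℝ) : Real.cos (flowθ k τ / 2) = flowR k τ := by
  rw [flowθ, mul_div_cancel_left₀ _ two_ne_zero, Real.cos_arctan, flowR, add_comm, ← Real.cosh_sq,
    Real.sqrt_sq (Real.cosh_pos _).le]

theorem sin_flowθ_half {k : ℝ} (hk : 0 < k) (τ : ℝ) : Real.sin (flowθ k τ / 2) = flowL k τ / k := by
  rw [flowθ, mul_div_cancel_left₀ _ two_ne_zero, Real.sin_arctan, flowL, add_comm, ← Real.cosh_sq,
    Real.sqrt_sq (Real.cosh_pos _).le, mul_div_cancel_left₀ _ hk.ne']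

theorem sin_flowθ {k : ℝ} (hk : 0 < k) (τ : ℝ) : Real.sin (flowθ k τ) = 2 * (flowL k τ / k) * flowR k τ := by
  rw [sin_eq_half, cos_flowθ_half, sin_flowθ_half hk]

/-- Normalised reciprocal of `arcV`, as a function of the angle. -/
noncomputable def arcQ (N : ℕ) (θ : ℝ) : ℝ :=
  (2 * N + 1) * Real.sin (θ / 2) / (2 * Real.cos (θ / 2)) / arcV N θ

/-- Normalised `arcCos` along the flow. -/
noncomputable def flowW (N : ℕ) (τ : ℝ) : ℝ := arcCos N (flowθ (2 * N + 1) τ) / flowR (2 * N + 1) τ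

/-- Normalised log-determinant along the flow. -/
noncomputable def flowLog (N : ℕ) (τ : ℝ) : ℝ :=
  Real.log (arcMatrix (N + 1) (flowθ (2 * N + 1) τ)).det - (N + 1) ^ 2 * Real.log (flowR (2 * N + 1) τ)
    + 1 / 4 * Real.log (flowL (2 * N + 1) τ / (2 * N + 1))

theorem two_mul_add_one_pos (N : ℕ) : (0 : ℝ) < 2 * N + 1 := by positivity

theorem arcQ_flowθ (N : ℕ) (τ : ℝ) : arcQ N (flowθ (2 * N + 1) τ) =
    flowL (2 * N + 1) τ / (2 * flowR (2 * N + 1) τ) / arcV N (flowθ (2 * N + 1) τ) := by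
  rw [arcQ, cos_flowθ_half, sin_flowθ_half (two_mul_add_one_pos N),
    mul_div_cancel₀ _ (two_mul_add_one_pos N).ne']

theorem flowW_sq_lt (N : ℕ) (hN : 0 < N) {τ : ℝ} (hτ : 0 < τ) : flowW N τ ^ 2 < 1 := by
  have hk := two_mul_add_one_pos N
  have h := (arc_phase_bounds N hN (flowθ_pos hk hτ) (flowθ_lt_pi _ τ)).2
  rw [cos_flowθ_half] at h
  rw [flowW, div_pow, div_lt_one (pow_pos (flowR_pos _ _) 2)]
  exact h

theorem sqrt_flowW (N : ℕ) (hN : 0 < N) {τ : ℝ} (hτ : 0 < τ) :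
    √(1 - flowR (2 * N + 1) τ ^ 2 * flowW N τ ^ 2) = arcSin N (flowθ (2 * N + 1) τ) := by
  have hk := two_mul_add_one_pos N
  have h := (arc_phase_bounds N hN (flowθ_pos hk hτ) (flowθ_lt_pi _ τ)).1
  have h2 := arcCos_sq_add_arcSin_sq N (flowθ_pos hk hτ).le (flowθ_lt_pi _ τ)
  rw [← mul_pow, flowW, mul_div_cancel₀ _ (flowR_pos _ _).ne', ← Real.sqrt_sq h.le]
  congr 1
  linarith

theorem arcQ_pos (N : ℕ) {θ : ℝ} (h0 : 0 < θ) (hθ : θ < Real.pi) : 0 < arcQ N θ := by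
  have := cos_half_pos h0.le hθ
  have h2 : 0 < Real.sin (θ / 2) := Real.sin_pos_of_pos_of_lt_pi (by linarith) (by linarith)
  have h3 := arcV_pos N h0.le hθ
  have h4 := two_mul_add_one_pos N
  rw [arcQ]; positivity

theorem hasDerivAt_flowQ (N : ℕ) (hN : 0 < N) {τ : ℝ} (hτ : 0 < τ) :
    HasDerivAt (fun t => arcQ N (flowθ (2 * N + 1) t)) (arcQ N (flowθ (2 * N + 1) τ) / flowL (2 * N + 1) τ
      - √(1 - flowR (2 * N + 1) τ ^ 2 * flowW N τ ^ 2) * flowW N τ) τ := by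
  have hk := two_mul_add_one_pos N
  rw [sqrt_flowW N hN hτ]
  simp only [arcQ_flowθ, flowW]
  generalize hkk : (2 * (N : ℝ) + 1) = k at *
  have h0 := flowθ_pos hk hτ
  have h1 := flowθ_lt_pi k τ
  have hr := (flowR_pos k τ).ne'
  have hl := (flowL_pos hk hτ).ne'
  have hV := (arcV_pos N h0.le h1).ne'
  refine (((hasDerivAt_flowL hk τ).fun_div ((hasDerivAt_flowR hk τ).const_mul 2)
    (mul_ne_zero two_ne_zero hr)).fun_div ((hasDerivAt_arcV N h0 h1).comp τ (hasDerivAt_flowθ hk τ)) hV).congr_deriv ?_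
  rw [sin_flowθ hk]
  simp only [Function.comp]
  field_simp
  linear_combination flowL_sq hk τ

theorem hasDerivAt_flowW (N : ℕ) (hN : 0 < N) {τ : ℝ} (hτ : 0 < τ) :
    HasDerivAt (flowW N) (-(√(1 - flowR (2 * N + 1) τ ^ 2 * flowW N τ ^ 2)
      * (arcQ N (flowθ (2 * N + 1) τ) - 1 + flowW N τ ^ 2) / arcQ N (flowθ (2 * N + 1) τ))
      + flowL (2 * N + 1) τ / (2 * N + 1) ^ 2 * flowW N τ) τ := by
  have hk := two_mul_add_one_pos N
  rw [sqrt_flowW N hN hτ]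
  have h0 := flowθ_pos hk hτ
  have h1 := flowθ_lt_pi (2 * N + 1) τ
  have hr := (flowR_pos (2 * N + 1) τ).ne'
  have hl := (flowL_pos hk hτ).ne'
  have hV := (arcV_pos N h0.le h1).ne'
  refine (((hasDerivAt_arcCos N h0 h1).comp τ (hasDerivAt_flowθ hk τ)).fun_div (hasDerivAt_flowR hk τ) hr).congr_deriv ?_
  rw [sin_flowθ hk, cos_flowθ_half, arcQ_flowθ, flowW]
  simp only [Function.comp]
  field_simp
  ring

theorem hasDerivAt_flowLog (N : ℕ) {τ : ℝ} (hτ : 0 < τ) :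
    HasDerivAt (flowLog N) (-(flowL (2 * N + 1) τ / 4) * (flowW N τ ^ 2 / arcQ N (flowθ (2 * N + 1) τ) ^ 2
      - 1 / flowL (2 * N + 1) τ ^ 2
      - (arcQ N (flowθ (2 * N + 1) τ) - 1) ^ 2 / arcQ N (flowθ (2 * N + 1) τ) ^ 2
      - 2 * (arcQ N (flowθ (2 * N + 1) τ) - 1) / ((2 * N + 1) * arcQ N (flowθ (2 * N + 1) τ)))) τ := by
  have hk := two_mul_add_one_pos N
  have h0 := flowθ_pos hk hτ
  have h1 := flowθ_lt_pi (2 * N + 1) τ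
  have hr := (flowR_pos (2 * N + 1) τ).ne'
  have hl := (flowL_pos hk hτ).ne'
  have hV := (arcV_pos N h0.le h1).ne'
  refine ((((hasDerivAt_log_det_arcMatrix_succ N h0 h1).comp τ (hasDerivAt_flowθ hk τ)).fun_sub
    (((hasDerivAt_flowR hk τ).log hr).const_mul (((N : ℝ) + 1) ^ 2))).fun_add
    ((((hasDerivAt_flowL hk τ).div_const (2 * N + 1)).log (div_ne_zero hl hk.ne')).const_mul (1 / 4))).congr_deriv ?_
  have hl2 := flowL_sq hk τ
  rw [sin_flowθ hk, cos_flowθ_half, arcQ_flowθ, flowW]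
  have hr2 : flowR (2 * N + 1) τ ^ 2 / (2 * N + 1) / (flowL (2 * N + 1) τ / (2 * N + 1)) =
      1 / flowL (2 * N + 1) τ - flowL (2 * N + 1) τ / (2 * N + 1) ^ 2 := by
    field_simp; linarith
  rw [hr2]
  clear hr2 hl2
  generalize arcV N (flowθ (2 * N + 1) τ) = V at *
  generalize arcCos N (flowθ (2 * N + 1) τ) = s at *
  generalize flowR (2 * N + 1) τ = r at *
  generalize flowL (2 * N + 1) τ = l at *
  field_simp
  ring

theorem flowW_pos_near (N : ℕ) : ∀ᶠ τ in nhdsWithin 0 (Set.Ioi 0), 0 < flowW N τ := by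
  have hk := two_mul_add_one_pos N
  have hc : ContinuousAt (fun τ => arcCos N (flowθ (2 * N + 1) τ)) 0 := by
    have hpi := Real.pi_pos
    have hθ0 : flowθ (2 * N + 1) 0 = 0 := by simp [flowθ]
    refine ContinuousAt.comp (g := arcCos N) ?_ (hasDerivAt_flowθ hk 0).continuousAt
    rw [hθ0]
    have hP := (hasDerivAt_arcP N le_rfl hpi).continuousAt
    have hS := (hasDerivAt_arcS N le_rfl hpi).continuousAt
    have hn := (arcP_sq_add_arcS_sq_pos N le_rfl hpi).ne'
    unfold arcCos
    fun_prop (disch := assumption)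
  have h0 : arcCos N (flowθ (2 * N + 1) 0) = 1 := by
    simp [flowθ, arcCos, arcP_zero, arcS_zero]
  have := hc.eventually_const_lt (u := 0) (by simp only [h0]; exact one_pos)
  filter_upwards [this.filter_mono nhdsWithin_le_nhds] with τ hτ
  exact div_pos hτ (flowR_pos _ _)

/-- The Gram kernel obtained from the rescaled monomial basis on a short arc. -/
noncomputable def arcGramFun (β x : ℝ) : ℂ :=
  Complex.I * x * Complex.exp (Complex.I * β * x) * Real.sinc (β * x)

/-- The Gram matrix of the rescaled monomial basis on a short arc. -/
noncomputable def arcGram (n : ℕ) (β : ℝ) : Matrix (Fin n) (Fin n) ℂ :=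
  Matrix.of fun a b => ∫ x in (0 : ℝ)..1, arcGramFun β x ^ (a : ℕ) * (-arcGramFun (-β) x) ^ (b : ℕ)

theorem two_mul_arcGramFun (β x : ℝ) :
    2 * β * arcGramFun β x = Complex.exp (2 * Complex.I * β * x) - 1 := by
  have h1 : (β * x) * Real.sinc (β * x) = Real.sin (β * x) := by
    by_cases h : β * x = 0
    · rw [h]; simp
    · rw [Real.sinc_of_ne_zero h, mul_div_cancel₀ _ h]
  have h2 : (β : ℂ) * x * Real.sinc (β * x) = Complex.sin (β * x) := by
    exact_mod_cast congrArg (fun t : ℝ => (t : ℂ)) h1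
  have h3 : 2 * Complex.I * Complex.sin (β * x) =
      Complex.exp (Complex.I * β * x) - Complex.exp (-(Complex.I * β * x)) := by
    rw [Complex.sin, show -((β : ℂ) * x) * Complex.I = -(Complex.I * β * x) by ring,
      show ((β : ℂ) * x) * Complex.I = Complex.I * β * x by ring]
    linear_combination (-(Complex.exp (Complex.I * β * x) - Complex.exp (-(Complex.I * β * x)))) * Complex.I_sq
  have h4 : Complex.exp (2 * Complex.I * β * x) = Complex.exp (Complex.I * β * x) * Complex.exp (Complex.I * β * x) := by
    rw [← Complex.exp_add]; ring_nf
  have h5 : Complex.exp (Complex.I * β * x) * Complex.exp (-(Complex.I * β * x)) = 1 := by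
    rw [← Complex.exp_add, add_neg_cancel, Complex.exp_zero]
  rw [arcGramFun, h4]
  linear_combination (2 * Complex.I * Complex.exp (Complex.I * β * x)) * h2 +
    Complex.exp (Complex.I * β * x) * h3 - h5

theorem continuous_arcGramFun : Continuous (Function.uncurry arcGramFun) := by
  unfold Function.uncurry arcGramFun
  have := Real.continuous_sinc
  fun_prop

theorem continuous_arcGram (n : ℕ) : Continuous (arcGram n) := by
  refine continuous_matrix fun a b => ?_
  refine intervalIntegral.continuous_parametric_intervalIntegral_of_continuous' ?_ 0 1
  have h1 := continuous_arcGramFun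
  have h2 : Continuous (fun p : ℝ × ℝ => arcGramFun (-p.1) p.2) :=
    h1.comp (by fun_prop : Continuous fun p : ℝ × ℝ => (-p.1, p.2))
  exact (h1.pow _).mul (h2.neg.pow _)

/-- Conjugating a matrix by scalings of rows and columns whose products are trivial keeps the determinant. -/
theorem det_of_mul_mul {R : Type*} [CommRing R] {n : ℕ} (A : Matrix (Fin n) (Fin n) R) (u v : Fin n → R)
    (huv : ∀ j, u j * v j = 1) : (Matrix.of fun j k => u j * (A j k * v k)).det = A.det := by
  have h : (Matrix.of fun j k => u j * (A j k * v k)) = Matrix.diagonal u * A * Matrix.diagonal v := by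
    ext j k
    simp [Matrix.diagonal_mul, Matrix.mul_diagonal, mul_assoc]
  rw [h, Matrix.det_mul, Matrix.det_mul, Matrix.det_diagonal, Matrix.det_diagonal]
  have : (∏ i, u i) * ∏ i, v i = 1 := by rw [← Finset.prod_mul_distrib]; simp [huv]
  linear_combination A.det * this

theorem det_arcGram_zero (n : ℕ) : (arcGram n 0).det = ((hilbertMatrix n).det : ℂ) := by
  have h : arcGram n 0 = Matrix.of fun a b : Fin n => Complex.I ^ (a : ℕ) *
      ((hilbertMatrix n).map (Complex.ofReal) a b * (-Complex.I) ^ (b : ℕ)) := by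
    ext a b
    simp only [arcGram, arcGramFun, Matrix.of_apply, hilbertMatrix, Matrix.map_apply]
    have : ∀ x : ℝ, (Complex.I * x * Complex.exp (Complex.I * (0 : ℝ) * x) * Real.sinc (0 * x)) ^ (a : ℕ) *
        (-(Complex.I * x * Complex.exp (Complex.I * (-0 : ℝ) * x) * Real.sinc (-0 * x))) ^ (b : ℕ)
        = Complex.I ^ (a : ℕ) * (-Complex.I) ^ (b : ℕ) * ((x ^ ((a : ℕ) + b) : ℝ) : ℂ) := by
      intro x
      simp only [Complex.ofReal_zero, mul_zero, zero_mul, Complex.exp_zero, Real.sinc_zero, neg_zero,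
        Complex.ofReal_one, mul_one, Complex.ofReal_pow]
      rw [← neg_mul, mul_pow, mul_pow, pow_add]
      ring
    simp only [this]
    rw [intervalIntegral.integral_const_mul, intervalIntegral.integral_ofReal, integral_pow]
    push_cast
    simp
    ring
  rw [h, det_of_mul_mul]
  · exact (Complex.ofRealHom.map_det (hilbertMatrix n)).symm
  · intro j
    rw [← mul_pow]; simp

theorem arcMatrix_pi_sub_apply (n : ℕ) {β : ℝ} (hβ : β ≠ 0) (j k : Fin n) :
    ((arcMatrix n (Real.pi - β) j k : ℝ) : ℂ) = ((-1) ^ (j : ℕ) * Complex.exp (-(Complex.I * β * (j : ℕ)))) *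
      ((β / Real.pi * ∫ x in (0 : ℝ)..1, Complex.exp (2 * Complex.I * β * x) ^ (j : ℕ) *
        Complex.exp (2 * Complex.I * (-β : ℝ) * x) ^ (k : ℕ)) *
      ((-1) ^ (k : ℕ) * Complex.exp (Complex.I * β * (k : ℕ)))) := by
  have hpi : (Real.pi : ℂ) ≠ 0 := by exact_mod_cast Real.pi_ne_zero
  have hβ' : (β : ℂ) ≠ 0 := by exact_mod_cast hβ
  have h1 : ∀ x : ℝ, Complex.exp (2 * Complex.I * β * x) ^ (j : ℕ) *
        Complex.exp (2 * Complex.I * (-β : ℝ) * x) ^ (k : ℕ) =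
        Complex.exp ((2 * Complex.I * β * (((j : ℕ) : ℂ) - (k : ℕ))) * x) := by
    intro x
    rw [← Complex.exp_nat_mul, ← Complex.exp_nat_mul, ← Complex.exp_add]
    congr 1
    push_cast
    ring
  simp only [h1]
  rw [arcMatrix, Matrix.of_apply]
  by_cases hjk : j = k
  · subst hjk
    have e1 : ((-1 : ℂ) ^ (j : ℕ)) * (-1) ^ (j : ℕ) = 1 := by rw [← mul_pow]; simp
    have e2 : Complex.exp (-(Complex.I * β * (j : ℕ))) * Complex.exp (Complex.I * β * (j : ℕ)) = 1 := by
      rw [← Complex.exp_add, neg_add_cancel, Complex.exp_zero]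
    simp only [if_true, sub_self, mul_zero, zero_mul, Complex.exp_zero, intervalIntegral.integral_const]
    push_cast
    have e3 : (1 : ℂ) - (Real.pi - β) / Real.pi = β / Real.pi := by field_simp; ring
    rw [e3]
    simp only [Complex.real_smul]
    push_cast
    linear_combination (-(β / Real.pi : ℂ) * Complex.exp (-(Complex.I * β * (j : ℕ))) * Complex.exp (Complex.I * β * (j : ℕ))) * e1
      - (β / Real.pi : ℂ) * e2
  · have hm : ((j : ℕ) : ℂ) - (k : ℕ) ≠ 0 := by
      rw [sub_ne_zero]
      exact_mod_cast fun h => hjk (Fin.ext h)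
    rw [if_neg hjk, integral_exp_mul_complex (by simp [hβ', hm])]
    have hsin : Real.sin (((j : ℝ) - k) * (Real.pi - β)) = -((-1) ^ (j : ℕ) * (-1) ^ (k : ℕ)) * Real.sin (((j : ℝ) - k) * β) := by
      rw [show ((j : ℝ) - k) * (Real.pi - β) = -(((j : ℝ) - k) * β) + (j : ℕ) * Real.pi - (k : ℕ) * Real.pi by ring,
        Real.sin_sub_nat_mul_pi, Real.sin_add_nat_mul_pi, Real.sin_neg]
      ring
    rw [hsin]
    push_cast
    have e4 : Complex.exp (2 * Complex.I * β * (((j : ℕ) : ℂ) - (k : ℕ)) * 1) =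
      (Complex.exp (Complex.I * β * (((j : ℕ) : ℂ) - (k : ℕ)))) ^ 2 := by rw [← Complex.exp_nat_mul]; ring_nf
    have e5 : Complex.exp (-(Complex.I * β * (j : ℕ))) * Complex.exp (Complex.I * β * (k : ℕ)) =
        Complex.exp (-(Complex.I * β * (((j : ℕ) : ℂ) - (k : ℕ)))) := by rw [← Complex.exp_add]; ring_nf
    have e6 : Complex.exp (Complex.I * β * (((j : ℕ) : ℂ) - (k : ℕ))) *
       Complex.exp (-(Complex.I * β * (((j : ℕ) : ℂ) - (k : ℕ)))) = 1 := by
      rw [← Complex.exp_add, add_neg_cancel, Complex.exp_zero]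
    rw [e4, mul_zero, Complex.exp_zero, Complex.sin, show -((((j : ℕ) : ℂ) - (k : ℕ)) * β) * Complex.I = -(Complex.I * β * (((j : ℕ) : ℂ) - (k : ℕ))) by ring,
      show ((((j : ℕ) : ℂ) - (k : ℕ)) * β) * Complex.I = Complex.I * β * (((j : ℕ) : ℂ) - (k : ℕ)) by ring]
    have hI := Complex.I_ne_zero
    set X := Complex.exp (Complex.I * β * (((j : ℕ) : ℂ) - (k : ℕ)))
    set Y := Complex.exp (-(Complex.I * β * (((j : ℕ) : ℂ) - (k : ℕ))))
    generalize hE : ((j : ℕ) : ℂ) - (k : ℕ) = m at *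
    have : ∀ A B s t : ℂ, (s * A) * (β / Real.pi * ((X ^ 2 - 1) / (2 * Complex.I * β * m)) * (t * B)) =
      s * t * (A * B) * (X ^ 2 - 1) / (2 * Complex.I * m * Real.pi) := by intros; field_simp
    rw [this, e5]
    field_simp
    linear_combination ((Y - X)) * Complex.I_sq + (-X) * e6

theorem one_add_pow_eq_sum_fin {R : Type*} [CommRing R] {n : ℕ} (j : Fin n) (z : R) :
    (z + 1) ^ (j : ℕ) = ∑ a : Fin n, ((j : ℕ).choose a : R) * z ^ (a : ℕ) := by
  rw [add_pow, Fin.sum_univ_eq_sum_range (fun a => ((j : ℕ).choose a : R) * z ^ a) n]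
  rw [← Finset.sum_subset (Finset.range_mono (Nat.succ_le_of_lt j.2))]
  · refine Finset.sum_congr rfl fun a _ => ?_
    rw [one_pow]; ring
  · intro a _ ha
    rw [Nat.choose_eq_zero_of_lt (by simpa using ha)]
    simp

/-- The Pascal matrix. -/
noncomputable def pascalMatrix (n : ℕ) : Matrix (Fin n) (Fin n) ℂ := Matrix.of fun j a => ((j : ℕ).choose a : ℂ)

theorem det_pascalMatrix (n : ℕ) : (pascalMatrix n).det = 1 := by
  have hL : (pascalMatrix n).BlockTriangular OrderDual.toDual := by
    intro i j hij
    have : (i : ℕ) < j := hij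
    simp [pascalMatrix, Nat.choose_eq_zero_of_lt this]
  rw [Matrix.det_of_isLowerTriangular _ hL]
  simp [pascalMatrix]

theorem integral_exp_pow_mul (n : ℕ) (β : ℝ) (j k : Fin n) :
    ∫ x in (0 : ℝ)..1, Complex.exp (2 * Complex.I * β * x) ^ (j : ℕ) *
        Complex.exp (2 * Complex.I * (-β : ℝ) * x) ^ (k : ℕ) =
      (pascalMatrix n * (Matrix.diagonal (fun a : Fin n => (2 * (β : ℂ)) ^ (a : ℕ)) * arcGram n β *
        Matrix.diagonal (fun a : Fin n => (2 * (β : ℂ)) ^ (a : ℕ))) * (pascalMatrix n).transpose) j k := by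
  have h1 : ∀ x : ℝ, Complex.exp (2 * Complex.I * β * x) ^ (j : ℕ) *
        Complex.exp (2 * Complex.I * (-β : ℝ) * x) ^ (k : ℕ) = ∑ b : Fin n, ∑ a : Fin n,
        ((((j : ℕ).choose a : ℂ) * (2 * (β : ℂ)) ^ (a : ℕ)) * (((k : ℕ).choose b : ℂ) * (2 * (β : ℂ)) ^ (b : ℕ))) *
        (arcGramFun β x ^ (a : ℕ) * (-arcGramFun (-β) x) ^ (b : ℕ)) := by
    intro x
    have e1 : Complex.exp (2 * Complex.I * β * x) = 2 * β * arcGramFun β x + 1 := by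
      rw [two_mul_arcGramFun]; ring
    have e2 : Complex.exp (2 * Complex.I * (-β : ℝ) * x) = 2 * β * (-arcGramFun (-β) x) + 1 := by
      have := two_mul_arcGramFun (-β) x
      push_cast at this ⊢
      linear_combination -this
    rw [e1, e2, one_add_pow_eq_sum_fin, one_add_pow_eq_sum_fin, Finset.sum_mul_sum, Finset.sum_comm]
    refine Finset.sum_congr rfl fun b _ => Finset.sum_congr rfl fun a _ => ?_
    rw [mul_pow, mul_pow (2 * (β : ℂ)) (-arcGramFun (-β) x)]
    ring
  simp only [h1]
  have hc : ∀ a b : Fin n, Continuous fun x : ℝ => arcGramFun β x ^ (a : ℕ) * (-arcGramFun (-β) x) ^ (b : ℕ) := by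
    intro a b
    have h2 : ∀ γ : ℝ, Continuous (fun x : ℝ => arcGramFun γ x) := fun γ =>
      continuous_arcGramFun.comp (by fun_prop : Continuous fun x : ℝ => (γ, x))
    exact ((h2 β).pow _).mul ((h2 (-β)).neg.pow _)
  rw [intervalIntegral.integral_finsetSum fun b _ =>
    (continuous_finsetSum _ fun a _ => (hc a b).const_mul _).intervalIntegrable _ _]
  rw [Matrix.mul_apply]
  refine Finset.sum_congr rfl fun b _ => ?_
  rw [intervalIntegral.integral_finsetSum fun a _ => ((hc a b).const_mul _).intervalIntegrable _ _,
    Matrix.mul_apply, Finset.sum_mul]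
  refine Finset.sum_congr rfl fun a _ => ?_
  rw [intervalIntegral.integral_const_mul, Matrix.mul_diagonal, Matrix.diagonal_mul]
  simp only [pascalMatrix, Matrix.of_apply, Matrix.transpose_apply, arcGram]
  ring

theorem det_arcMatrix_pi_sub (n : ℕ) {β : ℝ} (hβ : β ≠ 0) :
    (((arcMatrix n (Real.pi - β)).det : ℝ) : ℂ) =
      (β : ℂ) ^ n ^ 2 * (2 ^ (n * (n - 1)) / (Real.pi : ℂ) ^ n) * (arcGram n β).det := by
  have h1 := (Complex.ofRealHom.map_det (arcMatrix n (Real.pi - β)))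
  simp only [Complex.ofRealHom_eq_coe] at h1
  rw [h1]
  set M := (β / Real.pi : ℂ) • (pascalMatrix n * (Matrix.diagonal (fun a : Fin n => (2 * (β : ℂ)) ^ (a : ℕ)) * arcGram n β *
        Matrix.diagonal (fun a : Fin n => (2 * (β : ℂ)) ^ (a : ℕ))) * (pascalMatrix n).transpose) with hM
  have h2 : Complex.ofRealHom.mapMatrix (arcMatrix n (Real.pi - β)) = Matrix.of fun j k : Fin n =>
      ((-1) ^ (j : ℕ) * Complex.exp (-(Complex.I * β * (j : ℕ)))) *
      (M j k * ((-1) ^ (k : ℕ) * Complex.exp (Complex.I * β * (k : ℕ)))) := by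
    ext j k
    rw [Matrix.of_apply, hM, Matrix.smul_apply, ← integral_exp_pow_mul, smul_eq_mul]
    exact arcMatrix_pi_sub_apply n hβ j k
  rw [h2, det_of_mul_mul]
  · rw [hM, Matrix.det_smul, Matrix.det_mul, Matrix.det_mul, Matrix.det_transpose, det_pascalMatrix,
      Matrix.det_mul, Matrix.det_mul, Matrix.det_diagonal]
    rw [Fin.prod_univ_eq_prod_range (fun a => (2 * (β : ℂ)) ^ a) n, Finset.prod_pow_eq_pow_sum]
    have h3 : (2 * (β : ℂ)) ^ (∑ i ∈ Finset.range n, i) * (2 * (β : ℂ)) ^ (∑ i ∈ Finset.range n, i) =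
        (2 * (β : ℂ)) ^ (n * (n - 1)) := by
      rw [← pow_add, ← mul_two, Finset.sum_range_id_mul_two]
    have h4 : (β : ℂ) ^ n ^ 2 = (β : ℂ) ^ n * (β : ℂ) ^ (n * (n - 1)) := by
      rw [← pow_add]
      congr 1
      rcases n with _ | m
      · rfl
      · simp; ring
    rw [h4, Fintype.card_fin, div_pow]
    rw [mul_pow] at h3
    linear_combination ((β : ℂ) ^ n / (Real.pi : ℂ) ^ n * (arcGram n β).det) * h3
  · intro j
    have e1 : ((-1 : ℂ) ^ (j : ℕ)) * (-1) ^ (j : ℕ) = 1 := by rw [← mul_pow]; simp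
    have e2 : Complex.exp (-(Complex.I * β * (j : ℕ))) * Complex.exp (Complex.I * β * (j : ℕ)) = 1 := by
      rw [← Complex.exp_add, neg_add_cancel, Complex.exp_zero]
    linear_combination (Complex.exp (-(Complex.I * β * (j : ℕ))) * Complex.exp (Complex.I * β * (j : ℕ))) * e1 + e2

theorem tendsto_det_arcMatrix_div (n : ℕ) :
    Tendsto (fun β : ℝ => (arcMatrix n (Real.pi - β)).det / β ^ n ^ 2) (nhdsWithin 0 {0}ᶜ)
      (nhds (2 ^ (n * (n - 1)) / Real.pi ^ n * (hilbertMatrix n).det)) := by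
  have h1 : Tendsto (fun β : ℝ => ((2 ^ (n * (n - 1)) / (Real.pi : ℂ) ^ n) * (arcGram n β).det).re)
      (nhdsWithin 0 {0}ᶜ) (nhds ((2 ^ (n * (n - 1)) / (Real.pi : ℂ) ^ n) * (arcGram n 0).det).re) := by
    have : Continuous fun β : ℝ => ((2 ^ (n * (n - 1)) / (Real.pi : ℂ) ^ n) * (arcGram n β).det).re :=
      Complex.continuous_re.comp ((continuous_arcGram n).matrix_det.const_mul _)
    exact (this.tendsto 0).mono_left nhdsWithin_le_nhds
  have h2 : ((2 ^ (n * (n - 1)) / (Real.pi : ℂ) ^ n) * (arcGram n 0).det).re =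
      2 ^ (n * (n - 1)) / Real.pi ^ n * (hilbertMatrix n).det := by
    rw [det_arcGram_zero]
    exact_mod_cast Complex.ofReal_re (2 ^ (n * (n - 1)) / Real.pi ^ n * (hilbertMatrix n).det)
  rw [h2] at h1
  refine h1.congr' ?_
  filter_upwards [self_mem_nhdsWithin] with β hβ
  have hβ0 : β ≠ 0 := hβ
  have hβ' : (β : ℂ) ≠ 0 := by exact_mod_cast hβ0
  have h3 := det_arcMatrix_pi_sub n hβ0
  have h4 : (2 ^ (n * (n - 1)) / (Real.pi : ℂ) ^ n) * (arcGram n β).det =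
      (((arcMatrix n (Real.pi - β)).det / β ^ n ^ 2 : ℝ) : ℂ) := by
    push_cast
    rw [h3]
    field_simp
  rw [h4, Complex.ofReal_re]

theorem AnalyticAt.exists_eq_pow_mul_of_tendsto {f : ℝ → ℝ} (hf : AnalyticAt ℝ f 0) {m : ℕ} {c : ℝ} (hc : c ≠ 0)
    (h : Tendsto (fun x => f x / x ^ m) (nhdsWithin 0 {0}ᶜ) (nhds c)) :
    ∃ g : ℝ → ℝ, AnalyticAt ℝ g 0 ∧ g 0 = c ∧ ∀ᶠ x in nhds 0, f x = x ^ m * g x := by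
  have hne : ¬ ∀ᶠ x in nhds 0, f x = 0 := by
    intro h0
    have : Tendsto (fun x => f x / x ^ m) (nhdsWithin 0 {0}ᶜ) (nhds 0) := by
      refine tendsto_const_nhds.congr' ?_
      filter_upwards [h0.filter_mono nhdsWithin_le_nhds] with x hx
      rw [hx, zero_div]
    exact hc (tendsto_nhds_unique h this)
  obtain ⟨m', g, hg, hg0, hfg⟩ := hf.exists_eventuallyEq_pow_smul_nonzero_iff.2 hne
  simp only [sub_zero, smul_eq_mul] at hfg
  have hgt : Tendsto g (nhdsWithin 0 {0}ᶜ) (nhds (g 0)) := hg.continuousAt.tendsto.mono_left nhdsWithin_le_nhds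
  have hx0 : ∀ d : ℕ, Tendsto (fun x : ℝ => x ^ (d + 1)) (nhdsWithin 0 {0}ᶜ) (nhds 0) := fun d => by
    have := ((continuous_pow (M := ℝ) (d + 1)).tendsto 0).mono_left (nhdsWithin_le_nhds (s := {0}ᶜ))
    simpa using this
  have hmm : m' = m := by
    rcases lt_trichotomy m' m with hlt | heq | hlt
    · obtain ⟨d, rfl⟩ := Nat.exists_eq_add_of_lt hlt
      have h1 := (h.mul (hx0 d)).congr' (f₂ := g) (by
        filter_upwards [hfg.filter_mono nhdsWithin_le_nhds, self_mem_nhdsWithin] with x hx hx1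
        have : x ≠ 0 := hx1
        rw [hx, add_assoc, pow_add x m']
        field_simp)
      rw [mul_zero] at h1
      exact absurd (tendsto_nhds_unique hgt h1) hg0
    · exact heq
    · obtain ⟨d, rfl⟩ := Nat.exists_eq_add_of_lt hlt
      have h1 := (hgt.mul (hx0 d)).congr' (f₂ := fun x => f x / x ^ m) (by
        filter_upwards [hfg.filter_mono nhdsWithin_le_nhds, self_mem_nhdsWithin] with x hx hx1
        have : x ≠ 0 := hx1
        rw [hx, add_assoc, pow_add x m]
        field_simp)
      rw [mul_zero] at h1
      exact absurd (tendsto_nhds_unique h h1) hc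
  subst hmm
  refine ⟨g, hg, tendsto_nhds_unique hgt (h.congr' ?_), hfg⟩
  filter_upwards [hfg.filter_mono nhdsWithin_le_nhds, self_mem_nhdsWithin] with x hx hx1
  have : x ≠ 0 := hx1
  rw [hx]
  field_simp

theorem analyticAt_det_arcMatrix (n : ℕ) : AnalyticAt ℝ (fun β : ℝ => (arcMatrix n (Real.pi - β)).det) 0 := by
  have h : ∀ j k : Fin n, AnalyticAt ℝ (fun β : ℝ => arcMatrix n (Real.pi - β) j k) 0 := by
    intro j k
    simp only [arcMatrix, Matrix.of_apply]
    split_ifs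
    · fun_prop
    · refine (AnalyticAt.fun_div ?_ analyticAt_const ?_).fun_neg
      · exact Real.analyticAt_sin.fun_comp (by fun_prop)
      · rename_i hjk
        refine mul_ne_zero Real.pi_ne_zero (sub_ne_zero.2 ?_)
        exact_mod_cast fun h => hjk (Fin.ext h)
  simp only [Matrix.det_apply]
  refine Finset.analyticAt_fun_sum _ fun σ _ => ?_
  simp only [Units.smul_def, zsmul_eq_mul]
  exact analyticAt_const.fun_mul (Finset.analyticAt_fun_prod _ fun j _ => h _ _)

theorem arcX_eq_det_div (N : ℕ) {θ : ℝ} (h0 : 0 ≤ θ) (hθ : θ < Real.pi) :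
    arcX N θ = (arcMatrix N θ).det / (arcMatrix (N + 1) θ).det := by
  have hu := isUnit_det_arcMatrix (N + 1) h0 hθ
  rw [arcX, arcForm, arcE, Matrix.mulVec_single_one, single_one_dotProduct, Matrix.col_apply, Matrix.inv_def,
    Matrix.smul_apply, Matrix.adjugate_fin_succ_eq_det_submatrix, Ring.inverse_eq_inv', smul_eq_mul, ← div_eq_inv_mul]
  congr 1
  have : (arcMatrix (N + 1) θ).submatrix (Fin.succAbove 0) (Fin.succAbove 0) = arcMatrix N θ := by
    ext j k
    simp only [Matrix.submatrix_apply, arcMatrix, Matrix.of_apply, Fin.zero_succAbove, Fin.succ_inj, Fin.val_succ]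
    push_cast
    simp
  rw [this]
  simp

theorem exists_arcX_eq (N : ℕ) : ∃ G : ℝ → ℝ, AnalyticAt ℝ G 0 ∧ G 0 ≠ 0 ∧
    ∀ᶠ β in nhdsWithin 0 (Set.Ioi 0), arcX N (Real.pi - β) * β ^ (2 * N + 1) = G β := by
  have hc : ∀ n : ℕ, (2 ^ (n * (n - 1)) / Real.pi ^ n * (hilbertMatrix n).det) ≠ 0 := fun n =>
    (mul_pos (by have := Real.pi_pos; positivity) (det_hilbertMatrix_pos n)).ne'
  obtain ⟨g, hg, hg0, hfg⟩ := (analyticAt_det_arcMatrix N).exists_eq_pow_mul_of_tendsto (hc N)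
    (tendsto_det_arcMatrix_div N)
  obtain ⟨g', hg', hg0', hfg'⟩ := (analyticAt_det_arcMatrix (N + 1)).exists_eq_pow_mul_of_tendsto (hc (N + 1))
    (tendsto_det_arcMatrix_div (N + 1))
  have h1 : g 0 ≠ 0 := hg0 ▸ hc N
  have h2 : g' 0 ≠ 0 := hg0' ▸ hc (N + 1)
  refine ⟨fun β => g β / g' β, hg.fun_div hg' h2, div_ne_zero h1 h2, ?_⟩
  filter_upwards [hfg.filter_mono nhdsWithin_le_nhds, hfg'.filter_mono nhdsWithin_le_nhds,
    (hg'.continuousAt.eventually_ne h2).filter_mono nhdsWithin_le_nhds,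
    Ioo_mem_nhdsGT Real.pi_pos] with β e1 e2 e3 e4
  rw [arcX_eq_det_div N (by linarith [e4.2]) (by linarith [e4.1]), e1, e2]
  have h0 := e4.1.ne'
  have e5 : β ^ (N + 1) ^ 2 = β ^ N ^ 2 * β ^ (2 * N + 1) := by rw [← pow_add]; congr 1; ring
  rw [e5]
  field_simp

theorem exists_arcQ_eq (N : ℕ) : ∃ h : ℝ → ℝ, AnalyticAt ℝ h 0 ∧ h 0 = 1 ∧
    ∀ᶠ β in nhdsWithin 0 (Set.Ioi 0), arcQ N (Real.pi - β) = h β := by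
  obtain ⟨G, hG, hG0, hX⟩ := exists_arcX_eq N
  have hsin : AnalyticAt ℝ (fun β : ℝ => Real.sin (β / 2)) 0 := Real.analyticAt_sin.fun_comp (by fun_prop)
  have hcos : AnalyticAt ℝ (fun β : ℝ => Real.cos (β / 2)) 0 := Real.analyticAt_cos.fun_comp (by fun_prop)
  obtain ⟨s, hs, hs0, hss⟩ := hsin.exists_eq_pow_mul_of_tendsto (m := 1) (c := 1 / 2) (by norm_num) (by
    have h1 : HasDerivAt (fun β : ℝ => Real.sin (β / 2)) (1 / 2) 0 := by
      refine ((hasDerivAt_id (0 : ℝ)).div_const 2).sin.congr_deriv ?_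
      simp
    refine (hasDerivAt_iff_tendsto_slope.1 h1).congr fun x => ?_
    rw [slope_def_field]; simp)
  have hk := two_mul_add_one_pos N
  have hs0' : s 0 ≠ 0 := by rw [hs0]; norm_num
  refine ⟨fun β => (2 * N + 1) * Real.cos (β / 2) / (2 * s β * ((2 * N + 1) - β * (deriv G β / G β))), ?_, ?_, ?_⟩
  · refine AnalyticAt.fun_div (analyticAt_const.fun_mul hcos) ((analyticAt_const.fun_mul hs).fun_mul
      (analyticAt_const.fun_sub (analyticAt_id.fun_mul (hG.deriv.fun_div hG hG0)))) ?_
    simp [hs0, hk.ne']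
  · simp only [hs0, zero_div, zero_mul, Real.cos_zero, sub_zero]
    field_simp
  · rw [← eventually_eventually_nhdsWithin] at hX
    filter_upwards [hX, self_mem_nhdsWithin, hss.filter_mono nhdsWithin_le_nhds, Ioo_mem_nhdsGT Real.pi_pos,
      hG.eventually_analyticAt.filter_mono nhdsWithin_le_nhds,
      (hG.continuousAt.eventually_ne hG0).filter_mono nhdsWithin_le_nhds,
      (hs.continuousAt.eventually_ne hs0').filter_mono nhdsWithin_le_nhds] with β e1 e2 e3 e4 e5 e6 e7
    have h0 : (0 : ℝ) < β := e2
    rw [IsOpen.nhdsWithin_eq isOpen_Ioi e2] at e1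
    have hθ0 : 0 ≤ Real.pi - β := by linarith [e4.2]
    have hθ1 : Real.pi - β < Real.pi := by linarith
    have hXp := arcX_pos N hθ0 hθ1
    have d1 : HasDerivAt (fun t : ℝ => arcX N (Real.pi - t) * t ^ (2 * N + 1))
        (-(arcV N (Real.pi - β)) * arcX N (Real.pi - β) * β ^ (2 * N + 1) +
          arcX N (Real.pi - β) * ((2 * N + 1) * β ^ (2 * N))) β := by
      refine (((hasDerivAt_arcX N hθ0 hθ1).comp β ((hasDerivAt_id β).const_sub Real.pi)).fun_mul
        (hasDerivAt_pow (2 * N + 1) β)).congr_deriv ?_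
      rw [arcV]
      have := Real.pi_ne_zero
      simp only [Function.comp]
      push_cast
      field_simp
    have d2 := (d1.congr_of_eventuallyEq (EventuallyEq.symm e1)).deriv
    have e8 := e1.self_of_nhds
    have e9 : deriv G β / G β = (2 * N + 1) / β - arcV N (Real.pi - β) := by
      rw [d2, ← e8]
      field_simp
      ring
    have hV := arcV_pos N hθ0 hθ1
    have hsin2 : Real.sin ((Real.pi - β) / 2) = Real.cos (β / 2) := by
      rw [sub_div, Real.sin_pi_div_two_sub]
    have hcos2 : Real.cos ((Real.pi - β) / 2) = Real.sin (β / 2) := by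
      rw [sub_div, Real.cos_pi_div_two_sub]
    have e10 : (2 * N + 1 : ℝ) - β * (deriv G β / G β) = β * arcV N (Real.pi - β) := by
      rw [e9]; field_simp; ring
    rw [e10, arcQ, hsin2, hcos2, e3]
    field_simp

theorem tendsto_log_det_arcMatrix_sub (n : ℕ) :
    Tendsto (fun β : ℝ => Real.log (arcMatrix n (Real.pi - β)).det - n ^ 2 * Real.log (Real.sin (β / 2)))
      (nhdsWithin 0 (Set.Ioi 0))
      (nhds (2 * (n : ℝ) ^ 2 * Real.log 2 - n * Real.log (2 * Real.pi) + Real.log (hilbertMatrix n).det)) := by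
  have hpi := Real.pi_pos
  have hH := det_hilbertMatrix_pos n
  have h1 := (tendsto_det_arcMatrix_div n).mono_left (nhdsWithin_mono 0 (s := Set.Ioi 0) fun x (hx : 0 < x) => hx.ne')
  have h2 : Tendsto (fun β : ℝ => Real.sin (β / 2) / β) (nhdsWithin 0 (Set.Ioi 0)) (nhds (1 / 2)) := by
    have h1 : HasDerivAt (fun β : ℝ => Real.sin (β / 2)) (1 / 2) 0 := by
      refine ((hasDerivAt_id (0 : ℝ)).div_const 2).sin.congr_deriv ?_
      simp
    refine ((hasDerivAt_iff_tendsto_slope.1 h1).mono_left (nhdsWithin_mono 0 fun x (hx : 0 < x) => hx.ne')).congr fun x => ?_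
    rw [slope_def_field]; simp
  have h3 := ((h1.log (mul_pos (by positivity) hH).ne').sub ((h2.log (by norm_num)).const_mul ((n : ℝ) ^ 2)))
  have e : Real.log (2 ^ (n * (n - 1)) / Real.pi ^ n * (hilbertMatrix n).det) - (n : ℝ) ^ 2 * Real.log (1 / 2) =
      2 * (n : ℝ) ^ 2 * Real.log 2 - n * Real.log (2 * Real.pi) + Real.log (hilbertMatrix n).det := by
    rw [Real.log_mul (by positivity) hH.ne', Real.log_div (by positivity) (by positivity), Real.log_pow, Real.log_pow,
      Real.log_mul two_ne_zero hpi.ne', one_div, Real.log_inv]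
    have : ((n * (n - 1) : ℕ) : ℝ) = n * (n - 1) := by
      rcases n with _ | m
      · simp
      · simp
    rw [this]
    ring
  rw [e] at h3
  refine h3.congr' ?_
  filter_upwards [Ioo_mem_nhdsGT Real.pi_pos] with β hβ
  have hs : 0 < Real.sin (β / 2) := Real.sin_pos_of_pos_of_lt_pi (by linarith [hβ.1]) (by linarith [hβ.2])
  have hD := (posDef_arcMatrix n (θ := Real.pi - β) (by linarith [hβ.2]) (by linarith [hβ.1])).det_pos
  have hb := hβ.1
  rw [Real.log_div hD.ne' (by positivity), Real.log_div hs.ne' hb.ne', Real.log_pow]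
  push_cast
  ring

theorem tendsto_pi_sub_flowθ {k : ℝ} (hk : 0 < k) :
    Tendsto (fun τ => Real.pi - flowθ k τ) atTop (nhdsWithin 0 (Set.Ioi 0)) := by
  refine tendsto_nhdsWithin_of_tendsto_nhds_of_eventually_within _ ?_
    (Eventually.of_forall fun τ => sub_pos.2 (flowθ_lt_pi k τ))
  have h1 : Tendsto (fun τ : ℝ => Real.sinh (τ / k)) atTop atTop := by
    refine tendsto_atTop_mono' _ ?_ (tendsto_id.atTop_div_const hk)
    filter_upwards [eventually_ge_atTop 0] with τ hτ
    exact Real.self_le_sinh_iff.2 (div_nonneg hτ hk.le)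
  have h2 := (((Real.tendsto_arctan_atTop.mono_right nhdsWithin_le_nhds).comp h1).const_mul 2).const_sub Real.pi
  simpa [flowθ, Function.comp_def, mul_div_cancel₀] using h2

theorem sin_pi_sub_flowθ_half (k τ : ℝ) : Real.sin ((Real.pi - flowθ k τ) / 2) = flowR k τ := by
  rw [sub_div, Real.sin_pi_div_two_sub, cos_flowθ_half]

theorem tendsto_sq_div_sin_half {h : ℝ → ℝ} (hh : AnalyticAt ℝ h 0) (h1 : h 0 = 1) :
    Tendsto (fun β : ℝ => (h β - 1) ^ 2 / Real.sin (β / 2)) (nhdsWithin 0 (Set.Ioi 0)) (nhds 0) := by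
  have hmono := nhdsWithin_mono (0 : ℝ) (s := Set.Ioi 0) (t := {0}ᶜ) fun x (hx : 0 < x) => hx.ne'
  have e1 := (hasDerivAt_iff_tendsto_slope.1 hh.differentiableAt.hasDerivAt).mono_left hmono
  have e2 : Tendsto (fun β : ℝ => Real.sin (β / 2) / β) (nhdsWithin 0 (Set.Ioi 0)) (nhds (1 / 2)) := by
    have h1 : HasDerivAt (fun β : ℝ => Real.sin (β / 2)) (1 / 2) 0 := by
      refine ((hasDerivAt_id (0 : ℝ)).div_const 2).sin.congr_deriv ?_
      simp
    refine ((hasDerivAt_iff_tendsto_slope.1 h1).mono_left hmono).congr fun x => ?_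
    rw [slope_def_field]; simp
  have e3 : Tendsto (fun β => h β - 1) (nhdsWithin 0 (Set.Ioi 0)) (nhds 0) := by
    have := (hh.continuousAt.tendsto.mono_left (nhdsWithin_le_nhds (s := Set.Ioi 0))).sub_const 1
    simpa [h1] using this
  have e4 := (e1.mul e3).div e2 (by norm_num)
  simp only [mul_zero, zero_div] at e4
  refine e4.congr' ?_
  filter_upwards [self_mem_nhdsWithin] with β hβ
  have hb : β ≠ 0 := (show 0 < β from hβ).ne'
  simp only [Pi.div_apply, slope_def_field, h1, sub_zero]
  by_cases hs : Real.sin (β / 2) = 0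
  · simp [hs]
  · field_simp

/-- The arc determinants give a solution of the flow. -/
theorem isDysonFlow_arc (N : ℕ) (hN : 0 < N) :
    IsDysonFlow (2 * N + 1) (fun τ => arcQ N (flowθ (2 * N + 1) τ)) (flowW N) (flowLog N)
      (2 * ((N : ℝ) + 1) ^ 2 * Real.log 2 - (N + 1) * Real.log (2 * Real.pi)
        + Real.log (hilbertMatrix (N + 1)).det) := by
  have hk := two_mul_add_one_pos N
  have hβ := tendsto_pi_sub_flowθ hk
  obtain ⟨h, hh, h1, hQ⟩ := exists_arcQ_eq N
  have hh0 : Tendsto (fun τ => h (Real.pi - flowθ (2 * N + 1) τ)) atTop (nhds 1) := by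
    have := (hh.continuousAt.tendsto.mono_left nhdsWithin_le_nhds).comp hβ
    rwa [h1] at this
  have hq : ∀ᶠ τ in atTop, arcQ N (flowθ (2 * N + 1) τ) = h (Real.pi - flowθ (2 * N + 1) τ) := by
    filter_upwards [hβ.eventually hQ] with τ hτ
    rw [← hτ, sub_sub_cancel]
  refine ⟨by linarith [(Nat.cast_nonneg N : (0 : ℝ) ≤ N)], fun τ hτ => arcQ_pos N (flowθ_pos hk hτ) (flowθ_lt_pi _ τ),
    fun τ hτ => flowW_sq_lt N hN hτ, fun τ hτ => hasDerivAt_flowQ N hN hτ, fun τ hτ => hasDerivAt_flowW N hN hτ,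
    fun τ hτ => hasDerivAt_flowLog N hτ, flowW_pos_near N, hh0.congr' (hq.mono fun τ hτ => hτ.symm), ?_, ?_⟩
  · have hr := fun τ => (flowR_pos (2 * N + 1) τ).ne'
    have t1 := (tendsto_sq_div_sin_half hh h1).comp hβ
    have t2 := (hh.deriv.continuousAt.tendsto.mono_left (nhdsWithin_le_nhds (s := Set.Ioi 0))).comp hβ
    have t3 := tendsto_flowL hk
    have t4 := (t3.mul t1).add ((((t3.pow 2).mul t2).mul (hh0.sub_const 1)).const_mul (2 / (2 * (N : ℝ) + 1)))
    simp only [mul_zero, sub_self, add_zero] at t4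
    refine t4.congr' ?_
    have hev : ∀ᶠ τ in atTop, ∀ᶠ t in nhds τ, arcQ N (flowθ (2 * N + 1) t) = h (Real.pi - flowθ (2 * N + 1) t) := by
      obtain ⟨T, hT⟩ := eventually_atTop.1 hq
      filter_upwards [eventually_gt_atTop T] with τ hτ
      filter_upwards [lt_mem_nhds hτ] with t ht
      exact hT t ht.le
    filter_upwards [hev, eventually_gt_atTop 0,
      hβ.eventually (hh.eventually_analyticAt.filter_mono nhdsWithin_le_nhds)] with τ e1 e2 e3
    have hl := (flowL_pos hk e2).ne'
    have d1 := e3.differentiableAt.hasDerivAt.comp τ ((hasDerivAt_flowθ hk τ).const_sub Real.pi)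
    have d2 := (d1.congr_of_eventuallyEq e1).unique (hasDerivAt_flowQ N hN e2)
    have e4 := e1.self_of_nhds
    simp only [Function.comp_apply, sin_pi_sub_flowθ_half, e4] at d2 ⊢
    have hrτ := hr τ
    have d3 : √(1 - flowR (2 * N + 1) τ ^ 2 * flowW N τ ^ 2) * flowW N τ - 1 / flowL (2 * N + 1) τ =
        (h (Real.pi - flowθ (2 * N + 1) τ) - 1) / flowL (2 * N + 1) τ
          + deriv h (Real.pi - flowθ (2 * N + 1) τ) * (2 * (flowR (2 * N + 1) τ / (2 * N + 1))) := by
      rw [sub_div]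
      linarith
    rw [d3]
    generalize flowR (2 * N + 1) τ = r at *
    generalize flowL (2 * N + 1) τ = l at *
    generalize h (Real.pi - flowθ (2 * N + 1) τ) = y at *
    generalize deriv h (Real.pi - flowθ (2 * N + 1) τ) = y' at *
    field_simp
  · have t1 := (tendsto_log_det_arcMatrix_sub (N + 1)).comp hβ
    have t2 := (((tendsto_flowL hk).div_const (2 * (N : ℝ) + 1)).log (by rw [div_self hk.ne']; exact one_ne_zero)).const_mul (1 / 4)
    have t3 := t1.add t2
    simp only [div_self hk.ne', Real.log_one, mul_zero, add_zero, Function.comp_def, sin_pi_sub_flowθ_half,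
      sub_sub_cancel, Nat.cast_add, Nat.cast_one] at t3
    exact t3

theorem sineMatrix_eq_arcMatrix {n : ℕ} (hn : 0 < n) {α : ℝ} (hα : 0 < α) :
    sineMatrix n α = arcMatrix n (α / n) := by
  have hn' : (n : ℝ) ≠ 0 := by positivity
  have hpi := Real.pi_ne_zero
  ext j k
  simp only [sineMatrix, arcMatrix, Matrix.of_apply, sineKernel]
  by_cases hjk : j = k
  · subst hjk
    simp
    field_simp
  · have h : (j : ℝ) - k ≠ 0 := by
      rw [sub_ne_zero]
      exact_mod_cast fun h => hjk (Fin.ext h)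
    have h2 : α * ((j : ℝ) - k) / n ≠ 0 := by positivity
    rw [if_neg hjk, if_neg hjk, if_neg h2, show α * ((j : ℝ) - k) / n = ((j : ℝ) - k) * (α / n) by ring]
    field_simp
    ring

theorem tendsto_div_natCast_nhdsNE {α : ℝ} (hα : 0 < α) :
    Tendsto (fun n : ℕ => α / (n : ℝ)) atTop (nhdsWithin 0 (Set.Ioi 0)) := by
  refine tendsto_nhdsWithin_of_tendsto_nhds_of_eventually_within _
    (tendsto_const_nhds.div_atTop tendsto_natCast_atTop_atTop) ?_
  filter_upwards [eventually_gt_atTop 0] with n hn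
  have : (0 : ℝ) < n := by exact_mod_cast hn
  exact div_pos hα this

theorem tendsto_natCast_mul_sin_div {α : ℝ} (hα : 0 < α) :
    Tendsto (fun n : ℕ => (n : ℝ) * Real.sin (α / n)) atTop (nhds α) := by
  have h1 := ((hasDerivAt_iff_tendsto_slope.1 (Real.hasDerivAt_sin 0)).mono_left
    (nhdsWithin_mono (0 : ℝ) (s := Set.Ioi 0) fun x (hx : 0 < x) => hx.ne')).comp (tendsto_div_natCast_nhdsNE hα)
  rw [Real.cos_zero] at h1
  have h2 := h1.const_mul α
  rw [mul_one] at h2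
  refine h2.congr' ?_
  filter_upwards [eventually_gt_atTop 0] with n hn
  have : (0 : ℝ) < n := by exact_mod_cast hn
  simp only [Function.comp, slope_def_field, Real.sin_zero, sub_zero]
  field_simp

theorem tendsto_natCast_sq_mul_log_cos_div {α : ℝ} (hα : 0 < α) :
    Tendsto (fun n : ℕ => (n : ℝ) ^ 2 * Real.log (Real.cos (α / n))) atTop (nhds (-(α ^ 2 / 2))) := by
  have hd := tendsto_div_natCast_nhdsNE hα
  have hs : ∀ᶠ n : ℕ in atTop, 0 < Real.sin (α / n) ∧ 0 < Real.cos (α / n) := by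
    filter_upwards [hd.eventually (Ioo_mem_nhdsGT (half_pos Real.pi_pos))] with n hn
    exact ⟨Real.sin_pos_of_pos_of_lt_pi hn.1 (by linarith [hn.2, Real.pi_pos]),
      Real.cos_pos_of_mem_Ioo ⟨by linarith [hn.1, Real.pi_pos], hn.2⟩⟩
  have h0 : Tendsto (fun n : ℕ => 1 - Real.sin (α / n) ^ 2) atTop (nhdsWithin 1 {1}ᶜ) := by
    refine tendsto_nhdsWithin_of_tendsto_nhds_of_eventually_within _ ?_ ?_
    · have := (((Real.continuous_sin.tendsto 0).comp (hd.mono_right nhdsWithin_le_nhds)).pow 2).const_sub 1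
      simpa using this
    · filter_upwards [hs] with n hn
      have := pow_pos hn.1 2
      simp only [Set.mem_compl_iff, Set.mem_singleton_iff]
      intro h
      linarith
  have h1 := (hasDerivAt_iff_tendsto_slope.1 (Real.hasDerivAt_log one_ne_zero)).comp h0
  have h2 := (((tendsto_natCast_mul_sin_div hα).pow 2).mul h1).const_mul (-(1 / 2))
  have e : -(1 / 2) * (α ^ 2 * 1⁻¹) = -(α ^ 2 / 2) := by ring
  rw [e] at h2
  refine h2.congr' ?_
  filter_upwards [hs] with n hn
  have h3 : 1 - Real.sin (α / n) ^ 2 = Real.cos (α / n) ^ 2 := by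
    have := Real.sin_sq_add_cos_sq (α / n)
    linarith
  have h4 := hn.1.ne'
  have h5 : Real.cos (α / n) ^ 2 - 1 = -Real.sin (α / n) ^ 2 := by linarith
  simp only [Function.comp, slope_def_field, Real.log_one, sub_zero, h3, h5, Real.log_pow]
  push_cast
  field_simp

/-- The flow parameter corresponding to the half angle `x`. -/
theorem exists_flowθ_eq {k x : ℝ} (hk : 0 < k) (h0 : 0 < x) (hx : x < Real.pi / 2) :
    ∃ τ, 0 < τ ∧ flowθ k τ = 2 * x := by
  refine ⟨k * Real.arsinh (Real.tan x), mul_pos hk (Real.arsinh_pos_iff.2 (Real.tan_pos_of_pos_of_lt_pi_div_two h0 hx)), ?_⟩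
  rw [flowθ, mul_div_cancel_left₀ _ hk.ne', Real.sinh_arsinh, Real.arctan_tan (by linarith) hx]

/-- The normalised log-determinant of the sine matrix before passing to the limit. -/
theorem tendsto_flow_error {α : ℝ} (hα : 0 < α) :
    Tendsto (fun N : ℕ => (-((N : ℝ) + 1) ^ 2 * Real.log (Real.cos (α / (N + 1)))
      + 1 / 4 * Real.log (Real.sin (α / (N + 1)))) - (2 * ((N : ℝ) + 1) ^ 2 * Real.log 2
        - (N + 1) * Real.log (2 * Real.pi) + Real.log (hilbertMatrix (N + 1)).det)) atTop
      (nhds (α ^ 2 / 2 + Real.log α / 4 - (Real.log 2 / 12 + 3 * (deriv riemannZeta (-1)).re))) := by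
  have h1 := (tendsto_natCast_sq_mul_log_cos_div hα).neg
  have h2 := ((tendsto_natCast_mul_sin_div hα).log hα.ne').const_mul (1 / 4)
  have h3 := ((h1.add h2).sub tendsto_log_det_hilbertMatrix).comp (tendsto_add_atTop_nat 1)
  have e : -(-(α ^ 2 / 2)) + 1 / 4 * Real.log α - (Real.log 2 / 12 + 3 * (deriv riemannZeta (-1)).re) =
    α ^ 2 / 2 + Real.log α / 4 - (Real.log 2 / 12 + 3 * (deriv riemannZeta (-1)).re) := by ring
  rw [e] at h3
  refine h3.congr' ?_
  have hd := (tendsto_div_natCast_nhdsNE hα).comp (tendsto_add_atTop_nat 1)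
  filter_upwards [hd.eventually (Ioo_mem_nhdsGT Real.pi_pos)] with N hN
  simp only [Function.comp_apply, Nat.cast_add, Nat.cast_one] at hN ⊢
  have hs : 0 < Real.sin (α / (N + 1)) := Real.sin_pos_of_pos_of_lt_pi hN.1 hN.2
  rw [Real.log_mul (by positivity) hs.ne']
  ring

theorem log_det_sineMatrix_bound {ε : ℝ} (hε : 0 < ε) : ∃ K > 0, ∀ α, K < α → ∀ᶠ n : ℕ in atTop,
    |Real.log (sineMatrix n (2 * α)).det + α ^ 2 / 2 + Real.log α / 4
      - (Real.log 2 / 12 + 3 * (deriv riemannZeta (-1)).re)| ≤ ε := by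
  obtain ⟨K, hK, hU⟩ := IsDysonFlow.uniform_limit (ε / 2) (half_pos hε)
  refine ⟨K, hK, fun α hα => ?_⟩
  have hα0 : 0 < α := hK.trans hα
  obtain ⟨k₀, hk₀⟩ := hU (2 * α + 1)
  suffices h : ∀ᶠ N : ℕ in atTop, |Real.log (sineMatrix (N + 1) (2 * α)).det + α ^ 2 / 2 + Real.log α / 4
      - (Real.log 2 / 12 + 3 * (deriv riemannZeta (-1)).re)| ≤ ε by
    filter_upwards [(tendsto_sub_atTop_nat 1).eventually h, eventually_ge_atTop 1] with n hn h1
    rwa [Nat.sub_add_cancel h1] at hn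
  have hd := (tendsto_div_natCast_nhdsNE hα0).comp (tendsto_add_atTop_nat 1)
  have hl : Tendsto (fun N : ℕ => (2 * (N : ℝ) + 1) * Real.sin (α / (N + 1))) atTop (nhds (2 * α)) := by
    have h1 := ((tendsto_natCast_mul_sin_div hα0).const_mul 2).comp (tendsto_add_atTop_nat 1)
    have h2 := (Real.continuous_sin.tendsto 0).comp (hd.mono_right nhdsWithin_le_nhds)
    rw [Real.sin_zero] at h2
    have h3 := h1.sub h2
    rw [sub_zero] at h3
    refine h3.congr fun N => ?_
    simp only [Function.comp_apply, Nat.cast_add, Nat.cast_one]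
    ring
  have hk : ∀ᶠ N : ℕ in atTop, k₀ ≤ 2 * (N : ℝ) + 1 := by
    have : Tendsto (fun N : ℕ => (N : ℝ)) atTop atTop := tendsto_natCast_atTop_atTop
    filter_upwards [this.eventually_ge_atTop k₀] with N hN
    have : (0 : ℝ) ≤ N := Nat.cast_nonneg N
    linarith
  have hE := (tendsto_flow_error hα0).eventually (Metric.ball_mem_nhds _ (half_pos hε))
  filter_upwards [hd.eventually (Ioo_mem_nhdsGT (half_pos Real.pi_pos)), hk, hE,
    hl.eventually_const_le (u := K) (by linarith), hl.eventually_le_const (u := 2 * α + 1) (by linarith),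
    eventually_gt_atTop 0] with N e1 e2 e3 e4 e5 e6
  simp only [Function.comp_apply, Nat.cast_add, Nat.cast_one] at e1
  have hkp := two_mul_add_one_pos N
  obtain ⟨τ, hτ, hθ⟩ := exists_flowθ_eq hkp e1.1 e1.2
  have hL : flowL (2 * N + 1) τ = (2 * N + 1) * Real.sin (α / (N + 1)) := by
    have := sin_flowθ_half hkp τ
    rw [hθ, mul_div_cancel_left₀ _ two_ne_zero] at this
    rw [this]; field_simp
  have hR : flowR (2 * N + 1) τ = Real.cos (α / (N + 1)) := by
    rw [← cos_flowθ_half, hθ, mul_div_cancel_left₀ _ two_ne_zero]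
  have h1 := hk₀ _ _ _ _ _ (isDysonFlow_arc N e6) e2 τ hτ (by rw [hL]; exact e4) (by rw [hL]; exact e5)
  have hM : sineMatrix (N + 1) (2 * α) = arcMatrix (N + 1) (2 * (α / (N + 1))) := by
    rw [sineMatrix_eq_arcMatrix (Nat.succ_pos N) (by linarith)]
    push_cast
    rw [mul_div_assoc]
  rw [flowLog, hθ, ← hM, hL, hR, mul_div_cancel_left₀ _ hkp.ne'] at h1
  rw [Real.dist_eq] at e3
  rw [abs_le] at h1 ⊢
  rw [abs_lt] at e3
  constructor <;> linarith [h1.1, h1.2, e3.1, e3.2]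

section PosDefComparison
open Matrix
variable {ι : Type*} [Fintype ι] [DecidableEq ι]

theorem Matrix.PosDef.log_det_le_trace_sub_card {Z : Matrix ι ι ℝ} (hZ : Z.PosDef) :
    Real.log Z.det ≤ Z.trace - Fintype.card ι := by
  have hd := hZ.1.det_eq_prod_eigenvalues
  have ht := hZ.1.trace_eq_sum_eigenvalues
  simp only [RCLike.ofReal_real_eq_id, id] at hd ht
  rw [hd, ht, Real.log_prod fun i _ => (hZ.eigenvalues_pos i).ne', ← Finset.card_univ,
    Finset.card_eq_sum_ones, Nat.cast_sum, ← Finset.sum_sub_distrib]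
  refine Finset.sum_le_sum fun i _ => ?_
  simpa using Real.log_le_sub_one_of_pos (hZ.eigenvalues_pos i)

open scoped MatrixOrder Matrix.Norms.L2Operator in
theorem Matrix.PosDef.exists_eq_transpose_mul_self {X : Matrix ι ι ℝ} (hX : X.PosDef) :
    ∃ B : Matrix ι ι ℝ, X = Bᵀ * B := by
  obtain ⟨B, hB⟩ := CStarAlgebra.nonneg_iff_eq_star_mul_self.mp hX.posSemidef.nonneg
  exact ⟨B, by rw [hB, star_eq_conjTranspose, conjTranspose_eq_transpose_of_trivial]⟩

theorem Matrix.PosDef.log_det_sub_log_det_le {X Y : Matrix ι ι ℝ} (hX : X.PosDef) (hY : Y.PosDef) :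
    Real.log Y.det - Real.log X.det ≤ (X⁻¹ * (Y - X)).trace := by
  obtain ⟨B, rfl⟩ := hX.exists_eq_transpose_mul_self
  have hdet : (Bᵀ * B).det = B.det * B.det := by rw [det_mul, det_transpose]
  have hBd : B.det ≠ 0 := fun h => hX.det_pos.ne' (by rw [hdet, h, zero_mul])
  have hBu : IsUnit B.det := hBd.isUnit
  have hinj : Function.Injective B⁻¹.mulVec :=
    mulVec_injective_of_isUnit ((isUnit_iff_isUnit_det _).2 (isUnit_nonsing_inv_det B hBu))
  have hZ := hY.conjTranspose_mul_mul_same hinj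
  rw [conjTranspose_eq_transpose_of_trivial] at hZ
  have h := hZ.log_det_le_trace_sub_card
  have h1 : ((B⁻¹)ᵀ * Y * B⁻¹).det = Y.det / (Bᵀ * B).det := by
    rw [hdet, det_mul, det_mul, det_transpose, det_nonsing_inv, Ring.inverse_eq_inv']
    field_simp
  have h2 : ((B⁻¹)ᵀ * Y * B⁻¹).trace = ((Bᵀ * B)⁻¹ * Y).trace := by
    rw [trace_mul_comm, mul_inv_rev, transpose_nonsing_inv, Matrix.mul_assoc]
  rw [h1, h2, Real.log_div hY.det_pos.ne' hX.det_pos.ne'] at h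
  rw [mul_sub, nonsing_inv_mul _ hX.det_pos.ne'.isUnit, trace_sub, trace_one]
  exact h

theorem Matrix.PosDef.log_det_sub_log_det_le_of_entries [Nonempty ι] {X Y : Matrix ι ι ℝ} (hX : X.PosDef) (hY : Y.PosDef)
    {C δ : ℝ} (hC : ∀ i j, |(X⁻¹ - 1) i j| ≤ C / Fintype.card ι)
    (hδ : ∀ i j, |(Y - X) i j| ≤ δ / Fintype.card ι) :
    Real.log Y.det - Real.log X.det ≤ (1 + C) * δ := by
  have i₀ := Classical.arbitrary ι
  have hL : (0 : ℝ) < Fintype.card ι := by exact_mod_cast Fintype.card_pos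
  refine (hX.log_det_sub_log_det_le hY).trans ?_
  have h1 : X⁻¹ * (Y - X) = (Y - X) + (X⁻¹ - 1) * (Y - X) := by rw [sub_mul, one_mul]; abel
  have hC0 : 0 ≤ C / Fintype.card ι := (abs_nonneg _).trans (hC i₀ i₀)
  have h2 : (Y - X).trace ≤ δ := by
    calc (Y - X).trace ≤ ∑ _i : ι, δ / Fintype.card ι :=
          Finset.sum_le_sum fun i _ => (le_abs_self _).trans (hδ i i)
      _ = δ := by
        rw [Finset.sum_const, Finset.card_univ, nsmul_eq_mul]
        field_simp
  have h3 : ((X⁻¹ - 1) * (Y - X)).trace ≤ C * δ := by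
    calc ((X⁻¹ - 1) * (Y - X)).trace
        ≤ ∑ _i : ι, ∑ _j : ι, (C / Fintype.card ι) * (δ / Fintype.card ι) := by
          refine Finset.sum_le_sum fun i _ => ?_
          rw [diag_apply, mul_apply]
          refine Finset.sum_le_sum fun j _ => (le_abs_self _).trans ?_
          rw [abs_mul]
          exact mul_le_mul (hC i j) (hδ j i) (abs_nonneg _) hC0
      _ = C * δ := by
        simp only [Finset.sum_const, Finset.card_univ, nsmul_eq_mul]
        field_simp
  rw [h1, trace_add]
  linarith

theorem Matrix.PosDef.mul_dotProduct_self_le {M : Matrix ι ι ℝ} (hM : M.PosDef)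
    (h1 : ∀ x : ι → ℝ, x ⬝ᵥ M.mulVec x ≤ x ⬝ᵥ x) (x : ι → ℝ) : M.det * (x ⬝ᵥ x) ≤ x ⬝ᵥ M.mulVec x := by
  have hle : ∀ i, hM.1.eigenvalues i ≤ 1 := by
    intro i
    have h2 := h1 (hM.1.eigenvectorBasis i).ofLp
    have hn : (hM.1.eigenvectorBasis i).ofLp ⬝ᵥ (hM.1.eigenvectorBasis i).ofLp = 1 := by
      have := hM.1.eigenvectorBasis.inner_eq_one i
      rw [EuclideanSpace.inner_eq_star_dotProduct] at this
      simpa using this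
    rw [hM.1.mulVec_eigenvectorBasis, dotProduct_smul, hn] at h2
    simpa using h2
  have hge : ∀ i, M.det ≤ hM.1.eigenvalues i := by
    intro i
    have hd := hM.1.det_eq_prod_eigenvalues
    simp only [RCLike.ofReal_real_eq_id, id] at hd
    rw [hd, ← Finset.mul_prod_erase _ _ (Finset.mem_univ i)]
    exact mul_le_of_le_one_right (hM.eigenvalues_pos i).le
      (Finset.prod_le_one (fun j _ => (hM.eigenvalues_pos j).le) fun j _ => hle j)
  have hP : (diagonal (fun i => hM.1.eigenvalues i - M.det)).PosSemidef :=
    PosSemidef.diagonal fun i => sub_nonneg.2 (hge i)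
  have hQ := hP.mul_mul_conjTranspose_same (hM.1.eigenvectorUnitary : Matrix ι ι ℝ)
  have hs := hM.1.spectral_theorem
  rw [Unitary.conjStarAlgAut_apply] at hs
  have hU : (hM.1.eigenvectorUnitary : Matrix ι ι ℝ) * (hM.1.eigenvectorUnitary : Matrix ι ι ℝ)ᴴ = 1 := by
    rw [← star_eq_conjTranspose]; exact Unitary.coe_mul_star_self _
  have hE : (hM.1.eigenvectorUnitary : Matrix ι ι ℝ) * diagonal (fun i => hM.1.eigenvalues i - M.det) *
      (hM.1.eigenvectorUnitary : Matrix ι ι ℝ)ᴴ = M - M.det • (1 : Matrix ι ι ℝ) := by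
    have hd : diagonal (fun i => hM.1.eigenvalues i - M.det) =
        diagonal (RCLike.ofReal ∘ hM.1.eigenvalues) - M.det • (1 : Matrix ι ι ℝ) := by
      rw [smul_one_eq_diagonal, diagonal_sub]; rfl
    rw [hd, mul_sub, sub_mul, mul_smul_comm, smul_mul_assoc, mul_one, hU]
    congr 1
    exact hs.symm
  rw [hE] at hQ
  have := hQ.dotProduct_mulVec_nonneg x
  rw [star_trivial, sub_mulVec, dotProduct_sub, smul_mulVec, one_mulVec, dotProduct_smul, smul_eq_mul] at this
  linarith

theorem Matrix.PosDef.dotProduct_inv_mulVec_le {M : Matrix ι ι ℝ} (hM : M.PosDef)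
    (h1 : ∀ x : ι → ℝ, x ⬝ᵥ M.mulVec x ≤ x ⬝ᵥ x) {c : ℝ} (hc : 0 < c) (hcM : c ≤ M.det) (x : ι → ℝ) :
    x ⬝ᵥ M⁻¹.mulVec x ≤ (x ⬝ᵥ x) / c := by
  set y := M⁻¹.mulVec x with hy
  have hMy : M.mulVec y = x := by
    rw [hy, mulVec_mulVec, mul_nonsing_inv _ hM.det_pos.ne'.isUnit, one_mulVec]
  have h2 := hM.mul_dotProduct_self_le h1 y
  rw [hMy, dotProduct_comm y x] at h2
  have hyy : 0 ≤ y ⬝ᵥ y := Finset.sum_nonneg fun i _ => mul_self_nonneg (y i)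
  have h3 : c * (y ⬝ᵥ y) ≤ x ⬝ᵥ y := (mul_le_mul_of_nonneg_right hcM hyy).trans h2
  have h4 : 0 ≤ (x - c • y) ⬝ᵥ (x - c • y) := Finset.sum_nonneg fun i _ => mul_self_nonneg _
  simp only [sub_dotProduct, dotProduct_sub, smul_dotProduct, dotProduct_smul, smul_eq_mul, dotProduct_comm y x] at h4
  rw [le_div_iff₀ hc]
  nlinarith

end PosDefComparison

section Isometry
open Matrix
variable {ι κ : Type*} [Fintype ι] [DecidableEq ι] [Fintype κ] [DecidableEq κ]

/-- The extension by the identity of a matrix along an isometry `U`. -/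
theorem posDef_one_sub_isometry {M : Matrix ι ι ℝ} (hM : M.PosDef) {U : Matrix κ ι ℝ} (hU : Uᵀ * U = 1) :
    (1 - U * (1 - M) * Uᵀ).PosDef ∧ (1 - U * (1 - M) * Uᵀ).det = M.det ∧
      (1 - U * (1 - M) * Uᵀ)⁻¹ - 1 = U * (M⁻¹ - 1) * Uᵀ := by
  have hMu : IsUnit M.det := hM.det_pos.ne'.isUnit
  have hdet : (1 - U * (1 - M) * Uᵀ).det = M.det := by
    rw [Matrix.mul_assoc, det_one_sub_mul_comm, Matrix.mul_assoc, hU, Matrix.mul_one, sub_sub_cancel]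
  have hE : (1 - U * (1 - M) * Uᵀ) = (1 - U * Uᵀ) + U * M * Uᵀ := by
    rw [Matrix.mul_sub, Matrix.sub_mul, Matrix.mul_one]; abel
  have hP : (1 - U * Uᵀ).PosSemidef := by
    have h := posSemidef_conjTranspose_mul_self (1 - U * Uᵀ)
    have h2 : (1 - U * Uᵀ)ᴴ * (1 - U * Uᵀ) = 1 - U * Uᵀ := by
      have h3 : U * Uᵀ * (U * Uᵀ) = U * Uᵀ := by
        rw [Matrix.mul_assoc, ← Matrix.mul_assoc Uᵀ U, hU, Matrix.one_mul]
      rw [conjTranspose_eq_transpose_of_trivial, transpose_sub, transpose_one, transpose_mul, transpose_transpose,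
        Matrix.sub_mul, Matrix.one_mul, Matrix.mul_sub, Matrix.mul_one, h3, sub_self, sub_zero]
    rwa [h2] at h
  have hQ : (U * M * Uᵀ).PosSemidef := by
    have := hM.posSemidef.mul_mul_conjTranspose_same U
    rwa [conjTranspose_eq_transpose_of_trivial] at this
  refine ⟨?_, hdet, ?_⟩
  · rw [PosSemidef.posDef_iff_isUnit (by rw [hE]; exact hP.add hQ), isUnit_iff_isUnit_det, hdet]
    exact hMu
  · have : (1 - U * (1 - M) * Uᵀ) * (1 + U * (M⁻¹ - 1) * Uᵀ) = 1 := by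
      have h3 : U * (1 - M) * Uᵀ * (U * (M⁻¹ - 1) * Uᵀ) = U * ((1 - M) * (M⁻¹ - 1)) * Uᵀ := by
        simp only [Matrix.mul_assoc]
        rw [← Matrix.mul_assoc Uᵀ U, hU, Matrix.one_mul]
      have h4 : (1 - M) * (M⁻¹ - 1) = (M⁻¹ - 1) - (1 - M) := by
        rw [Matrix.sub_mul, Matrix.mul_sub M, mul_nonsing_inv _ hMu, Matrix.one_mul, Matrix.mul_one]
      rw [Matrix.sub_mul, Matrix.one_mul, Matrix.mul_add, Matrix.mul_one, h3, h4,
        Matrix.mul_sub U (M⁻¹ - 1) (1 - M), Matrix.sub_mul (U * (M⁻¹ - 1))]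
      abel
    rw [inv_eq_right_inv this, add_sub_cancel_left]

end Isometry

theorem sineKernel_eq_sinc (x : ℝ) : sineKernel x = Real.sinc x / Real.pi := by
  rw [sineKernel, Real.sinc_apply]
  split_ifs
  · rfl
  · rw [div_div, mul_comm]

theorem sinc_eq_integral_cos (x : ℝ) : Real.sinc x = ∫ t in (0 : ℝ)..1, Real.cos (t * x) := by
  by_cases hx : x = 0
  · simp [hx]
  · rw [intervalIntegral.integral_comp_mul_right _ hx, integral_cos, Real.sinc_of_ne_zero hx]
    simp [div_eq_inv_mul]

theorem abs_cos_sub_cos_le (x y : ℝ) : |Real.cos x - Real.cos y| ≤ |x - y| := by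
  have := Convex.norm_image_sub_le_of_norm_deriv_le (f := Real.cos) (C := 1) (s := Set.univ) (x := y) (y := x)
    (fun t _ => Real.differentiable_cos t) (fun t _ => by
      rw [Real.deriv_cos, norm_neg]; exact Real.abs_sin_le_one t) convex_univ (Set.mem_univ _) (Set.mem_univ _)
  simpa using this

theorem abs_sinc_sub_sinc_le (x y : ℝ) : |Real.sinc x - Real.sinc y| ≤ |x - y| := by
  have hi : ∀ z : ℝ, IntervalIntegrable (fun t => Real.cos (t * z)) MeasureTheory.volume 0 1 := fun z =>
    (by fun_prop : Continuous fun t : ℝ => Real.cos (t * z)).intervalIntegrable _ _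
  rw [sinc_eq_integral_cos, sinc_eq_integral_cos, ← intervalIntegral.integral_sub (hi x) (hi y)]
  have := intervalIntegral.norm_integral_le_of_norm_le_const (a := 0) (b := 1) (C := |x - y|)
    (f := fun t => Real.cos (t * x) - Real.cos (t * y)) (fun t ht => ?_)
  · simpa using this
  · rw [Set.uIoc_of_le zero_le_one] at ht
    refine (abs_cos_sub_cos_le _ _).trans ?_
    rw [← mul_sub, abs_mul, abs_of_pos ht.1]
    exact mul_le_of_le_one_left (abs_nonneg _) ht.2

theorem abs_sineKernel_le (x : ℝ) : |sineKernel x| ≤ 1 := by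
  rw [sineKernel_eq_sinc, abs_div, abs_of_pos Real.pi_pos, div_le_one Real.pi_pos]
  exact (Real.abs_sinc_le_one x).trans (by linarith [Real.pi_gt_three])

theorem abs_sineKernel_sub_le (x y : ℝ) : |sineKernel x - sineKernel y| ≤ |x - y| := by
  rw [sineKernel_eq_sinc, sineKernel_eq_sinc, ← sub_div, abs_div, abs_of_pos Real.pi_pos]
  exact (div_le_self (abs_nonneg _) (by linarith [Real.pi_gt_three])).trans (abs_sinc_sub_sinc_le x y)

theorem one_sub_sineMatrix_apply (n : ℕ) (α : ℝ) (i j : Fin n) :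
    (1 - sineMatrix n α) i j = α / n * sineKernel (α * ((i : ℝ) - j) / n) := by
  simp [sineMatrix, Matrix.one_apply]

theorem abs_one_sub_sineMatrix_apply_le {n : ℕ} {α : ℝ} (hα : 0 < α) (i j : Fin n) :
    |(1 - sineMatrix n α) i j| ≤ α / n := by
  rw [one_sub_sineMatrix_apply, abs_mul, abs_of_nonneg (by positivity)]
  exact mul_le_of_le_one_right (by positivity) (abs_sineKernel_le _)

theorem abs_sineMatrix_inv_sub_one_apply_le {n : ℕ} (hn : 0 < n) {α : ℝ} (hα : 0 < α) (hαn : α / n < Real.pi)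
    {c : ℝ} (hc : 0 < c) (hcM : c ≤ (sineMatrix n α).det) (i j : Fin n) :
    |((sineMatrix n α)⁻¹ - 1) i j| ≤ (α + α ^ 2 / c) / n := by
  have h0 : 0 ≤ α / n := by positivity
  have hn' : (0 : ℝ) < n := by exact_mod_cast hn
  have hle := abs_one_sub_sineMatrix_apply_le (n := n) hα
  rw [sineMatrix_eq_arcMatrix hn hα] at hcM hle ⊢
  have hM := posDef_arcMatrix n h0 hαn
  have hu := isUnit_det_arcMatrix n h0 hαn
  have hM1 : ∀ x : Fin n → ℝ, x ⬝ᵥ (arcMatrix n (α / n)).mulVec x ≤ x ⬝ᵥ x := fun x => by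
    have := antitone_dotProduct_arcMatrix n x h0
    simpa [arcMatrix_zero] using this
  set M := arcMatrix n (α / n) with hMdef
  set a : Fin n → Fin n → ℝ := fun i k => (1 - M) i k with ha
  have hsymm : ∀ i j, (1 - M) i j = (1 - M) j i := fun i j => by
    have h : (1 - M).transpose = 1 - M := by
      rw [Matrix.transpose_sub, Matrix.transpose_one, hMdef, arcMatrix_transpose]
    exact (congrFun (congrFun h i) j).symm
  have hform : ∀ i j, ((1 - M) * M⁻¹ * (1 - M)) i j = arcForm n (α / n) (a i) (a j) := fun i j => by
    rw [arcForm, Matrix.mul_assoc, Matrix.mul_apply]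
    refine Finset.sum_congr rfl fun k _ => ?_
    rw [Matrix.mul_apply]
    congr 1
    exact Finset.sum_congr rfl fun l _ => by rw [hsymm l j]
  have haa : ∀ i, arcForm n (α / n) (a i) (a i) ≤ α ^ 2 / c / n := fun i => by
    refine (hM.dotProduct_inv_mulVec_le hM1 hc hcM (a i)).trans ?_
    have : a i ⬝ᵥ a i ≤ ∑ _k : Fin n, (α / n) ^ 2 := by
      refine Finset.sum_le_sum fun k _ => ?_
      rw [← sq, ← sq_abs]
      exact pow_le_pow_left₀ (abs_nonneg _) (hle i k) 2
    rw [Finset.sum_const, Finset.card_univ, Fintype.card_fin, nsmul_eq_mul] at this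
    rw [div_right_comm]
    refine div_le_div_of_nonneg_right (this.trans_eq ?_) hc.le
    field_simp
  have hb : |arcForm n (α / n) (a i) (a j)| ≤ α ^ 2 / c / n := by
    refine abs_le_of_sq_le_sq ?_ (by positivity)
    refine (arcForm_sq_le n h0 hαn _ _).trans ?_
    rw [sq]
    exact mul_le_mul (haa i) (haa j) (arcForm_self_nonneg n h0 hαn _) (by positivity)
  have hid : M⁻¹ - 1 = (1 - M) + (1 - M) * M⁻¹ * (1 - M) := by
    rw [sub_mul, one_mul, Matrix.mul_nonsing_inv _ hu, sub_mul, mul_sub, Matrix.nonsing_inv_mul _ hu]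
    simp only [mul_one, one_mul]
    abel
  rw [hid, Matrix.add_apply, hform, add_div]
  exact (abs_add_le _ _).trans (add_le_add (hle i j) hb)

theorem det_arcMatrix_antitoneOn (n : ℕ) : AntitoneOn (fun θ => (arcMatrix n θ).det) (Set.Ico 0 Real.pi) := by
  have h : AntitoneOn (fun θ => Real.log (arcMatrix n θ).det) (Set.Ico 0 Real.pi) := by
    refine antitoneOn_of_deriv_nonpos (convex_Ico _ _)
      (fun θ hθ => (hasDerivAt_log_det_arcMatrix n hθ.1 hθ.2).continuousAt.continuousWithinAt) (fun θ hθ => ?_)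
      fun θ hθ => ?_
    · have := interior_subset hθ
      exact (hasDerivAt_log_det_arcMatrix n this.1 this.2).differentiableAt.differentiableWithinAt
    · have := interior_subset hθ
      rw [(hasDerivAt_log_det_arcMatrix n this.1 this.2).deriv, neg_div]
      exact neg_nonpos.2 (div_nonneg (add_nonneg (arcForm_self_nonneg n this.1 this.2 _)
        (arcForm_self_nonneg n this.1 this.2 _)) Real.pi_pos.le)
  intro x hx y hy hxy
  exact (Real.log_le_log_iff (posDef_arcMatrix n hy.1 hy.2).det_pos (posDef_arcMatrix n hx.1 hx.2).det_pos).1 (h hx hy hxy)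

theorem eventually_div_natCast_lt_pi (α : ℝ) : ∀ᶠ n : ℕ in atTop, α / n < Real.pi :=
  (tendsto_const_div_atTop_nhds_zero_nat α).eventually_lt_const Real.pi_pos

theorem exists_le_det_sineMatrix {α : ℝ} (hα : 0 < α) :
    ∃ c > 0, ∀ᶠ n : ℕ in atTop, c ≤ (sineMatrix n α).det := by
  obtain ⟨K, hK, hb⟩ := log_det_sineMatrix_bound one_pos
  set β := α + K + 1
  have hβ := hb β (by simp only [β]; linarith)
  set E := Real.log 2 / 12 + 3 * (deriv riemannZeta (-1)).re - β ^ 2 / 2 - Real.log β / 4 - 1 with hE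
  refine ⟨Real.exp E, Real.exp_pos _, ?_⟩
  have hβ0 : 0 < 2 * β := by simp only [β]; linarith
  filter_upwards [hβ, eventually_gt_atTop 0, eventually_div_natCast_lt_pi (2 * β)] with n h1 hn h2
  have hn' : (0 : ℝ) < n := by exact_mod_cast hn
  have hle : α / n ≤ 2 * β / n := by
    apply div_le_div_of_nonneg_right _ hn'.le
    simp only [β]; linarith
  have h3 : Real.exp E ≤ (sineMatrix n (2 * β)).det := by
    have hpos : 0 < (sineMatrix n (2 * β)).det := by
      rw [sineMatrix_eq_arcMatrix hn hβ0]
      exact (posDef_arcMatrix n (by positivity) h2).det_pos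
    rw [← Real.le_log_iff_exp_le hpos]
    have := (abs_le.1 h1).1
    rw [hE]; linarith
  refine h3.trans ?_
  rw [sineMatrix_eq_arcMatrix hn hβ0, sineMatrix_eq_arcMatrix hn hα]
  exact det_arcMatrix_antitoneOn n ⟨by positivity, hle.trans_lt h2⟩ ⟨by positivity, h2⟩ hle

/-- The isometry from `ℝⁿ` to `ℝⁿ ⊗ ℝᵐ` onto vectors that are constant on blocks. -/
noncomputable def blockIsometry (n m : ℕ) : Matrix (Fin n × Fin m) (Fin n) ℝ :=
  Matrix.of fun p j => if p.1 = j then 1 / √(m : ℝ) else 0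

open Matrix in
theorem blockIsometry_transpose_mul_self {n m : ℕ} (hm : 0 < m) :
    (blockIsometry n m)ᵀ * blockIsometry n m = 1 := by
  have hm' : (0 : ℝ) < m := by exact_mod_cast hm
  have hs : (m : ℝ) * (1 / √(m : ℝ) * (1 / √(m : ℝ))) = 1 := by
    rw [div_mul_div_comm, Real.mul_self_sqrt hm'.le]; field_simp
  ext i j
  simp only [mul_apply, transpose_apply, blockIsometry, of_apply, Fintype.sum_prod_type, one_apply]
  by_cases hij : i = j
  · subst hij
    simp [-one_div, hs]
  · simp [hij, Ne.symm hij]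

open Matrix in
theorem blockIsometry_mul_mul_apply {n m : ℕ} (B : Matrix (Fin n) (Fin n) ℝ) (p q : Fin n × Fin m) :
    (blockIsometry n m * B * (blockIsometry n m)ᵀ) p q = B p.1 q.1 / m := by
  have hs : (1 / √(m : ℝ)) * (1 / √(m : ℝ)) = 1 / m := by
    rw [div_mul_div_comm, Real.mul_self_sqrt (Nat.cast_nonneg m), one_mul]
  simp only [mul_apply, transpose_apply, blockIsometry, of_apply, ite_mul, zero_mul, mul_ite, mul_zero,
    Finset.sum_ite_eq, Finset.mem_univ, if_true]
  rw [mul_right_comm, hs, one_div_mul_eq_div]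

theorem exists_abs_log_det_sineMatrix_mul_sub_le {α : ℝ} (hα : 0 < α) :
    ∃ C, ∀ᶠ n : ℕ in atTop, ∀ m : ℕ, 0 < m →
      |Real.log (sineMatrix (n * m) α).det - Real.log (sineMatrix n α).det| ≤ C / n := by
  obtain ⟨c, hc, hdet⟩ := exists_le_det_sineMatrix hα
  set B := α + α ^ 2 / c with hB
  refine ⟨(1 + B) * α ^ 2, ?_⟩
  obtain ⟨n₀, hn₀⟩ := eventually_atTop.1 ((hdet.and (eventually_div_natCast_lt_pi α)).and (eventually_gt_atTop 0))
  filter_upwards [eventually_ge_atTop n₀] with n hn m hm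
  obtain ⟨⟨hcn, hαn⟩, hn0⟩ := hn₀ n hn
  obtain ⟨⟨hcN, hαN⟩, hN0⟩ := hn₀ (n * m) (hn.trans (Nat.le_mul_of_pos_right n hm))
  have hn' : (0 : ℝ) < n := by exact_mod_cast hn0
  have hm' : (0 : ℝ) < m := by exact_mod_cast hm
  have : Nonempty (Fin n × Fin m) := ⟨(⟨0, hn0⟩, ⟨0, hm⟩)⟩
  have hcard : (Fintype.card (Fin n × Fin m) : ℝ) = n * m := by simp
  have hMn : (sineMatrix n α).PosDef := by
    rw [sineMatrix_eq_arcMatrix hn0 hα]; exact posDef_arcMatrix n (by positivity) hαn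
  have hMN : (sineMatrix (n * m) α).PosDef := by
    rw [sineMatrix_eq_arcMatrix hN0 hα]; exact posDef_arcMatrix _ (by positivity) hαN
  obtain ⟨hX, hXdet, hXinv⟩ := posDef_one_sub_isometry hMn (blockIsometry_transpose_mul_self (n := n) hm)
  set X := 1 - blockIsometry n m * (1 - sineMatrix n α) * (blockIsometry n m).transpose with hXdef
  set e : Fin n × Fin m ≃ Fin (n * m) := finProdFinEquiv
  set Y := (sineMatrix (n * m) α).submatrix e e with hYdef
  have hY : Y.PosDef := hMN.submatrix e.injective
  have hYdet : Y.det = (sineMatrix (n * m) α).det := Matrix.det_submatrix_equiv_self e _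
  have hXC : ∀ p q, |(X⁻¹ - 1) p q| ≤ B / Fintype.card (Fin n × Fin m) := fun p q => by
    rw [hXinv, blockIsometry_mul_mul_apply, hcard, abs_div, abs_of_pos hm', ← div_div]
    exact div_le_div_of_nonneg_right (abs_sineMatrix_inv_sub_one_apply_le hn0 hα hαn hc hcn _ _) hm'.le
  have hYC : ∀ p q, |(Y⁻¹ - 1) p q| ≤ B / Fintype.card (Fin n × Fin m) := fun p q => by
    have h1 : Y⁻¹ - 1 = ((sineMatrix (n * m) α)⁻¹ - 1).submatrix e e := by
      rw [hYdef, Matrix.inv_submatrix_equiv, Matrix.submatrix_sub]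
      simp only [Pi.sub_apply]
      rw [Matrix.submatrix_one_equiv]
    rw [h1, Matrix.submatrix_apply, hcard, ← Nat.cast_mul]
    exact abs_sineMatrix_inv_sub_one_apply_le hN0 hα hαN hc hcN _ _
  have hD : ∀ p q, |(Y - X) p q| ≤ (α ^ 2 / n) / Fintype.card (Fin n × Fin m) := fun p q => by
    have h1 : Y - X = blockIsometry n m * (1 - sineMatrix n α) * (blockIsometry n m).transpose -
        (1 - sineMatrix (n * m) α).submatrix e e := by
      rw [hXdef, Matrix.submatrix_sub]
      simp only [Pi.sub_apply]
      rw [Matrix.submatrix_one_equiv]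
      abel
    have hp : ∀ p : Fin n × Fin m, ((e p : ℕ) : ℝ) = p.2 + m * p.1 := fun p => by
      simp [e, finProdFinEquiv]
    rw [h1, Matrix.sub_apply, blockIsometry_mul_mul_apply, Matrix.submatrix_apply, one_sub_sineMatrix_apply,
      one_sub_sineMatrix_apply, hp, hp, hcard]
    have h2 : α / n * sineKernel (α * ((p.1 : ℝ) - q.1) / n) / m -
        α / ((n * m : ℕ) : ℝ) * sineKernel (α * ((p.2 + m * p.1 : ℝ) - (q.2 + m * q.1)) / ((n * m : ℕ) : ℝ)) =
        α / (n * m) * (sineKernel (α * ((p.1 : ℝ) - q.1) / n) -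
          sineKernel (α * ((p.2 + m * p.1 : ℝ) - (q.2 + m * q.1)) / ((n * m : ℕ) : ℝ))) := by
      push_cast; ring
    rw [h2, abs_mul, abs_of_pos (by positivity)]
    have hpq : |(p.2 : ℝ) - q.2| ≤ m := by
      have h3 : (p.2 : ℝ) ≤ m := by exact_mod_cast p.2.2.le
      have h4 : (q.2 : ℝ) ≤ m := by exact_mod_cast q.2.2.le
      have h5 : (0 : ℝ) ≤ p.2 := Nat.cast_nonneg _
      have h6 : (0 : ℝ) ≤ q.2 := Nat.cast_nonneg _
      rw [abs_le]; constructor <;> linarith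
    have h3 : |α * ((p.1 : ℝ) - q.1) / n - α * ((p.2 + m * p.1 : ℝ) - (q.2 + m * q.1)) / ((n * m : ℕ) : ℝ)|
        ≤ α / n := by
      have : α * ((p.1 : ℝ) - q.1) / n - α * ((p.2 + m * p.1 : ℝ) - (q.2 + m * q.1)) / ((n * m : ℕ) : ℝ) =
          -(α / (n * m) * ((p.2 : ℝ) - q.2)) := by
        push_cast; field_simp; ring
      rw [this, abs_neg, abs_mul, abs_of_pos (by positivity)]
      calc α / (n * m) * |(p.2 : ℝ) - q.2| ≤ α / (n * m) * m := by gcongr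
        _ = α / n := by field_simp
    calc _ ≤ α / (n * m) * (α / n) := by
          gcongr
          exact (abs_sineKernel_sub_le _ _).trans h3
      _ = _ := by field_simp
  have hD' : ∀ p q, |(X - Y) p q| ≤ (α ^ 2 / n) / Fintype.card (Fin n × Fin m) := fun p q => by
    rw [Matrix.sub_apply, abs_sub_comm]; exact hD p q
  have h1 := hX.log_det_sub_log_det_le_of_entries hY hXC hD
  have h2 := hY.log_det_sub_log_det_le_of_entries hX hYC hD'
  rw [hXdet, hYdet, ← mul_div_assoc] at h1 h2
  exact abs_le.2 ⟨by linarith, h1⟩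

theorem exists_tendsto_det_sineMatrix {α : ℝ} (hα : 0 < α) :
    ∃ D > 0, Tendsto (fun n : ℕ => (sineMatrix n α).det) atTop (nhds D) := by
  obtain ⟨C, hC⟩ := exists_abs_log_det_sineMatrix_mul_sub_le hα
  obtain ⟨n₀, hn₀⟩ := eventually_atTop.1 (hC.and (eventually_gt_atTop 0))
  have hlog : CauchySeq fun n : ℕ => Real.log (sineMatrix n α).det := by
    rw [Metric.cauchySeq_iff]
    intro ε hε
    obtain ⟨n₁, hn₁⟩ := eventually_atTop.1
      ((tendsto_const_div_atTop_nhds_zero_nat C).eventually_lt_const (half_pos hε))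
    refine ⟨max n₀ n₁, fun m hm n hn => ?_⟩
    obtain ⟨hm1, hm0⟩ := hn₀ m ((le_max_left _ _).trans hm)
    obtain ⟨hn1, hn0⟩ := hn₀ n ((le_max_left _ _).trans hn)
    have h1 := hm1 n hn0
    have h2 := hn1 m hm0
    rw [mul_comm n m] at h2
    have h3 := hn₁ m ((le_max_right _ _).trans hm)
    have h4 := hn₁ n ((le_max_right _ _).trans hn)
    rw [Real.dist_eq, abs_lt]
    rw [abs_le] at h1 h2
    constructor <;> linarith [h1.1, h1.2, h2.1, h2.2]
  obtain ⟨l, hl⟩ := cauchySeq_tendsto_of_complete hlog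
  refine ⟨Real.exp l, Real.exp_pos l, ((Real.continuous_exp.tendsto l).comp hl).congr' ?_⟩
  filter_upwards [eventually_gt_atTop 0, eventually_div_natCast_lt_pi α] with n hn h
  rw [Function.comp_apply, Real.exp_log]
  rw [sineMatrix_eq_arcMatrix hn hα]
  exact (posDef_arcMatrix n (by positivity) h).det_pos

/-- For every `α > 0` the limit `D(α) = lim_{n→∞} det M_n(α)` exists and is a positive
real number, and Dyson's asymptotic formula holds:
`log D(2α) + α²/2 + (log α)/4 → (log 2)/12 + 3ζ'(−1)` as `α → ∞`. -/
theorem stmt0 :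
    ∃ D : ℝ → ℝ,
      (∀ α : ℝ, 0 < α →
        0 < D α ∧ Tendsto (fun n : ℕ => (sineMatrix n α).det) atTop (nhds (D α))) ∧
      Tendsto (fun α : ℝ => Real.log (D (2 * α)) + α ^ 2 / 2 + Real.log α / 4) atTop
        (nhds (Real.log 2 / 12 + 3 * (deriv riemannZeta (-1)).re)) := by
  choose! D hDpos hD using fun (α : ℝ) (hα : 0 < α) => exists_tendsto_det_sineMatrix hα
  refine ⟨D, fun α hα => ⟨hDpos α hα, hD α hα⟩, Metric.tendsto_nhds.2 fun ε hε => ?_⟩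
  obtain ⟨K, hK, hb⟩ := log_det_sineMatrix_bound (half_pos hε)
  filter_upwards [eventually_gt_atTop K] with α hα
  have h2 : 0 < 2 * α := by linarith
  have hlim := (((((hD _ h2).log (hDpos _ h2).ne').add_const (α ^ 2 / 2)).add_const (Real.log α / 4)).sub_const
    (Real.log 2 / 12 + 3 * (deriv riemannZeta (-1)).re)).abs
  rw [Real.dist_eq]
  exact (le_of_tendsto hlim (hb α hα)).trans_lt (half_lt_self hε)

end
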